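/- arXiv:2409.14525 — 2 statements merged into one kernel-verified Lean document; each statement's English description precedes it below -/
import Mathlib

section
/- There exists a finitely generated group G that is not virtually free (G has no free subgroup of finite index) such that for every finite generating set S of G, all of the following problems are decidable (as computable predicates on encoded tilesets over (G,S)): the weak snake, weak infinite snake, strong snake, strong infinite snake, directed weak snake, directed weak infinite snake, directed strong snake, and directed strong infinite snake problems. -/
/-!
STATEMENT 1: There exists a finitely generated group `G` that is not virtually free such
that for every finite generating set `S` of `G`, all eight of the following problems are
decidable (as computable predicates on encoded tilesets over `(G,S)`): the weak snake,
weak infinite snake, strong snake, strong infinite snake, directed weak snake, directed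
weak infinite snake, directed strong snake and directed strong infinite snake problems.

Encoding: the generating set `S` is identified with `Fin m` via an injective enumeration
`e : Fin m → G` whose range is `S`.  An (undirected) tileset is encoded as `(k, D)` with
colour set `Fin k` (colours coded as naturals `< k`) and `D` a finite list of dominoes
`(c, s, c')` with `s < m` the generator index; a directed tileset has colour set
`Fin k × Fin m` (coded as pairs of naturals with explicit bounds).  Snakes are injective
maps `ω : ℤ/nℤ → G` with steps in `S`, with the convention `ZMod 0 = ℤ`: `n = 0` gives
the infinite snake problems, arbitrary `n` the snake problems.
-/

/-- Encoded (undirected) tileset: `(k, D)`, colours `Fin k`, dominoes `(c, s, c')`. -/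
abbrev EncTileset : Type := ℕ × List (ℕ × ℕ × ℕ)

/-- Encoded directed tileset: `(k, D)`, colours `Fin k × Fin m`, dominoes `(c, s, c')`. -/
abbrev EncDirTileset : Type := ℕ × List ((ℕ × ℕ) × ℕ × ℕ × ℕ)

/-- A weak snake for the encoded tileset `T = (k, D)`: an injective `ω : ℤ/nℤ → G` together
with a colouring `x` of its indices by colours `< k` such that each step is some generator
`e s` and the corresponding domino `(x i, s, x (i+1))` is in `D`. -/
def WeakSnake {G : Type} [Group G] {m : ℕ} (e : Fin m → G)
    (T : EncTileset) (n : ℕ) : Prop :=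
  ∃ (ω : ZMod n → G) (x : ZMod n → ℕ),
    Function.Injective ω ∧
    (∀ i, x i < T.1) ∧
    (∀ i, ∃ s : Fin m, ω (i + 1) = ω i * e s ∧ (x i, ((s : ℕ), x (i + 1))) ∈ T.2)

/-- A strong snake for the encoded tileset `T = (k, D)`: an injective `ω : ℤ/nℤ → G` with
steps in `S = range e`, together with a colouring `x` of its indices (equivalently, of its
image, by injectivity) by colours `< k` such that whenever `ω i` and `ω j = ω i * e s` both
lie on the snake, the domino `(x i, s, x j)` is in `D`. -/
def StrongSnake {G : Type} [Group G] {m : ℕ} (e : Fin m → G)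
    (T : EncTileset) (n : ℕ) : Prop :=
  ∃ (ω : ZMod n → G) (x : ZMod n → ℕ),
    Function.Injective ω ∧
    (∀ i, x i < T.1) ∧
    (∀ i, ∃ s : Fin m, ω (i + 1) = ω i * e s) ∧
    (∀ i j : ZMod n, ∀ s : Fin m, ω j = ω i * e s → (x i, ((s : ℕ), x j)) ∈ T.2)

/-- A directed weak snake for the encoded directed tileset `T = (k, D)`: colours are pairs
`(a, b) ∈ Fin k × Fin m`, the snake follows the direction given by the second component of
its colour, and consecutive colours form dominoes of `D`. -/
def DirWeakSnake {G : Type} [Group G] {m : ℕ} (e : Fin m → G)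
    (T : EncDirTileset) (n : ℕ) : Prop :=
  ∃ (ω : ZMod n → G) (x : ZMod n → ℕ × ℕ),
    Function.Injective ω ∧
    (∀ i, (x i).1 < T.1 ∧ (x i).2 < m) ∧
    (∀ i, ∃ h : (x i).2 < m,
      ω (i + 1) = ω i * e ⟨(x i).2, h⟩ ∧ (x i, ((x i).2, x (i + 1))) ∈ T.2)

/-- A directed strong snake for the encoded directed tileset `T = (k, D)`: colours are pairs
`(a, b) ∈ Fin k × Fin m`, the snake follows the direction given by the second component of
its colour, and all adjacencies along the snake (not just consecutive ones) form dominoes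
of `D`. -/
def DirStrongSnake {G : Type} [Group G] {m : ℕ} (e : Fin m → G)
    (T : EncDirTileset) (n : ℕ) : Prop :=
  ∃ (ω : ZMod n → G) (x : ZMod n → ℕ × ℕ),
    Function.Injective ω ∧
    (∀ i, (x i).1 < T.1 ∧ (x i).2 < m) ∧
    (∀ i, ∃ h : (x i).2 < m, ω (i + 1) = ω i * e ⟨(x i).2, h⟩) ∧
    (∀ i j : ZMod n, ∀ s : Fin m, ω j = ω i * e s → (x i, ((s : ℕ), x j)) ∈ T.2)

namespace Snake

/-! ### Words in two generators -/

/-- A letter: the first component selects the generator (`false` for `a`, `true` for `t`), the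
second one its sign (`true` for the generator, `false` for its inverse). -/
abbrev Letter : Type := Bool × Bool

/-- Words in the letters `a`, `t` and their inverses. -/
abbrev Word : Type := List Letter

section Words

variable {Q R : Type*} [Group Q] [Group R]

/-- The value of a letter in a group. -/
def letterVal (A T : Q) (l : Letter) : Q := cond l.2 (cond l.1 T A) (cond l.1 T A)⁻¹

/-- The value of a word in a group. -/
def rep (A T : Q) (w : Word) : Q := (w.map (letterVal A T)).prod

@[simp] lemma rep_nil (A T : Q) : rep A T [] = 1 := rfl

@[simp] lemma rep_cons (A T : Q) (l : Letter) (w : Word) :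
    rep A T (l :: w) = letterVal A T l * rep A T w := by simp [rep]

@[simp] lemma rep_append (A T : Q) (v w : Word) : rep A T (v ++ w) = rep A T v * rep A T w := by
  simp [rep]

lemma map_letterVal (f : Q →* R) (A T : Q) (l : Letter) :
    f (letterVal A T l) = letterVal (f A) (f T) l := by
  rcases l with ⟨_ | _, _ | _⟩ <;> simp [letterVal]

lemma map_rep (f : Q →* R) (A T : Q) (w : Word) : f (rep A T w) = rep (f A) (f T) w := by
  induction w with
  | nil => simp
  | cons l w ih => simp [ih, map_letterVal]

lemma rep_prod (A T : Q) (A' T' : R) (w : Word) :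
    rep (A, A') (T, T') w = (rep A T w, rep A' T' w) :=
  Prod.ext (map_rep (MonoidHom.fst Q R) _ _ w) (map_rep (MonoidHom.snd Q R) _ _ w)

/-- The exponent sum of `t` in a letter. -/
def letterDrift (l : Letter) : ℤ := cond l.1 (cond l.2 1 (-1)) 0

/-- The exponent sum of `t` in a word. -/
def drift (w : Word) : ℤ := (w.map letterDrift).sum

@[simp] lemma drift_nil : drift [] = 0 := rfl

@[simp] lemma drift_cons (l : Letter) (w : Word) : drift (l :: w) = letterDrift l + drift w := by
  simp [drift]

@[simp] lemma drift_append (v w : Word) : drift (v ++ w) = drift v + drift w := by simp [drift]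

lemma abs_letterDrift_le (l : Letter) : |letterDrift l| ≤ 1 := by
  rcases l with ⟨_ | _, _ | _⟩ <;> simp [letterDrift]

lemma abs_drift_le (w : Word) : |drift w| ≤ w.length := by
  induction w with
  | nil => simp
  | cons l w ih =>
    have := abs_letterDrift_le l
    have := abs_add_le (letterDrift l) (drift w)
    simp only [drift_cons, List.length_cons, Nat.cast_add, Nat.cast_one]
    linarith

lemma rep_ofAdd (w : Word) :
    rep (1 : Multiplicative ℤ) (Multiplicative.ofAdd 1) w = Multiplicative.ofAdd (drift w) := by
  induction w with
  | nil => simp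
  | cons l w ih =>
    rw [rep_cons, ih, drift_cons, ofAdd_add]
    rcases l with ⟨_ | _, _ | _⟩ <;> simp [letterVal, letterDrift]

/-- The formal inverse of a word. -/
def invWord (w : Word) : Word := (w.map fun l => (l.1, !l.2)).reverse

lemma rep_invWord (A T : Q) (w : Word) : rep A T (invWord w) = (rep A T w)⁻¹ := by
  induction w with
  | nil => simp [invWord]
  | cons l w ih =>
    have : invWord (l :: w) = invWord w ++ [(l.1, !l.2)] := by simp [invWord]
    rw [this, rep_append, ih, rep_cons, rep_cons, mul_inv_rev]
    rcases l with ⟨_ | _, _ | _⟩ <;> simp [letterVal]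

@[simp] lemma length_invWord (w : Word) : (invWord w).length = w.length := by simp [invWord]

/-- The conjugate of `A` by the `j`-th power of `T`. -/
def conjT (A T : Q) (j : ℕ) : Q := T ^ j * A * (T ^ j)⁻¹

lemma conjT_succ (A T : Q) (j : ℕ) : conjT A T (j + 1) = T * conjT A T j * T⁻¹ := by
  simp [conjT, pow_succ', mul_assoc]

lemma map_conjT (f : Q →* R) (A T : Q) (j : ℕ) : f (conjT A T j) = conjT (f A) (f T) j := by
  simp [conjT]

/-- The subgroup generated by the first `n` conjugates of `A` by powers of `T`. -/
def conjClosure (A T : Q) (n : ℕ) : Subgroup Q := Subgroup.closure {q | ∃ j < n, conjT A T j = q}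

lemma conjT_mem {A T : Q} {n j : ℕ} (h : j < n) : conjT A T j ∈ conjClosure A T n :=
  Subgroup.subset_closure ⟨j, h, rfl⟩

lemma conjClosure_mono (A T : Q) {n n' : ℕ} (h : n ≤ n') :
    conjClosure A T n ≤ conjClosure A T n' :=
  Subgroup.closure_mono fun _ ⟨j, hj, e⟩ => ⟨j, hj.trans_le h, e⟩

/-- A word all of whose prefixes stay at heights `0, …, n - 1` when started at height `j`
represents, after normalisation by powers of `T`, an element of a subgroup containing the first `n`
conjugates of `A`. -/
lemma rep_mem_of_band {A T : Q} {Δ : Subgroup Q} {n : ℕ} (hΔ : ∀ j < n, conjT A T j ∈ Δ)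
    (w : Word) (j : ℤ) (hw : ∀ p, p <+: w → 0 ≤ j + drift p ∧ j + drift p < n) :
    T ^ j * rep A T w * (T ^ (j + drift w))⁻¹ ∈ Δ := by
  induction w generalizing j with
  | nil => simp
  | cons l w ih =>
    have h0 := hw [] List.nil_prefix
    have ih' := ih (j + letterDrift l) fun p hp => by
      have := hw (l :: p) (by simpa using hp)
      simpa [add_assoc] using this
    have key : T ^ j * letterVal A T l * (T ^ (j + letterDrift l))⁻¹ ∈ Δ := by
      obtain ⟨i, rfl⟩ : ∃ i : ℕ, j = i := ⟨j.toNat, by simp at h0; omega⟩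
      have hi := hΔ i (by simp at h0; omega)
      rcases l with ⟨_ | _, _ | _⟩
      · have := Δ.inv_mem hi
        simpa [letterVal, letterDrift, conjT, mul_assoc] using this
      · simpa [letterVal, letterDrift, conjT, mul_assoc] using hi
      · have : T ^ (i : ℤ) * T⁻¹ * (T ^ ((i : ℤ) + -1))⁻¹ = 1 := by
          rw [← zpow_neg_one, ← zpow_neg, ← zpow_add, ← zpow_add]; simp
        simp only [letterVal, letterDrift, cond_true, cond_false, this, Δ.one_mem]
      · have : T ^ (i : ℤ) * T * (T ^ ((i : ℤ) + 1))⁻¹ = 1 := by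
          rw [zpow_add_one]; simp
        simp only [letterVal, letterDrift, cond_true, this, Δ.one_mem]
    have := Δ.mul_mem key ih'
    simpa [mul_assoc, add_assoc] using this

lemma abs_drift_prefix_le {p w : Word} (h : p <+: w) : |drift p| ≤ w.length :=
  (abs_drift_le p).trans (by exact_mod_cast h.length_le)

end Words

/-! ### Allowed pairs of generators -/

section Allowed

variable {P Q R : Type*} [Group P] [Group Q] [Group R]

/-- `(A', T')` is allowed over `(A, T)` up to `n` if mapping the first `n` conjugates of `A` by
powers of `T` to those of `A'` by powers of `T'` defines a homomorphism. -/
def Allowed (n : ℕ) (A T : P) (A' T' : Q) : Prop :=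
  ∃ φ : conjClosure A T n →* Q, ∀ (j : ℕ) (h : j < n), φ ⟨conjT A T j, conjT_mem h⟩ = conjT A' T' j

lemma Allowed.of_hom (n : ℕ) (f : P →* Q) (A T : P) : Allowed n A T (f A) (f T) :=
  ⟨f.comp (Subgroup.subtype _), fun j _ => by simp [map_conjT]⟩

lemma Allowed.map {n : ℕ} {A T : P} {A' T' : Q} (h : Allowed n A T A' T') (f : Q →* R) :
    Allowed n A T (f A') (f T') := by
  obtain ⟨φ, hφ⟩ := h
  exact ⟨f.comp φ, fun j hj => by simp [hφ j hj, map_conjT]⟩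

lemma range_le_conjClosure {n : ℕ} {A T : P} {A' T' : Q} {φ : conjClosure A T n →* Q}
    (hφ : ∀ (j : ℕ) (h : j < n), φ ⟨conjT A T j, conjT_mem h⟩ = conjT A' T' j)
    (k : conjClosure A T n) : φ k ∈ conjClosure A' T' n := by
  obtain ⟨k, hk⟩ := k
  induction hk using Subgroup.closure_induction with
  | mem x hx => obtain ⟨j, hj, rfl⟩ := hx; rw [hφ j hj]; exact conjT_mem hj
  | one => exact (map_one φ) ▸ one_mem _
  | mul x y hx hy ihx ihy => exact (map_mul φ ⟨x, hx⟩ ⟨y, hy⟩) ▸ mul_mem ihx ihy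
  | inv x hx ih => exact (map_inv φ ⟨x, hx⟩) ▸ inv_mem ih

lemma Allowed.trans {n n' : ℕ} (hn : n ≤ n') {A T : P} {A' T' : Q} {A'' T'' : R}
    (h : Allowed n A T A' T') (h' : Allowed n' A' T' A'' T'') : Allowed n A T A'' T'' := by
  obtain ⟨φ, hφ⟩ := h
  obtain ⟨ψ, hψ⟩ := h'
  refine ⟨ψ.comp (φ.codRestrict _ fun k =>
    conjClosure_mono A' T' hn (range_le_conjClosure hφ k)), fun j hj => ?_⟩
  rw [← hψ j (hj.trans_le hn)]
  exact congrArg ψ (Subtype.ext (hφ j hj))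

lemma Allowed.pi {ι : Type*} {Q : ι → Type*} [∀ i, Group (Q i)] {n : ℕ} {A T : P}
    {A' T' : ∀ i, Q i} (h : ∀ i, Allowed n A T (A' i) (T' i)) : Allowed n A T A' T' := by
  choose φ hφ using h
  refine ⟨MonoidHom.pi φ, fun j hj => funext fun i => ?_⟩
  have := map_conjT (Pi.evalMonoidHom Q i) A' T' j
  simpa [hφ i j hj] using this.symm

/-- Equalities between short words are inherited by allowed pairs. -/
lemma Allowed.rep_eq {m : ℕ} {A T : P} {A' T' : Q} (h : Allowed (2 * m + 1) A T A' T')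
    {v w : Word} (hv : v.length ≤ m) (hw : w.length ≤ m) (hd : drift v = drift w)
    (e : rep A T v = rep A T w) : rep A' T' v = rep A' T' w := by
  obtain ⟨φ, hφ⟩ := h
  have key : ∀ u : Word, u.length ≤ m → ∃ k : conjClosure A T (2 * m + 1),
      (k : P) = T ^ (m : ℤ) * rep A T u * (T ^ (m + drift u))⁻¹ ∧
      φ k = T' ^ (m : ℤ) * rep A' T' u * (T' ^ (m + drift u))⁻¹ := by
    intro u hu
    have := rep_mem_of_band (A := (A, A')) (T := (T, T'))
      (Δ := ((conjClosure A T (2 * m + 1)).subtype.prod φ).range) (n := 2 * m + 1)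
      (fun j hj => ⟨⟨_, conjT_mem hj⟩, by
        rw [MonoidHom.prod_apply, hφ j hj]
        exact Prod.ext (map_conjT (MonoidHom.fst P Q) (A, A') (T, T') j).symm
          (map_conjT (MonoidHom.snd P Q) (A, A') (T, T') j).symm⟩) u m
      (fun p hp => by
        have := (abs_le.1 (abs_drift_prefix_le hp))
        push_cast
        constructor <;> [skip; skip] <;> omega)
    obtain ⟨k, hk⟩ := this
    rw [rep_prod] at hk
    exact ⟨k, congrArg Prod.fst hk, congrArg Prod.snd hk⟩
  obtain ⟨k, hk, hk'⟩ := key v hv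
  obtain ⟨l, hl, hl'⟩ := key w hw
  have : k = l := Subtype.ext (by rw [hk, hl, e, hd])
  rw [this, hl', hd] at hk'
  simpa using hk'.symm

end Allowed

end Snake

namespace Snake

section Extension

open Equiv

variable {P Q : Type*} [Group P] [Group Q]

/-- An action of the first `h + 1` conjugates together with an equivariant `T'` is allowed. -/
lemma allowed_of_equivariant {h : ℕ} {A T : P} (φ : conjClosure A T (h + 1) →* Q) (T' : Q)
    (hT : ∀ (j : ℕ) (hj : j < h), T' * φ ⟨conjT A T j, conjT_mem (hj.trans h.lt_succ_self)⟩ =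
      φ ⟨conjT A T (j + 1), conjT_mem (Nat.succ_lt_succ hj)⟩ * T') :
    Allowed (h + 1) A T (φ ⟨conjT A T 0, conjT_mem h.succ_pos⟩) T' := by
  refine ⟨φ, fun j hj => ?_⟩
  induction j with
  | zero => simp [conjT]
  | succ j ih => rw [conjT_succ (φ _), ← ih (by omega), hT j (by omega)]; simp

open Classical in
/-- The permutation by which `T` acts on the extension space. -/
noncomputable def extShift (T : P) (C : Subgroup P) (r : ℕ) : Perm (P × Bool × ZMod (r + 1)) where
  toFun x := (T * x.1, xor x.2.1 (decide (x.2.2 = 0 ∧ x.1 ∈ C)), x.2.2 + 1)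
  invFun x := (T⁻¹ * x.1, xor x.2.1 (decide (x.2.2 - 1 = 0 ∧ T⁻¹ * x.1 ∈ C)), x.2.2 - 1)
  left_inv x := by
    simp only [inv_mul_cancel_left, add_sub_cancel_right, Bool.xor_assoc, Bool.xor_self,
      Bool.xor_false, Prod.mk.eta]
  right_inv x := by
    simp only [mul_inv_cancel_left, sub_add_cancel, Bool.xor_assoc, Bool.xor_self,
      Bool.xor_false, Prod.mk.eta]

open Classical in
lemma extShift_apply (T : P) (C : Subgroup P) (r : ℕ) (x : P × Bool × ZMod (r + 1)) :
    extShift T C r x = (T * x.1, xor x.2.1 (decide (x.2.2 = 0 ∧ x.1 ∈ C)), x.2.2 + 1) := rfl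

/-- The action of `P` on the extension space by left multiplication. -/
def extMul (r : ℕ) : P →* Perm (P × Bool × ZMod (r + 1)) :=
  MonoidHom.mk' (fun q => (Equiv.mulLeft q).prodCongr (Equiv.refl _)) fun q q' => by
    ext x <;> simp [mul_assoc]

@[simp] lemma extMul_apply (r : ℕ) (q : P) (x : P × Bool × ZMod (r + 1)) :
    extMul r q x = (q * x.1, x.2) := rfl

lemma extShift_pow_apply (T : P) (C : Subgroup P) (r u : ℕ) (hu : u < r) (p : P) (ε : Bool) :
    (extShift T C r ^ u) (p, ε, ((r - u : ℕ) : ZMod (r + 1))) =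
      (T ^ u * p, ε, ((r : ℕ) : ZMod (r + 1))) := by
  induction u generalizing p with
  | zero => simp
  | succ u ih =>
    have h0 : ((r - (u + 1) : ℕ) : ZMod (r + 1)) ≠ 0 := by
      rw [Ne, ZMod.natCast_eq_zero_iff]
      exact Nat.not_dvd_of_pos_of_lt (by omega) (by omega)
    have h1 : ((r - (u + 1) : ℕ) : ZMod (r + 1)) + 1 = ((r - u : ℕ) : ZMod (r + 1)) := by
      rw [← Nat.cast_add_one]; congr 1; omega
    rw [pow_succ, Perm.mul_apply]
    have : extShift T C r (p, ε, ((r - (u + 1) : ℕ) : ZMod (r + 1))) =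
        (T * p, ε, ((r - u : ℕ) : ZMod (r + 1))) := by simp [extShift, h0, h1]
    rw [this, ih (by omega), pow_succ, mul_assoc]

lemma extShift_pow_snd (T : P) (C : Subgroup P) (r u : ℕ) (x : P × Bool × ZMod (r + 1)) :
    ((extShift T C r ^ u) x).2.2 = x.2.2 + u := by
  induction u with
  | zero => simp
  | succ u ih => rw [pow_succ', Perm.mul_apply, extShift_apply, ih, Nat.cast_succ, add_assoc]

/-- The two-colouring of the extension space. -/
def extColour (r : ℕ) (x : P × Bool × ZMod (r + 1)) : Bool :=
  if x.2.2 = ((r : ℕ) : ZMod (r + 1)) then x.2.1 else false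

/-- If the `n`-th conjugate is not generated by the earlier ones, there is a finite allowed set
on which, for a prescribed `n' ≥ n`, some two-colouring is invariant under the first `n'` conjugates
but not under the `n'`-th one. -/
theorem exists_extension {P : Type} [Group P] [Finite P] (A T : P) {h n' : ℕ} (hn : h < n')
    (good : conjT A T (h + 1) ∉ conjClosure A T (h + 1)) :
    ∃ (X : Type) (_ : Finite X) (a t : Perm X) (χ : X → Bool), Allowed (h + 1) A T a t ∧
      (∀ j < n', ∀ x, χ (conjT a t j x) = χ x) ∧ ∃ x, χ (conjT a t n' x) ≠ χ x := by
  obtain ⟨r, rfl⟩ := Nat.exists_eq_add_of_lt hn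
  rw [add_assoc]
  generalize hr' : r + 1 = r'
  have hr : 0 < r' := by omega
  clear hn hr' r
  rename' r' => r
  set C := conjClosure A T h with hC
  set t := extShift T C r with ht
  have hgood : conjT A T h ∉ C := by
    intro hm
    refine good ?_
    rw [conjT_succ]
    generalize conjT A T h = q at hm
    induction hm using Subgroup.closure_induction with
    | mem x hx =>
      obtain ⟨j, hj, rfl⟩ := hx
      rw [← conjT_succ]
      exact conjT_mem (by omega)
    | one => simp
    | mul x y hx hy ihx ihy => simpa [mul_assoc] using mul_mem ihx ihy
    | inv x hx ih => simpa [mul_assoc] using inv_mem ih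
  have hequiv : ∀ j < h, t * extMul r (conjT A T j) = extMul r (conjT A T (j + 1)) * t := by
    intro j hj
    ext1 x
    have hm : conjT A T j * x.1 ∈ C ↔ x.1 ∈ C := C.mul_mem_cancel_left (conjT_mem hj)
    rw [Perm.mul_apply, Perm.mul_apply, extMul_apply, extMul_apply, ht, extShift_apply,
      extShift_apply]
    simp [hm, conjT_succ, mul_assoc]
  have hall : Allowed (h + 1) A T (extMul r A) t := by
    have := allowed_of_equivariant (A := A) (T := T) (h := h)
      ((extMul r).comp (Subgroup.subtype _)) t hequiv
    simpa [conjT] using this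
  obtain ⟨φ, hφ⟩ := hall
  have hconj : ∀ j ≤ h, conjT (extMul r A) t j = extMul r (conjT A T j) := by
    intro j hj
    induction j with
    | zero => simp [conjT]
    | succ j ih =>
      rw [conjT_succ, ih (by omega), mul_inv_eq_iff_eq_mul, hequiv j (by omega)]
  have hconj' : ∀ u, conjT (extMul r A) t (h + u) =
      t ^ u * extMul r (conjT A T h) * (t ^ u)⁻¹ := by
    intro u
    rw [← hconj h le_rfl, conjT, conjT, add_comm h u, pow_add t u h]
    group
  have hlow : ∀ u < r, ∀ y, extColour r ((t ^ u) (extMul r (conjT A T h) y)) =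
      extColour r ((t ^ u) y) := by
    rintro u hu ⟨p, ε, i⟩
    by_cases hi : i = ((r - u : ℕ) : ZMod (r + 1))
    · subst hi
      rw [extMul_apply, ht, extShift_pow_apply _ _ _ _ hu, extShift_pow_apply _ _ _ _ hu]
      simp [extColour]
    · have : i + u ≠ ((r : ℕ) : ZMod (r + 1)) := by
        intro h'
        apply hi
        rw [Nat.cast_sub hu.le, ← h']
        ring
      simp only [extColour, ht, extShift_pow_snd, extMul_apply, this, if_false]
  refine ⟨P × Bool × ZMod (r + 1), inferInstance, extMul r A, t, extColour r, ⟨φ, hφ⟩, ?_, ?_⟩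
  · intro j hj x
    rcases le_or_gt j h with hjh | hjh
    · rw [hconj j hjh]; rfl
    · obtain ⟨u, rfl⟩ := Nat.exists_eq_add_of_lt hjh
      rw [add_assoc] at hj ⊢
      rw [hconj']
      have := hlow (u + 1) (by omega) ((t ^ (u + 1))⁻¹ x)
      simpa using this
  · refine ⟨(t ^ r) (1, false, 0), ?_⟩
    obtain ⟨s, rfl⟩ : ∃ s, r = s + 1 := ⟨r - 1, by omega⟩
    have step : ∀ q : P, (t ^ (s + 1)) (q, false, 0) =
        (T ^ s * (T * q), (extShift T C (s + 1) (q, false, 0)).2.1,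
          (((s + 1 : ℕ)) : ZMod (s + 1 + 1))) := by
      intro q
      rw [pow_succ, Perm.mul_apply, ← extShift_pow_apply T C (s + 1) s (by omega)]
      simp [ht, extShift]
    rw [hconj', Perm.mul_apply, Perm.inv_def, Equiv.symm_apply_apply, Perm.mul_apply,
      extMul_apply, step, step]
    simp [extColour, extShift, hgood, one_mem]

end Extension

end Snake

namespace Snake

open Equiv

section Matching

/-- Two maps from finite types with equinumerous fibres differ by an equivalence of the domains. -/
lemma exists_equiv_of_card_fibers {X Y Z : Type*} [Finite X] [Finite Y] (f : X → Z) (g : Y → Z)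
    (h : ∀ z, Nat.card {x // f x = z} = Nat.card {y // g y = z}) :
    ∃ e : X ≃ Y, ∀ x, g (e x) = f x := by
  let e : ∀ z, {x // f x = z} ≃ {y // g y = z} := fun z => (Finite.card_eq.1 (h z)).some
  refine ⟨(Equiv.sigmaFiberEquiv f).symm.trans
    ((Equiv.sigmaCongrRight e).trans (Equiv.sigmaFiberEquiv g)), fun x => ?_⟩
  exact (e (f x) ⟨x, rfl⟩).2

variable {C X Y Z : Type*} [Group C] [MulAction C X] [MulAction C Y] [MulAction C Z]

/-- A free action is described by a system of representatives of its orbits. -/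
lemma bijective_smul_of_free {I : Type*} (hX : ∀ (c : C) (x : X), c • x = x → c = 1) (s : I → X)
    (hs : Function.Bijective fun i => (Quotient.mk (MulAction.orbitRel C X) (s i))) :
    Function.Bijective fun p : I × C => p.2 • s p.1 := by
  constructor
  · rintro ⟨i, c⟩ ⟨j, d⟩ h
    have h : c • s i = d • s j := h
    have hij : i = j := hs.1 (Quotient.sound ⟨c⁻¹ * d, by simp [mul_smul, ← h]⟩)
    subst hij
    have := hX (d⁻¹ * c) (s i) (by rw [mul_smul, h, inv_smul_smul])
    rw [inv_mul_eq_one] at this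
    rw [this]
  · intro x
    obtain ⟨i, hi⟩ := hs.2 (Quotient.mk _ x)
    obtain ⟨c, hc⟩ : x ∈ MulAction.orbit C (s i) := Quotient.exact hi.symm
    exact ⟨(i, c), hc⟩

/-- Finite free actions with equivariant maps having equinumerous fibres are isomorphic over the
target. -/
theorem exists_equivariant_equiv [Finite C] [Finite X] [Finite Y]
    (hX : ∀ (c : C) (x : X), c • x = x → c = 1) (hY : ∀ (c : C) (y : Y), c • y = y → c = 1)
    (f : X → Z) (g : Y → Z) (hf : ∀ (c : C) x, f (c • x) = c • f x)
    (hg : ∀ (c : C) y, g (c • y) = c • g y)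
    (h : ∀ z, Nat.card {x // f x = z} = Nat.card {y // g y = z}) :
    ∃ e : X ≃ Y, (∀ (c : C) x, e (c • x) = c • e x) ∧ ∀ x, g (e x) = f x := by
  let f' : Quotient (MulAction.orbitRel C X) → Quotient (MulAction.orbitRel C Z) :=
    Quotient.map f (fun x y ⟨c, hc⟩ => ⟨c, by rw [← hc]; exact (hf c y).symm⟩)
  let g' : Quotient (MulAction.orbitRel C Y) → Quotient (MulAction.orbitRel C Z) :=
    Quotient.map g (fun x y ⟨c, hc⟩ => ⟨c, by rw [← hc]; exact (hg c y).symm⟩)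
  have hbX : Function.Bijective fun p : Quotient (MulAction.orbitRel C X) × C => p.2 • p.1.out :=
    bijective_smul_of_free hX _ (by simpa using! Function.bijective_id)
  have hbY : Function.Bijective fun p : Quotient (MulAction.orbitRel C Y) × C => p.2 • p.1.out :=
    bijective_smul_of_free hY _ (by simpa using! Function.bijective_id)
  have hf' : ∀ (c : C) q, (Quotient.mk _ (f (c • Quotient.out q)) :
      Quotient (MulAction.orbitRel C Z)) = f' q := by
    intro c q
    conv_rhs => rw [← Quotient.out_eq q]
    exact Quotient.sound ⟨c, (hf c _).symm⟩
  have hg' : ∀ (c : C) q, (Quotient.mk _ (g (c • Quotient.out q)) :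
      Quotient (MulAction.orbitRel C Z)) = g' q := by
    intro c q
    conv_rhs => rw [← Quotient.out_eq q]
    exact Quotient.sound ⟨c, (hg c _).symm⟩
  obtain ⟨e₀, he₀⟩ := exists_equiv_of_card_fibers f g h
  obtain ⟨e₁, he₁⟩ : ∃ e : Quotient (MulAction.orbitRel C X) ≃ Quotient (MulAction.orbitRel C Y),
      ∀ q, g' (e q) = f' q := by
    refine exists_equiv_of_card_fibers f' g' fun o => ?_
    have eX : {q // f' q = o} × C ≃
        {x // (Quotient.mk _ (f x) : Quotient (MulAction.orbitRel C Z)) = o} :=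
      (Equiv.prodSubtypeFstEquivSubtypeProd (p := fun q => f' q = o)).symm.trans
        ((Equiv.ofBijective _ hbX).subtypeEquiv fun p => by
          simp only [Equiv.ofBijective_apply]; rw [hf'])
    have eY : {q // g' q = o} × C ≃
        {x // (Quotient.mk _ (g x) : Quotient (MulAction.orbitRel C Z)) = o} :=
      (Equiv.prodSubtypeFstEquivSubtypeProd (p := fun q => g' q = o)).symm.trans
        ((Equiv.ofBijective _ hbY).subtypeEquiv fun p => by
          simp only [Equiv.ofBijective_apply]; rw [hg'])
    have eXY : {x // (Quotient.mk _ (f x) : Quotient (MulAction.orbitRel C Z)) = o} ≃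
        {x // (Quotient.mk _ (g x) : Quotient (MulAction.orbitRel C Z)) = o} :=
      e₀.subtypeEquiv fun x => by rw [he₀]
    have := Nat.card_congr (eX.trans (eXY.trans eY.symm))
    rw [Nat.card_prod, Nat.card_prod] at this
    exact Nat.eq_of_mul_eq_mul_right Nat.card_pos this
  have hy : ∀ q, ∃ c : C, c • g (e₁ q).out = f (Quotient.out q) := by
    intro q
    have := he₁ q
    rw [← hf' 1 q, ← hg' 1 (e₁ q), one_smul, one_smul] at this
    obtain ⟨c, hc⟩ := Quotient.exact this.symm
    exact ⟨c, hc⟩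
  choose d hd using hy
  have hb : Function.Bijective fun p : Quotient (MulAction.orbitRel C X) × C =>
      p.2 • (d p.1 • (e₁ p.1).out) := by
    refine bijective_smul_of_free hY (fun q => d q • (e₁ q).out) ?_
    convert! e₁.bijective using 2 with q
    conv_rhs => rw [← Quotient.out_eq (e₁ q)]
    exact Quotient.sound ⟨d q, rfl⟩
  refine ⟨(Equiv.ofBijective _ hbX).symm.trans (Equiv.ofBijective _ hb), fun c x => ?_,
    fun x => ?_⟩
  · obtain ⟨⟨q, c'⟩, rfl⟩ := hbX.2 x
    have h1 : (Equiv.ofBijective _ hbX).symm (c' • q.out) = (q, c') :=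
      (Equiv.symm_apply_eq _).2 rfl
    have h2 : (Equiv.ofBijective _ hbX).symm (c • c' • q.out) = (q, c * c') :=
      (Equiv.symm_apply_eq _).2 (by simp [mul_smul])
    simp only [Equiv.trans_apply, h1, h2, Equiv.ofBijective_apply, mul_smul]
  · obtain ⟨⟨q, c'⟩, rfl⟩ := hbX.2 x
    have h1 : (Equiv.ofBijective _ hbX).symm (c' • q.out) = (q, c') :=
      (Equiv.symm_apply_eq _).2 rfl
    simp only [Equiv.trans_apply, h1, Equiv.ofBijective_apply, hg, hf, hd]

end Matching

end Snake

namespace Snake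

open Equiv

section Pump

variable {K C : Type} [Group K] [Group C] {S : Type}

/-- A pattern translated by a group element. -/
def shiftPattern (κ : K) (p : K → S) : K → S := fun κ' => p (κ' * κ)

lemma shiftPattern_mul (κ κ' : K) (p : K → S) :
    shiftPattern (κ * κ') p = shiftPattern κ (shiftPattern κ' p) := by
  funext x; simp [shiftPattern, mul_assoc]

lemma sum_card_pattern [Finite K] [Fintype (K → S)] {Y : Type} [Finite Y]
    (φ : K →* Perm Y) (pat : Y → K → S) (hpat : ∀ κ y, pat (φ κ y) = shiftPattern κ (pat y))
    (q : (K → S) → Prop) :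
    ∑ p, Nat.card {y // pat y = p} * Nat.card {κ : K // q (shiftPattern κ p)} =
      Nat.card K * Nat.card {y // q (pat y)} := by
  classical
  have := Fintype.ofFinite K
  have := Fintype.ofFinite Y
  simp only [Nat.card_eq_fintype_card, Fintype.card_subtype, Finset.card_filter]
  calc _ = ∑ p, ∑ y, ∑ κ : K, if pat y = p ∧ q (shiftPattern κ p) then 1 else 0 := by
        refine Finset.sum_congr rfl fun p _ => ?_
        rw [Finset.sum_mul_sum]
        simp only [ite_and, mul_ite, mul_one, mul_zero]
        refine Finset.sum_congr rfl fun y _ => Finset.sum_congr rfl fun κ _ => ?_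
        split_ifs <;> rfl
    _ = ∑ κ : K, ∑ y, ∑ p, if pat y = p ∧ q (shiftPattern κ p) then 1 else 0 := by
        rw [Finset.sum_comm]
        simp_rw [Finset.sum_comm (s := (Finset.univ : Finset (K → S)))]
        rw [Finset.sum_comm]
    _ = ∑ κ : K, ∑ y, if q (pat (φ κ y)) then 1 else 0 := by
        simp_rw [ite_and, hpat]
        simp
    _ = ∑ κ : K, ∑ y, if q (pat y) then 1 else 0 :=
        Finset.sum_congr rfl fun κ _ => Equiv.sum_comp (φ κ) fun y => if q (pat y) then 1 else 0
    _ = _ := by simp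

lemma card_pattern_model [Finite K] [Fintype (K → S)] (v : (K → S) → ℕ) (q : (K → S) → Prop) :
    Nat.card {x : Σ p : K → S, Fin (v p) × K // q (shiftPattern x.2.2 x.1)} =
      ∑ p, v p * Nat.card {κ : K // q (shiftPattern κ p)} := by
  classical
  have := Fintype.ofFinite K
  simp only [Nat.card_eq_fintype_card, Fintype.card_subtype, Finset.card_filter]
  rw [Fintype.sum_sigma]
  refine Finset.sum_congr rfl fun p _ => ?_
  rw [Fintype.sum_prod_type]
  refine (Finset.sum_eq_card_nsmul (b := ∑ κ : K, if q (shiftPattern κ p) then 1 else 0)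
    fun i _ => rfl).trans ?_
  rw [Finset.card_univ, Fintype.card_fin, smul_eq_mul]

/-- Left multiplication on the model space. -/
def modelMul (v : (K → S) → ℕ) : K →* Perm (Σ p : K → S, Fin (v p) × K) :=
  MonoidHom.mk' (fun κ => Equiv.sigmaCongrRight fun _ => (Equiv.refl _).prodCongr (Equiv.mulLeft κ))
    fun κ κ' => by
      ext1 x; exact Sigma.ext rfl (heq_of_eq (Prod.ext rfl (mul_assoc _ _ _)))

lemma modelMul_apply (v : (K → S) → ℕ) (κ : K) (x : Σ p : K → S, Fin (v p) × K) :
    modelMul v κ x = ⟨x.1, x.2.1, κ * x.2.2⟩ := rfl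

/-- **Pumping lemma.**  Among infinitely many labelled finite spaces with a common local structure,
two (the second one arbitrarily far) can be subtracted from each other. -/
theorem exists_pump [Finite K] [Finite C] [Finite S] {ι θ : C →* K}
    (hι : Function.Injective ι) (hθ : Function.Injective θ)
    (Y : ℕ → Type) [∀ k, Finite (Y k)] (φ : ∀ k, K →* Perm (Y k)) (t : ∀ k, Perm (Y k))
    (heq : ∀ k c, t k * φ k (ι c) = φ k (θ c) * t k) (σ : ∀ k, Y k → S) :
    ∃ k₁, ∀ N, ∃ k₂ ≥ N, ∃ (X : Type) (_ : Finite X) (ψ : K →* Perm X) (u : Perm X) (ρ : X → S),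
      (∀ c, u * ψ (ι c) = ψ (θ c) * u) ∧
      (∀ κ x, ∃ y, ρ x = σ k₂ y ∧ ρ (ψ κ x) = σ k₂ (φ k₂ κ y)) ∧
      (∀ x, ∃ y, ρ x = σ k₂ y ∧ ρ (u x) = σ k₂ (t k₂ y)) ∧
      ∀ q : S → Prop, Nat.card {x // q (ρ x)} + Nat.card K * Nat.card {y // q (σ k₁ y)} =
        Nat.card K * Nat.card {y // q (σ k₂ y)} := by
  have := Fintype.ofFinite (K → S × S × S)
  let pat : ∀ k, Y k → K → S × S × S := fun k y κ =>
    (σ k ((t k)⁻¹ (φ k κ y)), σ k (φ k κ y), σ k (t k (φ k κ y)))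
  have hpat : ∀ k κ y, pat k (φ k κ y) = shiftPattern κ (pat k y) := by
    intro k κ y; funext κ'; simp [pat, shiftPattern]
  let n : ℕ → (K → S × S × S) → ℕ := fun k p => Nat.card {y // pat k y = p}
  obtain ⟨g, hg⟩ := (wellQuasiOrdered_le (α := (K → S × S × S) → ℕ)).exists_monotone_subseq n
  refine ⟨g 0, fun N => ⟨g N, g.strictMono.le_apply, ?_⟩⟩
  set k₁ := g 0
  set k₂ := g N
  have hle : ∀ p, n k₁ p ≤ n k₂ p := hg 0 N (Nat.zero_le _)
  let v : (K → S × S × S) → ℕ := fun p => n k₂ p - n k₁ p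
  let X := Σ p : K → S × S × S, Fin (v p) × K
  let patX : X → K → S × S × S := fun x => shiftPattern x.2.2 x.1
  have hpatX : ∀ κ x, patX (modelMul v κ x) = shiftPattern κ (patX x) := by
    intro κ x; exact shiftPattern_mul _ _ _
  have hcard : ∀ q : (K → S × S × S) → Prop,
      Nat.card {x // q (patX x)} + Nat.card K * Nat.card {y // q (pat k₁ y)} =
        Nat.card K * Nat.card {y // q (pat k₂ y)} := by
    intro q
    rw [← sum_card_pattern (φ k₁) (pat k₁) (hpat k₁), ← sum_card_pattern (φ k₂) (pat k₂) (hpat k₂),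
      card_pattern_model, ← Finset.sum_add_distrib]
    refine Finset.sum_congr rfl fun p _ => ?_
    rw [← add_mul]
    congr 1
    exact Nat.sub_add_cancel (hle p)
  have hex : ∀ x : X, ∃ y, patX x = pat k₂ y := by
    rintro ⟨p, i, κ⟩
    have hpos : 0 < n k₂ p := by have := i.2; simp only [v] at this; omega
    obtain ⟨⟨y, hy⟩⟩ := (Nat.card_pos_iff.1 hpos).1
    exact ⟨φ k₂ κ y, by rw [hpat, hy]⟩
  let Λ : (K → S × S × S) → C → S × S := fun p c => ((p (ι c)).2.1, (p (ι c)).2.2)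
  let M : (K → S × S × S) → C → S × S := fun p c => ((p (θ c)).1, (p (θ c)).2.1)
  have hΛM : ∀ k y, Λ (pat k y) = M (pat k (t k y)) := by
    intro k y
    funext c
    have h1 : φ k (θ c) (t k y) = t k (φ k (ι c) y) := by
      rw [← Perm.mul_apply, ← heq, Perm.mul_apply]
    simp [Λ, M, pat, h1]
  have hYfib : ∀ k z, Nat.card {y // Λ (pat k y) = z} = Nat.card {y // M (pat k y) = z} :=
    fun k z => Nat.card_congr ((t k).subtypeEquiv fun y => by rw [hΛM])
  have hXfib : ∀ z, Nat.card {x // Λ (patX x) = z} = Nat.card {x // M (patX x) = z} := by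
    intro z
    have h1 := hcard fun p => Λ p = z
    have h2 := hcard fun p => M p = z
    rw [hYfib, hYfib] at h1
    omega
  let actZ : MulAction C (C → S × S) :=
    { smul := fun c z => shiftPattern c z
      one_smul := fun z => by funext x; exact congrArg z (mul_one x)
      mul_smul := fun c d z => shiftPattern_mul c d z }
  let act₁ : MulAction C X := MulAction.compHom X ((modelMul v).comp ι)
  let act₂ : MulAction C X := MulAction.compHom X ((modelMul v).comp θ)
  have hfree : ∀ (κ : K) (x : X), modelMul v κ x = x → κ = 1 := by
    rintro κ ⟨p, i, κ'⟩ h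
    rw [modelMul_apply] at h
    simpa using h
  obtain ⟨u, hu, hu'⟩ := @exists_equivariant_equiv C X X (C → S × S) _ act₁ act₂ actZ _ _ _
    (fun c x h => hι (by rw [hfree _ x h, map_one]))
    (fun c x h => hθ (by rw [hfree _ x h, map_one]))
    (fun x => Λ (patX x)) (fun x => M (patX x))
    (fun c x => by
      change Λ (patX (modelMul v (ι c) x)) = shiftPattern c (Λ (patX x))
      rw [hpatX]; funext c'; simp [Λ, shiftPattern])
    (fun c x => by
      change M (patX (modelMul v (θ c) x)) = shiftPattern c (M (patX x))
      rw [hpatX]; funext c'; simp [M, shiftPattern])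
    hXfib
  refine ⟨X, inferInstance, modelMul v, u, fun x => (patX x 1).2.1, fun c => Equiv.ext fun x =>
    hu c x, fun κ x => ?_, fun x => ?_, fun q => ?_⟩
  · obtain ⟨y, hy⟩ := hex x
    refine ⟨y, by simp [hy, pat], ?_⟩
    simp [hpatX, hy, shiftPattern, pat]
  · obtain ⟨y, hy⟩ := hex x
    refine ⟨y, by simp [hy, pat], ?_⟩
    have := congrArg Prod.snd (congrFun (hu' x) 1)
    simp only [M, Λ, map_one] at this
    change (patX (u x) 1).2.1 = _
    rw [this, hy]
    simp [pat]
  · have h := hcard fun p => q (p 1).2.1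
    simpa [pat] using h

end Pump

end Snake

namespace Snake

open Equiv

/-! ### Problems, paths and ouroboroi -/

/-- A directed snake problem: whether it is strong, the words representing the generators, the
number of base colours, and the dominoes. -/
abbrev Prob : Type := Bool × List Word × ℕ × List ((ℕ × ℕ) × ℕ × ℕ × ℕ)

/-- The word of a generator. -/
def wd (P : Prob) (s : ℕ) : Word := P.2.1.getD s []

/-- The admissible colours of a directed problem. -/
def IsLetter (P : Prob) (y : ℕ × ℕ) : Prop := y.1 < P.2.2.1 ∧ y.2 < P.2.1.length

instance (P : Prob) : Finite {y // IsLetter P y} :=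
  Set.Finite.to_subtype (((Set.finite_Iio P.2.2.1).prod (Set.finite_Iio P.2.1.length)).subset
    fun _ hy => ⟨hy.1, hy.2⟩)

/-- Coloured self-avoiding paths with `L` vertices in a space on which words act from the right. -/
structure IsPath {V : Type*} (P : Prob) (stp : V → Word → V) (L : ℕ) (z : ℕ → V) (y : ℕ → ℕ × ℕ) :
    Prop where
  letter : ∀ i < L, IsLetter P (y i)
  step : ∀ i < L, z (i + 1) = stp (z i) (wd P (y i).2)
  inj : ∀ i < L, ∀ j < L, z i = z j → i = j
  next : P.1 = false → ∀ i, i + 1 < L → (y i, ((y i).2, y (i + 1))) ∈ P.2.2.2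
  conf : P.1 = true → ∀ i < L, ∀ j < L, ∀ s < P.2.1.length, z j = stp (z i) (wd P s) →
    (y i, (s, y j)) ∈ P.2.2.2

/-- Coloured self-avoiding closed paths with `n` vertices. -/
structure IsOuro {V : Type*} (P : Prob) (stp : V → Word → V) (n : ℕ) (z : ℕ → V) (y : ℕ → ℕ × ℕ) :
    Prop extends IsPath P stp n z y where
  pos : 0 < n
  closed : z n = z 0
  next_closed : P.1 = false → (y (n - 1), ((y (n - 1)).2, y 0)) ∈ P.2.2.2

lemma IsPath.take {V : Type*} {P : Prob} {stp : V → Word → V} {L L' : ℕ} {z : ℕ → V}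
    {y : ℕ → ℕ × ℕ} (h : IsPath P stp L z y) (hL : L' ≤ L) : IsPath P stp L' z y where
  letter i hi := h.letter i (hi.trans_le hL)
  step i hi := h.step i (hi.trans_le hL)
  inj i hi j hj := h.inj i (hi.trans_le hL) j (hj.trans_le hL)
  next hP i hi := h.next hP i (hi.trans_le hL)
  conf hP i hi j hj := h.conf hP i (hi.trans_le hL) j (hj.trans_le hL)

/-- The right action of words on a space with two permutations. -/
def permStep {X : Type*} (a t : Perm X) (x : X) (w : Word) : X := (rep a t w)⁻¹ x

/-- The right action of words on a group with two distinguished elements. -/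
def groupStep {Q : Type*} [Group Q] (a t g : Q) (w : Word) : Q := g * rep a t w

/-- The total drift of the first `L` steps. -/
def pathDrift (P : Prob) (y : ℕ → ℕ × ℕ) (L : ℕ) : ℤ := ∑ i ∈ Finset.range L, drift (wd P (y i).2)

lemma exists_sum_period_ne_zero {V : Type*} [Fintype V] (f : Perm V) (τ : V → ℤ)
    (h : ∑ x, τ x ≠ 0) :
    ∃ x, ∑ i ∈ Finset.range (Function.minimalPeriod f x), τ (f^[i] x) ≠ 0 := by
  by_contra! hc
  apply h
  have hper : ∀ x q, ∑ i ∈ Finset.range (Function.minimalPeriod f x * q), τ (f^[i] x) = 0 := by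
    intro x q
    induction q with
    | zero => simp
    | succ q ih =>
      rw [Nat.mul_succ, Finset.sum_range_add, ih, zero_add, ← hc x]
      refine Finset.sum_congr rfl fun i _ => ?_
      rw [add_comm, Function.iterate_add_apply,
        (Function.isPeriodicPt_minimalPeriod f x).mul_const q]
  have h1 : ∀ x, ∑ i ∈ Finset.range (orderOf f), τ (f^[i] x) = 0 := by
    intro x
    obtain ⟨q, hq⟩ : Function.minimalPeriod f x ∣ orderOf f := by
      refine Function.IsPeriodicPt.minimalPeriod_dvd ?_
      rw [Function.IsPeriodicPt, Function.IsFixedPt, ← Perm.coe_pow, pow_orderOf_eq_one]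
      rfl
    rw [hq]
    exact hper x q
  have h2 : ∑ x, ∑ i ∈ Finset.range (orderOf f), τ (f^[i] x) = orderOf f * ∑ x, τ x := by
    rw [Finset.sum_comm]
    simp_rw [← Perm.coe_pow, fun i => Equiv.sum_comp (f ^ i) τ]
    simp
  simp only [h1, Finset.sum_const_zero] at h2
  exact (mul_eq_zero.1 h2.symm).resolve_left (by exact_mod_cast (orderOf_pos f).ne')

/-- A finite space with a partial colouring obeying local rules and having nonzero total drift
contains an ouroboros with nonzero drift. -/
lemma exists_ouro_of_local {X : Type} [Fintype X] (P : Prob) (a t : Perm X)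
    (d : X → Option {y // IsLetter P y})
    (hout : ∀ x b, d x = some b → ∃ c, d (permStep a t x (wd P b.1.2)) = some c ∧
      (P.1 = false → (b.1, (b.1.2, c.1)) ∈ P.2.2.2))
    (hin : ∀ x b, d x = some b → ∃ c, d (rep a t (wd P c.1.2) x) = some c)
    (hconf : P.1 = true → ∀ x b, d x = some b → ∀ s < P.2.1.length, ∀ c,
      d (permStep a t x (wd P s)) = some c → (b.1, (s, c.1)) ∈ P.2.2.2)
    (htot : ∑ x, ((d x).elim 0 fun b => drift (wd P b.1.2)) ≠ 0) :
    ∃ n z y, IsOuro P (permStep a t) n z y ∧ pathDrift P y n ≠ 0 := by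
  classical
  let V := {x // (d x).isSome}
  let c : V → {y // IsLetter P y} := fun x => (d x).get x.2
  have hc : ∀ x : V, d x = some (c x) := fun x => (Option.some_get x.2).symm
  let f : V → V := fun x => ⟨permStep a t x (wd P (c x).1.2), by
    obtain ⟨b, hb, -⟩ := hout x (c x) (hc x); simp [hb]⟩
  have hsurj : Function.Surjective f := by
    intro x
    obtain ⟨b, hb⟩ := hin x (c x) (hc x)
    have hx' : (d (rep a t (wd P b.1.2) x)).isSome := by simp [hb]
    refine ⟨⟨_, hx'⟩, Subtype.ext ?_⟩
    have : c ⟨_, hx'⟩ = b := Option.some_injective _ (by rw [← hc, hb])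
    simp only [f, this, permStep, Perm.inv_def, Equiv.symm_apply_apply]
  let e : Perm V := Equiv.ofBijective f (Finite.injective_iff_bijective.1
    (Finite.injective_iff_surjective.2 hsurj))
  let τ : V → ℤ := fun x => drift (wd P (c x).1.2)
  have hτ : ∑ x, τ x ≠ 0 := by
    convert htot using 1
    have h0 : ∀ x, ¬ (d x).isSome → ((d x).elim 0 fun b => drift (wd P b.1.2)) = 0 := by
      intro x hx
      rw [Option.not_isSome_iff_eq_none] at hx
      rw [hx]; rfl
    rw [← Finset.sum_filter_of_ne (p := fun x => (d x).isSome = true)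
      (fun x _ h => not_not.1 fun hx => h (h0 x hx)),
      Finset.sum_subtype (p := fun x => (d x).isSome = true)
      (F := inferInstance) _ (by simp)]
    exact Finset.sum_congr rfl fun x _ => by rw [hc x]; rfl
  obtain ⟨x, hx⟩ := exists_sum_period_ne_zero e τ hτ
  set n := Function.minimalPeriod e x with hn
  have hpos : 0 < n := Nat.pos_of_ne_zero fun h => hx (by rw [h]; simp)
  have hclosed : e^[n] x = x := Function.iterate_minimalPeriod
  have hstep : ∀ i, ((e^[i + 1] x : V) : X) =
      permStep a t (e^[i] x : V) (wd P (c (e^[i] x)).1.2) := by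
    intro i
    rw [Function.iterate_succ_apply']
    rfl
  have hnext : ∀ i, P.1 = false →
      ((c (e^[i] x)).1, ((c (e^[i] x)).1.2, (c (e^[i + 1] x)).1)) ∈ P.2.2.2 := by
    intro i hP
    obtain ⟨b, hb, hb'⟩ := hout _ _ (hc (e^[i] x))
    have : b = c (e^[i + 1] x) := Option.some_injective _ (by rw [← hb, ← hc, hstep])
    exact this ▸ hb' hP
  refine ⟨n, fun i => (e^[i] x : V), fun i => (c (e^[i] x)).1, ⟨⟨fun i _ => (c _).2,
    fun i _ => hstep i, fun i hi j hj h => ?_, fun hP i _ => hnext i hP,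
    fun hP i hi j hj s hs h => ?_⟩, hpos, ?_, fun hP => ?_⟩, hx⟩
  · exact Function.iterate_injOn_Iio_minimalPeriod (f := e) (x := x) hi hj (Subtype.ext h)
  · refine hconf hP _ _ (hc (e^[i] x)) s hs _ ?_
    rw [← h]
    exact hc _
  · simp only [hclosed]; rfl
  · have := hnext (n - 1) hP
    rwa [Nat.sub_add_cancel hpos, hclosed] at this

end Snake

namespace Snake

open Equiv

/-- A bound for the lengths of the words of the generators. -/
def wordBound (P : Prob) : ℕ := P.2.1.flatten.length

lemma length_wd_le (P : Prob) (s : ℕ) : (wd P s).length ≤ wordBound P := by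
  unfold wd wordBound
  by_cases h : s < P.2.1.length
  · rw [List.getD_eq_getElem _ _ h]
    exact (List.sublist_flatten_of_mem (List.getElem_mem h)).length_le
  · rw [List.getD_eq_default _ _ (not_lt.1 h)]
    simp

/-- The endomorphism of conjugation by `T`, shifting the conjugates of `A`. -/
def conjShift {P : Type*} [Group P] (A T : P) (h : ℕ) :
    conjClosure A T h →* conjClosure A T (h + 1) :=
  ((MulAut.conj T).toMonoidHom.comp (conjClosure A T h).subtype).codRestrict _ (by
    rintro ⟨x, hx⟩
    simp only [MonoidHom.comp_apply, Subgroup.subtype_apply, MulEquiv.coe_toMonoidHom,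
      MulAut.conj_apply]
    induction hx using Subgroup.closure_induction with
    | mem x hx =>
      obtain ⟨j, hj, rfl⟩ := hx
      rw [← conjT_succ]
      exact conjT_mem (by omega)
    | one => simp
    | mul x y hx hy ihx ihy => simpa [mul_assoc] using mul_mem ihx ihy
    | inv x hx ih => simpa [mul_assoc] using inv_mem ih)

lemma equivariant_of_allowed {P Q : Type*} [Group P] [Group Q] {A T : P} {A' T' : Q} {h : ℕ}
    {φ : conjClosure A T (h + 1) →* Q}
    (hφ : ∀ (j : ℕ) (hj : j < h + 1), φ ⟨conjT A T j, conjT_mem hj⟩ = conjT A' T' j)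
    (c : conjClosure A T h) :
    T' * φ (Subgroup.inclusion (conjClosure_mono A T h.le_succ) c) =
      φ (conjShift A T h c) * T' := by
  rw [← mul_inv_eq_iff_eq_mul]
  let f : conjClosure A T h →* Q := (MulAut.conj T').toMonoidHom.comp
    (φ.comp (Subgroup.inclusion (conjClosure_mono A T h.le_succ)))
  let g : conjClosure A T h →* Q := φ.comp (conjShift A T h)
  change f c = g c
  obtain ⟨c, hc⟩ := c
  induction hc using Subgroup.closure_induction with
  | mem x hx =>
    obtain ⟨j, hj, rfl⟩ := hx
    have h1 : f ⟨conjT A T j, conjT_mem hj⟩ = T' * conjT A' T' j * T'⁻¹ := by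
      rw [← hφ j (hj.trans h.lt_succ_self)]; rfl
    have h2 : g ⟨conjT A T j, conjT_mem hj⟩ = conjT A' T' (j + 1) := by
      rw [← hφ (j + 1) (Nat.succ_lt_succ hj)]
      exact congrArg φ (Subtype.ext (conjT_succ A T j).symm)
    rw [h1, h2, conjT_succ]
  | one => exact (map_one f).trans (map_one g).symm
  | mul x y hx hy ihx ihy =>
    exact (map_mul f ⟨x, hx⟩ ⟨y, hy⟩).trans ((congrArg₂ _ ihx ihy).trans
      (map_mul g ⟨x, hx⟩ ⟨y, hy⟩).symm)
  | inv x hx ih => exact (map_inv f ⟨x, hx⟩).trans ((congrArg _ ih).trans (map_inv g ⟨x, hx⟩).symm)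

lemma sum_option_elim {X A : Type*} [Fintype X] [Fintype A] (d : X → Option A) (g : A → ℤ) :
    ∑ x, (d x).elim 0 g = ∑ b, g b * (Nat.card {x // d x = some b} : ℤ) := by
  classical
  simp only [Nat.card_eq_fintype_card, Fintype.card_subtype, Finset.card_filter, Nat.cast_sum,
    Finset.mul_sum]
  rw [Finset.sum_comm]
  refine Finset.sum_congr rfl fun x _ => ?_
  rcases d x with _ | b <;> simp

section Labels

variable {X : Type} {P : Prob} {a t : Perm X} {L : ℕ} {z : ℕ → X} {y : ℕ → ℕ × ℕ}

lemma IsPath.exists_colouring (h : IsPath P (permStep a t) L z y) :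
    ∃ d : X → Option {y // IsLetter P y},
      (∀ i (hi : i < L), d (z i) = some ⟨y i, h.letter i hi⟩) ∧
      ∀ x b, d x = some b → ∃ i < L, z i = x ∧ y i = b.1 := by
  classical
  refine ⟨fun x => if hx : ∃ i < L, z i = x then
    some ⟨y hx.choose, h.letter _ hx.choose_spec.1⟩ else none, fun i hi => ?_, fun x b hb => ?_⟩
  · have hx : ∃ j < L, z j = z i := ⟨i, hi, rfl⟩
    have : hx.choose = i := h.inj _ hx.choose_spec.1 _ hi hx.choose_spec.2
    simp only [hx, dif_pos, this]
  · by_cases hx : ∃ i < L, z i = x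
    · simp only [hx, dif_pos, Option.some.injEq] at hb
      exact ⟨_, hx.choose_spec.1, hx.choose_spec.2, by rw [← hb]⟩
    · simp [hx] at hb

lemma IsPath.sum_colouring [Fintype X] (h : IsPath P (permStep a t) L z y)
    {d : X → Option {y // IsLetter P y}}
    (hd : ∀ i (hi : i < L), d (z i) = some ⟨y i, h.letter i hi⟩)
    (hd' : ∀ x b, d x = some b → ∃ i < L, z i = x ∧ y i = b.1) :
    ∑ x, ((d x).elim 0 fun b => drift (wd P b.1.2)) = pathDrift P y L := by
  classical
  have hinj : Set.InjOn z (Finset.range L) := fun i hi j hj e =>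
    h.inj i (by simpa using hi) j (by simpa using hj) e
  rw [← Finset.sum_subset (Finset.subset_univ ((Finset.range L).image z)), Finset.sum_image hinj]
  · refine Finset.sum_congr rfl fun i hi => ?_
    rw [hd i (Finset.mem_range.1 hi)]
    rfl
  · intro x _ hx
    rcases hb : d x with _ | b
    · rfl
    · obtain ⟨i, hi, hz, -⟩ := hd' x b hb
      exact absurd (Finset.mem_image.2 ⟨i, Finset.mem_range.2 hi, hz⟩) hx

end Labels

/-- Either there is an allowed finite space with an ouroboros of nonzero drift, or the drift of
paths in allowed finite spaces is bounded. -/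
theorem ouro_or_bounded {Q : Type} [Group Q] [Finite Q] (A T : Q) (h : ℕ) (P : Prob) :
    (∃ (X : Type) (_ : Finite X) (a t : Perm X), Allowed (h + 1) A T a t ∧
      ∃ n z y, IsOuro P (permStep a t) n z y ∧ pathDrift P y n ≠ 0) ∨
    ∃ H : ℕ, ∀ (X : Type) (_ : Finite X) (a t : Perm X), Allowed (h + 1) A T a t →
      ∀ L z y, IsPath P (permStep a t) L z y → |pathDrift P y L| < H := by
  classical
  rw [or_iff_not_imp_right]
  intro hn
  push Not at hn
  choose Y hfin a t hall L z y hpath hH using fun k : ℕ => hn (k + 1)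
  choose φ hφ using hall
  choose d hd hd' using fun k => (hpath k).exists_colouring
  have hL : ∀ k, 0 < L k := by
    intro k
    by_contra h0
    have := hH k
    rw [show L k = 0 by omega] at this
    simp [pathDrift] at this
    omega
  let ℓ := wordBound P
  have : Finite {w : Word // w.length ≤ ℓ} := (List.finite_length_le Letter ℓ).to_subtype
  let S := ({w : Word // w.length ≤ ℓ} → Option {y // IsLetter P y}) × Bool × Bool
  let σ : ∀ k, Y k → S := fun k x =>
    (fun w => d k (rep (a k) (t k) w.1 x), decide (x = z k 0), decide (x = z k (L k - 1)))
  obtain ⟨k₁, hk₁⟩ := exists_pump (S := S)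
    (Subgroup.inclusion_injective (conjClosure_mono A T h.le_succ))
    (θ := conjShift A T h) (fun c c' hc => by
      have : T * (c : Q) * T⁻¹ = T * c' * T⁻¹ := congrArg Subtype.val hc
      exact Subtype.ext (by simpa using this))
    Y φ t (fun k c => equivariant_of_allowed (hφ k) c) σ
  obtain ⟨k₂, hk₂, X, hX, ψ, u, ρ, hequiv, hρ₁, hρ₂, hcard⟩ := hk₁
      (pathDrift P (y k₁) (L k₁)).natAbs
  set α : Perm X := ψ ⟨conjT A T 0, conjT_mem h.succ_pos⟩ with hα
  have ha : ∀ k, φ k ⟨conjT A T 0, conjT_mem h.succ_pos⟩ = a k := by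
    intro k; rw [hφ k 0 h.succ_pos]; simp [conjT]
  refine ⟨X, hX, α, u, allowed_of_equivariant ψ u fun j hj => ?_, ?_⟩
  · rw [show (⟨conjT A T j, conjT_mem (hj.trans h.lt_succ_self)⟩ : conjClosure A T (h + 1)) =
      Subgroup.inclusion (conjClosure_mono A T h.le_succ) ⟨conjT A T j, conjT_mem hj⟩ from rfl,
      hequiv]
    congr 2
    exact Subtype.ext (conjT_succ A T j).symm
  let d₀ : X → Option {y // IsLetter P y} := fun x => (ρ x).1 ⟨[], Nat.zero_le _⟩
  have hletter : ∀ l x, ∃ v, ρ x = σ k₂ v ∧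
      ρ (letterVal α u l x) = σ k₂ (letterVal (a k₂) (t k₂) l v) := by
    rintro ⟨_ | _, _ | _⟩ x
    · obtain ⟨v, hv, hv'⟩ := hρ₁ (⟨conjT A T 0, conjT_mem h.succ_pos⟩)⁻¹ x
      rw [map_inv, map_inv, ha] at hv'
      exact ⟨v, hv, hv'⟩
    · obtain ⟨v, hv, hv'⟩ := hρ₁ ⟨conjT A T 0, conjT_mem h.succ_pos⟩ x
      rw [ha] at hv'
      exact ⟨v, hv, hv'⟩
    · obtain ⟨v, hv, hv'⟩ := hρ₂ (u⁻¹ x)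
      refine ⟨t k₂ v, ?_, ?_⟩
      · rw [← hv']; simp
      · simpa [letterVal] using hv
    · exact hρ₂ x
  have hwin : ∀ (w : Word) (hw : w.length ≤ ℓ) x, (ρ x).1 ⟨w, hw⟩ = d₀ (rep α u w x) := by
    intro w
    induction w using List.reverseRecOn with
    | nil => intro _ x; rfl
    | append_singleton w l ih =>
      intro hw x
      have hw' : w.length ≤ ℓ := by simp at hw; omega
      obtain ⟨v, hv, hv'⟩ := hletter l x
      have e1 : (ρ x).1 ⟨w ++ [l], hw⟩ = (ρ (letterVal α u l x)).1 ⟨w, hw'⟩ := by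
        rw [hv, hv']; simp [σ]
      rw [e1, ih]
      simp
  have hloc : ∀ x, ∃ v, ρ x = σ k₂ v ∧
      ∀ w : Word, w.length ≤ ℓ → d₀ (rep α u w x) = d k₂ (rep (a k₂) (t k₂) w v) := by
    intro x
    obtain ⟨v, hv, -⟩ := hρ₁ 1 x
    exact ⟨v, hv, fun w hw => by rw [← hwin w hw, hv]⟩
  have hsub : ∀ k (w : Y k), Nat.card {x // decide (x = w) = true} = 1 := by
    intro k w
    simp
  have hstart : ∀ x, (ρ x).2.1 = false := by
    intro x
    have := hcard fun s => s.2.1 = true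
    rw [hsub, hsub, Nat.add_eq_right, Nat.card_eq_zero] at this
    by_contra hx
    rcases this with this | this
    · exact this.false ⟨x, by simpa using hx⟩
    · exact this.not_finite inferInstance
  have hend : ∀ x, (ρ x).2.2 = false := by
    intro x
    have := hcard fun s => s.2.2 = true
    rw [hsub, hsub, Nat.add_eq_right, Nat.card_eq_zero] at this
    by_contra hx
    rcases this with this | this
    · exact this.false ⟨x, by simpa using hx⟩
    · exact this.not_finite inferInstance
  have hvis : ∀ x b, d₀ x = some b → ∃ i, ∃ hi : i + 2 < L k₂,
      b = ⟨y k₂ (i + 1), (hpath k₂).letter _ (by omega)⟩ ∧ ∀ w : Word, w.length ≤ ℓ →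
        d₀ (rep α u w x) = d k₂ (rep (a k₂) (t k₂) w (z k₂ (i + 1))) := by
    intro x b hb
    obtain ⟨v, hv, hw⟩ := hloc x
    have h0 : d₀ x = d k₂ v := by simpa using hw [] (Nat.zero_le _)
    rw [h0] at hb
    obtain ⟨i, hi, rfl, hy⟩ := hd' k₂ v b hb
    have h1 := hstart x
    have h2 := hend x
    rw [hv] at h1 h2
    simp only [σ, decide_eq_false_iff_not] at h1 h2
    obtain ⟨i, rfl⟩ : ∃ j, i = j + 1 := ⟨i - 1, by
      rcases i with _ | i
      · exact absurd rfl h1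
      · rfl⟩
    have : i + 1 ≠ L k₂ - 1 := fun e => h2 (by rw [e])
    exact ⟨i, by omega, Subtype.ext hy.symm, hw⟩
  have := Fintype.ofFinite X
  have := Fintype.ofFinite {y // IsLetter P y}
  have := fun k => Fintype.ofFinite (Y k)
  have hinvstep : ∀ (x : X) s, permStep α u x (wd P s) = rep α u (invWord (wd P s)) x :=
      fun x s => by
    rw [rep_invWord]; rfl
  have hinvstep' : ∀ (x : Y k₂) s, permStep (a k₂) (t k₂) x (wd P s) =
      rep (a k₂) (t k₂) (invWord (wd P s)) x := fun x s => by
    rw [rep_invWord]; rfl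
  have hlen : ∀ s, (invWord (wd P s)).length ≤ ℓ := fun s => by
    rw [length_invWord]; exact length_wd_le P s
  refine exists_ouro_of_local P α u d₀ ?_ ?_ ?_ ?_
  · intro x b hb
    obtain ⟨i, hi, rfl, hw⟩ := hvis x b hb
    refine ⟨⟨y k₂ (i + 1 + 1), (hpath k₂).letter _ hi⟩, ?_, fun hP => (hpath k₂).next hP _ hi⟩
    rw [hinvstep, hw _ (hlen _), ← hinvstep', ← (hpath k₂).step _ (by omega), hd k₂ _ hi]
  · intro x b hb
    obtain ⟨i, hi, rfl, hw⟩ := hvis x b hb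
    refine ⟨⟨y k₂ i, (hpath k₂).letter _ (by omega)⟩, ?_⟩
    rw [hw _ (length_wd_le _ _), (hpath k₂).step i (by omega), permStep]
    simp only [Perm.inv_def, Equiv.apply_symm_apply]
    exact hd k₂ i (by omega)
  · intro hP x b hb s hs c hc
    obtain ⟨i, hi, rfl, hw⟩ := hvis x b hb
    rw [hinvstep, hw _ (hlen _), ← hinvstep'] at hc
    obtain ⟨j, hj, hz, hy⟩ := hd' _ _ _ hc
    rw [← hy]
    exact (hpath k₂).conf hP _ (by omega) _ hj s hs hz
  · intro h0
    have hd₀ : ∀ k, (∑ x, ((d k x).elim 0 fun b => drift (wd P b.1.2))) = pathDrift P (y k) (L k) :=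
      fun k => (hpath k).sum_colouring (hd k) (hd' k)
    have e := fun b => hcard fun s => s.1 ⟨[], Nat.zero_le _⟩ = some b
    have e' : ∀ b, (Nat.card {x // d₀ x = some b} : ℤ) + Nat.card (conjClosure A T (h + 1)) *
        Nat.card {x // d k₁ x = some b} =
        Nat.card (conjClosure A T (h + 1)) * Nat.card {x // d k₂ x = some b} := by
      intro b
      exact_mod_cast e b
    have e'' : (Nat.card (conjClosure A T (h + 1)) : ℤ) * pathDrift P (y k₁) (L k₁) =
        Nat.card (conjClosure A T (h + 1)) * pathDrift P (y k₂) (L k₂) := by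
      rw [← zero_add (_ * pathDrift P (y k₁) (L k₁)), ← h0, ← hd₀, ← hd₀, sum_option_elim,
        sum_option_elim, sum_option_elim, Finset.mul_sum, Finset.mul_sum, ← Finset.sum_add_distrib]
      refine Finset.sum_congr rfl fun b _ => ?_
      rw [mul_left_comm, mul_left_comm _ (drift _), ← e' b]
      ring
    have hK : (Nat.card (conjClosure A T (h + 1)) : ℤ) ≠ 0 := by
      exact_mod_cast Nat.card_pos.ne'
    have := mul_left_cancel₀ hK e''
    have h3 := hH k₂
    rw [← this] at h3
    push_cast at h3
    have : |pathDrift P (y k₁) (L k₁)| = ((pathDrift P (y k₁) (L k₁)).natAbs : ℤ) :=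
      Int.abs_eq_natAbs _
    omega

end Snake

namespace Snake

/-! ### Primitive recursive predicates -/

/-- All lists of length `n` with entries in `A`. -/
def listsOf {α : Type*} (A : List α) (n : ℕ) : List (List α) :=
  (List.range n).foldl (fun s _ => s.flatMap fun l => A.map fun a => a :: l) [[]]

lemma listsOf_succ {α : Type*} (A : List α) (n : ℕ) :
    listsOf A (n + 1) = (listsOf A n).flatMap fun l => A.map fun a => a :: l := by
  simp [listsOf, List.range_succ]

lemma mem_listsOf {α : Type*} {A : List α} {n : ℕ} {l : List α} :
    l ∈ listsOf A n ↔ l.length = n ∧ ∀ a ∈ l, a ∈ A := by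
  induction n generalizing l with
  | zero => simp +contextual [listsOf, List.length_eq_zero_iff]
  | succ n ih =>
    rw [listsOf_succ]
    cases l with
    | nil => simp
    | cons a l => simp [ih]; tauto

attribute [fun_prop] Primrec

section Primrec

variable {α β γ σ : Type*} [Primcodable α] [Primcodable β] [Primcodable γ] [Primcodable σ]

@[fun_prop] lemma primrec_id : Primrec fun a : α => a := Primrec.id

@[fun_prop] lemma primrec_const (b : β) : Primrec fun _ : α => b := Primrec.const b

@[fun_prop] lemma primrec_comp {f : β → γ} {g : α → β} (hf : Primrec f) (hg : Primrec g) :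
    Primrec fun a => f (g a) := hf.comp hg

@[fun_prop] lemma primrec_fst {f : α → β × γ} (hf : Primrec f) : Primrec fun a => (f a).1 :=
  Primrec.fst.comp hf

@[fun_prop] lemma primrec_snd {f : α → β × γ} (hf : Primrec f) : Primrec fun a => (f a).2 :=
  Primrec.snd.comp hf

@[fun_prop] lemma primrec_mk {f : α → β} {g : α → γ} (hf : Primrec f) (hg : Primrec g) :
    Primrec fun a => (f a, g a) := hf.pair hg

@[fun_prop] lemma primrec_add {f g : α → ℕ} (hf : Primrec f) (hg : Primrec g) :
    Primrec fun a => f a + g a := Primrec.nat_add.comp hf hg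

@[fun_prop] lemma primrec_mul {f g : α → ℕ} (hf : Primrec f) (hg : Primrec g) :
    Primrec fun a => f a * g a := Primrec.nat_mul.comp hf hg

@[fun_prop] lemma primrec_sub {f g : α → ℕ} (hf : Primrec f) (hg : Primrec g) :
    Primrec fun a => f a - g a := Primrec.nat_sub.comp hf hg

@[fun_prop] lemma primrec_not {f : α → Bool} (hf : Primrec f) : Primrec fun a => !(f a) :=
  Primrec.not.comp hf

@[fun_prop] lemma primrec_getD {f : α → List β} {g : α → ℕ} {d : β} (hf : Primrec f)
    (hg : Primrec g) : Primrec fun a => (f a).getD (g a) d := (Primrec.list_getD d).comp hf hg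

@[fun_prop] lemma primrec_length {f : α → List β} (hf : Primrec f) :
    Primrec fun a => (f a).length := Primrec.list_length.comp hf

@[fun_prop] lemma primrec_range {f : α → ℕ} (hf : Primrec f) :
    Primrec fun a => List.range (f a) := Primrec.list_range.comp hf

@[fun_prop] lemma primrec_listCons {f : α → β} {g : α → List β} (hf : Primrec f) (hg : Primrec g) :
    Primrec fun a => f a :: g a := Primrec.list_cons.comp hf hg

@[fun_prop] lemma primrec_append {f g : α → List β} (hf : Primrec f) (hg : Primrec g) :
    Primrec fun a => f a ++ g a := Primrec.list_append.comp hf hg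

@[fun_prop] lemma primrec_flatten {f : α → List (List β)} (hf : Primrec f) :
    Primrec fun a => (f a).flatten := Primrec.list_flatten.comp hf

@[fun_prop] lemma primrec_map {f : α → List β} {g : α → β → γ} (hf : Primrec f)
    (hg : Primrec fun q : α × β => g q.1 q.2) : Primrec fun a => (f a).map (g a) :=
  Primrec.list_map hf hg

@[fun_prop] lemma primrec_flatMap {f : α → List β} {g : α → β → List γ} (hf : Primrec f)
    (hg : Primrec fun q : α × β => g q.1 q.2) : Primrec fun a => (f a).flatMap (g a) :=
  Primrec.list_flatMap hf hg

@[fun_prop] lemma primrec_foldl {f : α → List β} {g : α → σ} {h : α → σ → β → σ} (hf : Primrec f)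
    (hg : Primrec g) (hh : Primrec fun q : α × σ × β => h q.1 q.2.1 q.2.2) :
    Primrec fun a => (f a).foldl (h a) (g a) :=
  Primrec.list_foldl hf hg (h := fun a q => h a q.1 q.2) hh

@[fun_prop] lemma primrec_cond {c : α → Bool} {f g : α → β} (hc : Primrec c) (hf : Primrec f)
    (hg : Primrec g) : Primrec fun a => cond (c a) (f a) (g a) := Primrec.cond hc hf hg

lemma primrecPred_eq {f g : α → β} (hf : Primrec f) (hg : Primrec g) :
    PrimrecPred fun a => f a = g a := by
  classical
  exact Primrec.eq.comp hf hg

lemma primrecPred_lt {f g : α → ℕ} (hf : Primrec f) (hg : Primrec g) :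
    PrimrecPred fun a => f a < g a := Primrec.nat_lt.comp hf hg

lemma primrecPred_le {f g : α → ℕ} (hf : Primrec f) (hg : Primrec g) :
    PrimrecPred fun a => f a ≤ g a := Primrec.nat_le.comp hf hg

lemma primrecPred_imp {p q : α → Prop} (hp : PrimrecPred p) (hq : PrimrecPred q) :
    PrimrecPred fun a => p a → q a :=
  (hp.not.or hq).of_eq fun a => by tauto

lemma primrecPred_ball {f : α → List β} {p : α → β → Prop} (hf : Primrec f)
    (hp : PrimrecPred fun q : α × β => p q.1 q.2) : PrimrecPred fun a => ∀ b ∈ f a, p a b := by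
  have h : PrimrecRel fun (b : β) (a : α) => p a b :=
    hp.comp (f := fun q : β × α => (q.2, q.1)) (by fun_prop)
  exact (PrimrecRel.forall_mem_list h).comp hf Primrec.id

lemma primrecPred_ball_lt {f : α → ℕ} {p : α → ℕ → Prop} (hf : Primrec f)
    (hp : PrimrecPred fun q : α × ℕ => p q.1 q.2) : PrimrecPred fun a => ∀ b < f a, p a b :=
  (primrecPred_ball (f := fun a => List.range (f a)) (by fun_prop) hp).of_eq fun a => by simp

lemma primrecPred_bex {f : α → List β} {p : α → β → Prop} (hf : Primrec f)
    (hp : PrimrecPred fun q : α × β => p q.1 q.2) : PrimrecPred fun a => ∃ b ∈ f a, p a b :=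
  (primrecPred_ball (p := fun a b => ¬ p a b) hf hp.not).not.of_eq fun a => by push Not; rfl

lemma primrecPred_bex_lt {f : α → ℕ} {p : α → ℕ → Prop} (hf : Primrec f)
    (hp : PrimrecPred fun q : α × ℕ => p q.1 q.2) : PrimrecPred fun a => ∃ b < f a, p a b :=
  (primrecPred_bex (f := fun a => List.range (f a)) (by fun_prop) hp).of_eq fun a => by simp

lemma primrecPred_mem {f : α → β} {g : α → List β} (hf : Primrec f) (hg : Primrec g) :
    PrimrecPred fun a => f a ∈ g a :=
  (primrecPred_bex (p := fun a b => f a = b) hg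
    (primrecPred_eq (by fun_prop) (by fun_prop))).of_eq fun a => by simp

@[fun_prop] lemma primrec_listsOf {f : α → List β} {g : α → ℕ} (hf : Primrec f) (hg : Primrec g) :
    Primrec fun a => listsOf (f a) (g a) := by
  unfold listsOf
  fun_prop

end Primrec

/-! ### Codes of finite spaces with two permutations -/

/-- A code of a finite space with two permutations: the tables of the first permutation and its
inverse and of the second permutation and its inverse. -/
abbrev Block : Type := (List ℕ × List ℕ) × (List ℕ × List ℕ)

/-- The number of points of a coded space. -/
def size (b : Block) : ℕ := b.1.1.length

/-- The action of a letter on a coded space. -/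
def app (b : Block) (l : Letter) (x : ℕ) : ℕ :=
  (cond l.1 (cond l.2 b.2.1 b.2.2) (cond l.2 b.1.1 b.1.2)).getD x 0

/-- The inverse letter. -/
def invLetter (l : Letter) : Letter := (l.1, !l.2)

/-- The right action of a word on a coded space. -/
def ev (b : Block) (w : Word) (x : ℕ) : ℕ := w.foldl (fun x l => app b (invLetter l) x) x

/-- All letters. -/
def letters : List Letter := [(false, false), (false, true), (true, false), (true, true)]

lemma mem_letters (l : Letter) : l ∈ letters := by rcases l with ⟨_ | _, _ | _⟩ <;> simp [letters]

/-- The code describes a space with two permutations. -/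
def Valid (b : Block) : Prop :=
  ∀ l ∈ letters, ∀ x < size b, app b l x < size b ∧ app b (invLetter l) (app b l x) = x

/-- The number of occurrences of a letter in a word. -/
def occ (l : Letter) (w : Word) : ℕ := (w.filter fun l' => l' = l).length

lemma drift_eq_occ (w : Word) : drift w = occ (true, true) w - occ (true, false) w := by
  induction w with
  | nil => simp [occ]
  | cons l w ih =>
    rw [drift_cons, ih]
    rcases l with ⟨_ | _, _ | _⟩ <;> simp [occ, letterDrift] <;> ring

/-- The words have the same total exponent of `t`. -/
def SameDrift (v w : Word) : Prop :=
  occ (true, true) v + occ (true, false) w = occ (true, true) w + occ (true, false) v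

lemma sameDrift_iff {v w : Word} : SameDrift v w ↔ drift v = drift w := by
  rw [SameDrift, drift_eq_occ, drift_eq_occ]
  omega

/-- Two words have the same effect on the listed points and, if required, the same drift. -/
def Eqv (e : Bool × List (Block × ℕ)) (v w : Word) : Prop :=
  (e.1 = true → SameDrift v w) ∧ ∀ p ∈ e.2, ev p.1 v p.2 = ev p.1 w p.2

/-- The word read along the first `i` steps of a coloured path. -/
def pw (P : Prob) (y : ℕ → ℕ × ℕ) (i : ℕ) : Word :=
  (List.range i).flatMap fun j => wd P (y j).2

/-- The colours `y` define a self-avoiding path with `L` vertices, where `R` tells whether two words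
lead to the same point. -/
def RPath (P : Prob) (R : Word → Word → Prop) (L : ℕ) (y : ℕ → ℕ × ℕ) : Prop :=
  (∀ i < L, IsLetter P (y i)) ∧
  (∀ i < L, ∀ j < L, R (pw P y i) (pw P y j) → i = j) ∧
  (P.1 = false → ∀ i < L, i + 1 < L → (y i, ((y i).2, y (i + 1))) ∈ P.2.2.2) ∧
  (P.1 = true → ∀ i < L, ∀ j < L, ∀ s < P.2.1.length,
    R (pw P y j) (pw P y i ++ wd P s) → (y i, (s, y j)) ∈ P.2.2.2)

/-- The colours `y` define a self-avoiding closed path with `n` vertices. -/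
def ROuro (P : Prob) (R : Word → Word → Prop) (n : ℕ) (y : ℕ → ℕ × ℕ) : Prop :=
  RPath P R n y ∧ 0 < n ∧ R (pw P y n) [] ∧
    (P.1 = false → (y (n - 1), ((y (n - 1)).2, y 0)) ∈ P.2.2.2)

/-- The function with the given list of values. -/
def fn (ys : List (ℕ × ℕ)) (i : ℕ) : ℕ × ℕ := ys.getD i (0, 0)

section

variable {α : Type*} [Primcodable α]

@[fun_prop] lemma primrec_size {f : α → Block} (hf : Primrec f) : Primrec fun a => size (f a) := by
  unfold size; fun_prop

@[fun_prop] lemma primrec_app {f : α → Block} {g : α → Letter} {h : α → ℕ} (hf : Primrec f)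
    (hg : Primrec g) (hh : Primrec h) : Primrec fun a => app (f a) (g a) (h a) := by
  unfold app; fun_prop

@[fun_prop] lemma primrec_invLetter {f : α → Letter} (hf : Primrec f) :
    Primrec fun a => invLetter (f a) := by unfold invLetter; fun_prop

@[fun_prop] lemma primrec_ev {f : α → Block} {g : α → Word} {h : α → ℕ} (hf : Primrec f)
    (hg : Primrec g) (hh : Primrec h) : Primrec fun a => ev (f a) (g a) (h a) := by
  unfold ev; fun_prop

lemma primrecPred_valid {f : α → Block} (hf : Primrec f) : PrimrecPred fun a => Valid (f a) :=
  primrecPred_ball (by fun_prop) (primrecPred_ball_lt (by fun_prop)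
    ((primrecPred_lt (by fun_prop) (by fun_prop)).and (primrecPred_eq (by fun_prop) (by fun_prop))))

@[fun_prop] lemma primrec_occ (l : Letter) {f : α → Word} (hf : Primrec f) :
    Primrec fun a => occ l (f a) := by
  have : Primrec fun w : Word => w.filter fun l' => l' = l :=
    Primrec.listFilter (primrecPred_eq (by fun_prop) (by fun_prop))
  unfold occ
  exact Primrec.list_length.comp (this.comp hf)

lemma primrecPred_sameDrift {f g : α → Word} (hf : Primrec f) (hg : Primrec g) :
    PrimrecPred fun a => SameDrift (f a) (g a) :=
  primrecPred_eq (by fun_prop) (by fun_prop)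

lemma primrecPred_eqv {e : α → Bool × List (Block × ℕ)} {f g : α → Word} (he : Primrec e)
    (hf : Primrec f) (hg : Primrec g) : PrimrecPred fun a => Eqv (e a) (f a) (g a) :=
  (primrecPred_imp (primrecPred_eq (by fun_prop) (by fun_prop)) (primrecPred_sameDrift hf hg)).and
    (primrecPred_ball (by fun_prop) (primrecPred_eq (by fun_prop) (by fun_prop)))

@[fun_prop] lemma primrec_wd {P : α → Prob} {s : α → ℕ} (hP : Primrec P) (hs : Primrec s) :
    Primrec fun a => wd (P a) (s a) := by
  unfold wd; fun_prop

@[fun_prop] lemma primrec_fn {f : α → List (ℕ × ℕ)} {g : α → ℕ} (hf : Primrec f)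
    (hg : Primrec g) : Primrec fun a => fn (f a) (g a) := by
  unfold fn; fun_prop

@[fun_prop] lemma primrec_pw {P : α → Prob} {f : α → List (ℕ × ℕ)} {g : α → ℕ} (hP : Primrec P)
    (hf : Primrec f) (hg : Primrec g) : Primrec fun a => pw (P a) (fn (f a)) (g a) := by
  unfold pw; fun_prop

lemma primrecPred_rPath {P : α → Prob} {e : α → Bool × List (Block × ℕ)} {L : α → ℕ}
    {f : α → List (ℕ × ℕ)} (hP : Primrec P) (he : Primrec e) (hL : Primrec L) (hf : Primrec f) :
    PrimrecPred fun a => RPath (P a) (Eqv (e a)) (L a) (fn (f a)) := by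
  refine .and ?_ (.and ?_ (.and ?_ ?_))
  · exact primrecPred_ball_lt hL (.and (primrecPred_lt (by fun_prop) (by fun_prop))
      (primrecPred_lt (by fun_prop) (by fun_prop)))
  · exact primrecPred_ball_lt hL (primrecPred_ball_lt (by fun_prop) (primrecPred_imp
      (primrecPred_eqv (by fun_prop) (by fun_prop) (by fun_prop))
      (primrecPred_eq (by fun_prop) (by fun_prop))))
  · exact primrecPred_imp (primrecPred_eq (by fun_prop) (by fun_prop)) (primrecPred_ball_lt hL
      (primrecPred_imp (primrecPred_lt (by fun_prop) (by fun_prop))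
        (primrecPred_mem (by fun_prop) (by fun_prop))))
  · exact primrecPred_imp (primrecPred_eq (by fun_prop) (by fun_prop)) (primrecPred_ball_lt hL
      (primrecPred_ball_lt (by fun_prop) (primrecPred_ball_lt (by fun_prop) (primrecPred_imp
        (primrecPred_eqv (by fun_prop) (by fun_prop) (by fun_prop))
        (primrecPred_mem (by fun_prop) (by fun_prop))))))

lemma primrecPred_rOuro {P : α → Prob} {e : α → Bool × List (Block × ℕ)} {L : α → ℕ}
    {f : α → List (ℕ × ℕ)} (hP : Primrec P) (he : Primrec e) (hL : Primrec L) (hf : Primrec f) :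
    PrimrecPred fun a => ROuro (P a) (Eqv (e a)) (L a) (fn (f a)) :=
  .and (primrecPred_rPath hP he hL hf) (.and (primrecPred_lt (by fun_prop) (by fun_prop))
    (.and (primrecPred_eqv (by fun_prop) (by fun_prop) (by fun_prop))
      (primrecPred_imp (primrecPred_eq (by fun_prop) (by fun_prop))
        (primrecPred_mem (by fun_prop) (by fun_prop)))))

end

end Snake

namespace Snake

open Equiv

/-! ### Semantics of codes -/

open Classical in
/-- The permutations of a coded space. -/
noncomputable def perm (b : Block) (g : Bool) : Perm (Fin (size b)) :=
  if h : Valid b then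
    { toFun := fun x => ⟨app b (g, true) x, (h _ (mem_letters _) _ x.2).1⟩
      invFun := fun x => ⟨app b (g, false) x, (h _ (mem_letters _) _ x.2).1⟩
      left_inv := fun x => Fin.ext (h _ (mem_letters (g, true)) _ x.2).2
      right_inv := fun x => Fin.ext (h _ (mem_letters (g, false)) _ x.2).2 }
  else 1

/-- The right action of words on a coded space, by permutations. -/
noncomputable def pstep (b : Block) (x : Fin (size b)) (w : Word) : Fin (size b) :=
  permStep (perm b false) (perm b true) x w

@[simp] lemma permStep_nil {X : Type*} (a t : Perm X) (x : X) : permStep a t x [] = x := by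
  simp [permStep]

lemma permStep_append {X : Type*} (a t : Perm X) (x : X) (v w : Word) :
    permStep a t x (v ++ w) = permStep a t (permStep a t x v) w := by
  simp [permStep]

lemma groupStep_append {Q : Type*} [Group Q] (a t g : Q) (v w : Word) :
    groupStep a t g (v ++ w) = groupStep a t (groupStep a t g v) w := by
  simp [groupStep, mul_assoc]

lemma coe_pstep {b : Block} (h : Valid b) (x : Fin (size b)) (w : Word) :
    (pstep b x w : ℕ) = ev b w x := by
  induction w generalizing x with
  | nil => simp [pstep, ev]
  | cons l w ih =>
    have h1 : (pstep b x [l] : ℕ) = app b (invLetter l) x := by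
      rcases l with ⟨_ | _, _ | _⟩ <;>
        simp [pstep, permStep, letterVal, perm, h, invLetter, Perm.inv_def]
    have h2 : pstep b x (l :: w) = pstep b (pstep b x [l]) w :=
      permStep_append _ _ x [l] w
    rw [h2, ih, h1]
    rfl

/-- Every finite space with two permutations has a code. -/
lemma exists_block {X : Type*} [Finite X] (a t : Perm X) :
    ∃ b, Valid b ∧ ∃ e : X ≃ Fin (size b), perm b false = e.permCongr a ∧
      perm b true = e.permCongr t := by
  obtain ⟨n, ⟨e⟩⟩ := Finite.exists_equiv_fin X
  let f : Perm X → List ℕ := fun p => List.ofFn fun i => (e (p (e.symm i)) : ℕ)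
  have hf : ∀ (p : Perm X) (i : Fin n), (f p).getD i 0 = e (p (e.symm i)) := by
    intro p i
    simp [f]
  obtain ⟨b, hb⟩ : ∃ b : Block, b = ((f a, f a⁻¹), (f t, f t⁻¹)) := ⟨_, rfl⟩
  have hn : size b = n := by simp [hb, size, f]
  have happ : ∀ (l : Letter) (i : Fin n), app b l i = e (letterVal a t l (e.symm i)) := by
    intro l i
    rcases l with ⟨_ | _, _ | _⟩ <;> simp only [hb, app, letterVal, cond_true, cond_false, hf]
  have hv : Valid b := by
    intro l _ x hx
    rw [hn] at hx ⊢
    lift x to Fin n using hx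
    rw [happ]
    refine ⟨Fin.is_lt _, ?_⟩
    rw [happ]
    rcases l with ⟨_ | _, _ | _⟩ <;> simp [invLetter, letterVal]
  refine ⟨b, hv, e.trans (finCongr hn.symm), ?_, ?_⟩ <;>
  · ext i
    have := fun l => happ l (finCongr hn i)
    simp only [finCongr_apply, Fin.val_cast] at this
    simp [perm, hv, this, letterVal, Equiv.permCongr_apply]

/-- The product of the symmetric groups of a set of coded spaces. -/
abbrev Gam (B : Set Block) : Type := ∀ b : B, Perm (Fin (size b.1))

/-- The distinguished elements of the product of symmetric groups. -/
noncomputable def gen (B : Set Block) (g : Bool) : Gam B := fun b => perm b.1 g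

/-- The distinguished elements of the product of symmetric groups with an infinite cyclic factor. -/
noncomputable def fullGen (B : Set Block) (g : Bool) : Gam B × Multiplicative ℤ :=
  (gen B g, Multiplicative.ofAdd (cond g 1 0))

lemma rep_gen_apply (B : Set Block) (w : Word) (b : B) :
    rep (gen B false) (gen B true) w b = rep (perm b.1 false) (perm b.1 true) w :=
  map_rep (Pi.evalMonoidHom (fun b : B => Perm (Fin (size b.1))) b) _ _ w

lemma rep_fullGen (B : Set Block) (w : Word) :
    rep (fullGen B false) (fullGen B true) w =
      (rep (gen B false) (gen B true) w, Multiplicative.ofAdd (drift w)) := by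
  rw [fullGen, fullGen, rep_prod, ← rep_ofAdd]
  rfl

lemma rep_fullGen_eq_iff {B : Set Block} {v w : Word} :
    rep (fullGen B false) (fullGen B true) v = rep (fullGen B false) (fullGen B true) w ↔
      drift v = drift w ∧ ∀ b ∈ B,
        rep (perm b false) (perm b true) v = rep (perm b false) (perm b true) w := by
  rw [rep_fullGen, rep_fullGen, Prod.ext_iff, and_comm]
  simp only [EmbeddingLike.apply_eq_iff_eq, funext_iff, rep_gen_apply, Subtype.forall]

/-- The set of entries of a list of codes. -/
def toSet (Bs : List Block) : Set Block := {b | b ∈ Bs}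

instance (Bs : List Block) : Finite (toSet Bs) := List.finite_toSet Bs

/-- All points of all coded spaces in a list. -/
def allPts (Bs : List Block) : List (Block × ℕ) :=
  Bs.flatMap fun b => (List.range (size b)).map fun x => (b, x)

lemma mem_allPts {Bs : List Block} {p : Block × ℕ} : p ∈ allPts Bs ↔ p.1 ∈ Bs ∧ p.2 < size p.1 := by
  rcases p with ⟨b, x⟩
  simp only [allPts, List.mem_flatMap, List.mem_map, List.mem_range, Prod.mk.injEq]
  grind

@[fun_prop] lemma primrec_allPts {α : Type*} [Primcodable α] {f : α → List Block} (hf : Primrec f) :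
    Primrec fun a => allPts (f a) := by
  unfold allPts; fun_prop

lemma rep_perm_eq_iff {b : Block} (hb : Valid b) {v w : Word} :
    rep (perm b false) (perm b true) v = rep (perm b false) (perm b true) w ↔
      ∀ x < size b, ev b v x = ev b w x := by
  rw [← inv_inj, Perm.ext_iff]
  refine ⟨fun h x hx => ?_, fun h x => Fin.ext ?_⟩
  · rw [← coe_pstep hb ⟨x, hx⟩, ← coe_pstep hb ⟨x, hx⟩]
    exact congrArg Fin.val (h ⟨x, hx⟩)
  · have := h x x.2
    rwa [← coe_pstep hb, ← coe_pstep hb] at this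

lemma eqv_allPts {Bs : List Block} (h : ∀ b ∈ Bs, Valid b) {v w : Word} :
    Eqv (true, allPts Bs) v w ↔
      rep (fullGen (toSet Bs) false) (fullGen (toSet Bs) true) v =
        rep (fullGen (toSet Bs) false) (fullGen (toSet Bs) true) w := by
  rw [rep_fullGen_eq_iff, Eqv, sameDrift_iff]
  simp only [forall_const, mem_allPts]
  refine and_congr_right fun _ => ⟨fun hb b hB => ?_, fun hb p hp => ?_⟩
  · exact (rep_perm_eq_iff (h b hB)).2 fun x hx => hb (b, x) ⟨hB, hx⟩
  · exact (rep_perm_eq_iff (h _ hp.1)).1 (hb _ hp.1) _ hp.2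

/-! ### Paths and words -/

lemma pw_succ (P : Prob) (y : ℕ → ℕ × ℕ) (i : ℕ) :
    pw P y (i + 1) = pw P y i ++ wd P (y i).2 := by
  simp [pw, List.range_succ]

@[simp] lemma pw_zero (P : Prob) (y : ℕ → ℕ × ℕ) : pw P y 0 = [] := rfl

lemma drift_pw (P : Prob) (y : ℕ → ℕ × ℕ) (i : ℕ) : drift (pw P y i) = pathDrift P y i := by
  induction i with
  | zero => simp [pathDrift]
  | succ i ih => rw [pw_succ, drift_append, ih, pathDrift, pathDrift, Finset.sum_range_succ]

lemma length_pw_le (P : Prob) (y : ℕ → ℕ × ℕ) (i : ℕ) : (pw P y i).length ≤ i * wordBound P := by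
  induction i with
  | zero => simp
  | succ i ih =>
    rw [pw_succ, List.length_append, Nat.succ_mul]
    exact Nat.add_le_add ih (length_wd_le P _)

lemma pw_congr {P : Prob} {y y' : ℕ → ℕ × ℕ} {i : ℕ} (h : ∀ j < i, y j = y' j) :
    pw P y i = pw P y' i := by
  induction i with
  | zero => rfl
  | succ i ih =>
    rw [pw_succ, pw_succ, ih fun j hj => h j (by omega), h i (by omega)]

lemma IsPath.eq_stp_pw {V : Type*} {P : Prob} {stp : V → Word → V} {L : ℕ} {z : ℕ → V}
    {y : ℕ → ℕ × ℕ} (hnil : ∀ v, stp v [] = v)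
    (happ : ∀ v u w, stp v (u ++ w) = stp (stp v u) w) (h : IsPath P stp L z y) {i : ℕ}
    (hi : i ≤ L) : z i = stp (z 0) (pw P y i) := by
  induction i with
  | zero => simp [hnil]
  | succ i ih => rw [pw_succ, happ, ← ih (by omega), h.step i (by omega)]

lemma IsPath.rPath {V : Type*} {P : Prob} {stp : V → Word → V} {L : ℕ} {z : ℕ → V}
    {y : ℕ → ℕ × ℕ} (hnil : ∀ v, stp v [] = v)
    (happ : ∀ v u w, stp v (u ++ w) = stp (stp v u) w) (h : IsPath P stp L z y) :
    RPath P (fun u w => stp (z 0) u = stp (z 0) w) L y := by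
  have hz := fun {i} => h.eq_stp_pw hnil happ (i := i)
  refine ⟨h.letter, fun i hi j hj e => h.inj i hi j hj ?_, fun hP i _ => h.next hP i,
    fun hP i hi j hj s hs e => h.conf hP i hi j hj s hs ?_⟩
  · rwa [hz hi.le, hz hj.le]
  · rwa [hz hi.le, hz hj.le, ← happ]

lemma RPath.isPath {V : Type*} {P : Prob} {stp : V → Word → V} {L : ℕ} {v : V}
    {y : ℕ → ℕ × ℕ} (happ : ∀ v u w, stp v (u ++ w) = stp (stp v u) w)
    (h : RPath P (fun u w => stp v u = stp v w) L y) :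
    IsPath P stp L (fun i => stp v (pw P y i)) y where
  letter := h.1
  step i _ := by rw [pw_succ, happ]
  inj := h.2.1
  next hP i hi := h.2.2.1 hP i (by omega) hi
  conf hP i hi j hj s hs e := h.2.2.2 hP i hi j hj s hs (e.trans (happ _ _ _).symm)

lemma RPath.congr {P : Prob} {R R' : Word → Word → Prop} {L : ℕ} {y y' : ℕ → ℕ × ℕ}
    (h : RPath P R L y) (hy : ∀ i < L, y i = y' i)
    (hR : ∀ u w : Word, u.length ≤ L * wordBound P → w.length ≤ L * wordBound P →
      (R u w ↔ R' u w)) : RPath P R' L y' := by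
  have hl : ∀ i < L, (pw P y i).length ≤ L * wordBound P := fun i hi =>
    (length_pw_le P y i).trans (Nat.mul_le_mul_right _ hi.le)
  have hp : ∀ i < L, pw P y' i = pw P y i := fun i hi =>
    (pw_congr fun j hj => hy j (hj.trans hi)).symm
  refine ⟨fun i hi => hy i hi ▸ h.1 i hi, fun i hi j hj e => h.2.1 i hi j hj ?_,
    fun hP i hi hi' => ?_, fun hP i hi j hj s hs e => ?_⟩
  · rw [hp i hi, hp j hj] at e
    exact (hR _ _ (hl i hi) (hl j hj)).2 e
  · rw [← hy i hi, ← hy _ hi']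
    exact h.2.2.1 hP i hi hi'
  · rw [hp i hi, hp j hj] at e
    rw [← hy i hi, ← hy j hj]
    refine h.2.2.2 hP i hi j hj s hs ((hR _ _ (hl j hj) ?_).2 e)
    rw [List.length_append]
    calc _ ≤ i * wordBound P + wordBound P :=
          Nat.add_le_add (length_pw_le P y i) (length_wd_le P s)
      _ = (i + 1) * wordBound P := by ring
      _ ≤ _ := Nat.mul_le_mul_right _ hi

lemma ROuro.congr {P : Prob} {R R' : Word → Word → Prop} {n : ℕ} {y y' : ℕ → ℕ × ℕ}
    (h : ROuro P R n y) (hy : ∀ i < n, y i = y' i)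
    (hR : ∀ u w : Word, u.length ≤ n * wordBound P → w.length ≤ n * wordBound P →
      (R u w ↔ R' u w)) : ROuro P R' n y' := by
  refine ⟨h.1.congr hy hR, h.2.1, ?_, fun hP => ?_⟩
  · rw [← pw_congr hy]
    exact (hR _ _ (length_pw_le P y n) (by simp)).1 h.2.2.1
  · have h1 := h.2.1
    rw [← hy 0 h1, ← hy (n - 1) (by omega)]
    exact h.2.2.2 hP

lemma IsOuro.rOuro {V : Type*} {P : Prob} {stp : V → Word → V} {n : ℕ} {z : ℕ → V}
    {y : ℕ → ℕ × ℕ} (hnil : ∀ v, stp v [] = v)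
    (happ : ∀ v u w, stp v (u ++ w) = stp (stp v u) w) (h : IsOuro P stp n z y) :
    ROuro P (fun u w => stp (z 0) u = stp (z 0) w) n y :=
  ⟨h.toIsPath.rPath hnil happ, h.pos, by
    change stp (z 0) _ = stp (z 0) _
    rw [← h.toIsPath.eq_stp_pw hnil happ le_rfl, h.closed, hnil], h.next_closed⟩

lemma ROuro.isOuro {V : Type*} {P : Prob} {stp : V → Word → V} {n : ℕ} {v : V}
    {y : ℕ → ℕ × ℕ} (happ : ∀ v u w, stp v (u ++ w) = stp (stp v u) w)
    (h : ROuro P (fun u w => stp v u = stp v w) n y) :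
    IsOuro P stp n (fun i => stp v (pw P y i)) y where
  toIsPath := h.1.isPath happ
  pos := h.2.1
  closed := h.2.2.1
  next_closed := h.2.2.2

end Snake

namespace Snake

open Equiv

/-! ### Bounded drift prevents long paths -/

section

variable {P Q R : Type*} [Group P] [Group Q] [Group R]

lemma Allowed.prod_one {n : ℕ} {A T : P} {A' T' : Q} (h : Allowed n A T A' T') (c : R) :
    Allowed n A T (A', (1 : R)) (T', c) := by
  obtain ⟨φ, hφ⟩ := h
  refine ⟨(MonoidHom.inl Q R).comp φ, fun j hj => ?_⟩
  have h1 := map_conjT (MonoidHom.fst Q R) (A', 1) (T', c) j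
  refine Prod.ext ?_ ?_
  · simpa [hφ j hj] using h1.symm
  · simp [conjT]

end

lemma prefix_pw {P : Prob} {y : ℕ → ℕ × ℕ} {q : ℕ} {p : Word} (h : p <+: pw P y q) :
    ∃ i ≤ q, ∃ r : Word, p = pw P y i ++ r ∧ r.length ≤ wordBound P := by
  induction q with
  | zero =>
    rw [pw_zero, List.prefix_nil] at h
    exact ⟨0, le_rfl, [], by simp [h], by simp⟩
  | succ q ih =>
    rw [pw_succ] at h
    obtain h' | ⟨r, rfl⟩ := List.prefix_or_prefix_of_prefix h (List.prefix_append _ _)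
    · obtain ⟨i, hi, hr⟩ := ih h'
      exact ⟨i, by omega, hr⟩
    · exact ⟨q, by omega, r, rfl,
        ((List.prefix_append_right_inj _).1 h).length_le.trans (length_wd_le P _)⟩

lemma rep_one_ofAdd_zmod (M : ℕ) (w : Word) :
    rep (1 : Multiplicative (ZMod M)) (Multiplicative.ofAdd 1) w =
      Multiplicative.ofAdd (drift w : ZMod M) := by
  have := map_rep (AddMonoidHom.toMultiplicative (Int.castAddHom (ZMod M))) 1
    (Multiplicative.ofAdd 1) w
  rw [rep_ofAdd] at this
  simpa using this.symm

/-- If the drift of all paths in spaces allowed over one group is bounded, then the length of paths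
in a group allowed over it is bounded in terms of a sufficiently long restriction of that group. -/
theorem not_rPath_of_bounded {Q₀ Q₁ Q : Type} [Group Q₀] [Group Q₁] [Group Q] [Finite Q₁] [Finite Q]
    {A₀ T₀ : Q₀} {A₁ T₁ : Q₁} {A T : Q} {n m₁ H : ℕ} {P : Prob}
    (hH : ∀ (X : Type) (_ : Finite X) (a t : Perm X), Allowed n A₀ T₀ a t →
      ∀ L z y, IsPath P (permStep a t) L z y → |pathDrift P y L| < H)
    (h₀ : Allowed n A₀ T₀ A T) (h₁ : Allowed (2 * m₁ + 1) A₁ T₁ A T) (hm : H + wordBound P ≤ m₁)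
    (y : ℕ → ℕ × ℕ) :
    ¬ RPath P (fun u w => drift u = drift w ∧ rep A T u = rep A T w)
      (Nat.card (conjClosure A₁ T₁ (2 * m₁ + 1)) * (2 * H + 1) + 1) y := by
  set L := Nat.card (conjClosure A₁ T₁ (2 * m₁ + 1)) * (2 * H + 1) + 1 with hL
  intro hR
  have hbound : ∀ i < L, |drift (pw P y i)| < H := by
    intro i hi
    let M := 2 * (L * wordBound P) + 1
    let X := Q × Multiplicative (ZMod M)
    have : Finite (Multiplicative (ZMod M)) := inferInstanceAs (Finite (ZMod M))
    let c : Multiplicative (ZMod M) := Multiplicative.ofAdd 1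
    let f : X →* Perm X := MulAction.toPermHom X X
    have hall : Allowed n A₀ T₀ (f (A, 1)) (f (T, c)) := (h₀.prod_one c).map f
    have hstp : ∀ w, permStep (f (A, 1)) (f (T, c)) 1 w =
        ((rep A T w)⁻¹, (Multiplicative.ofAdd (drift w : ZMod M))⁻¹) := by
      intro w
      rw [permStep, ← map_rep, ← map_inv, rep_prod, rep_one_ofAdd_zmod]
      simp only [f, MulAction.toPermHom_apply, MulAction.toPerm_apply, smul_eq_mul, mul_one]
      rfl
    have hp := hR.congr (R' := fun u w => permStep (f (A, 1)) (f (T, c)) 1 u =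
      permStep (f (A, 1)) (f (T, c)) 1 w) (fun _ _ => rfl) (fun u w hu hw => by
        rw [hstp, hstp, Prod.ext_iff, and_comm]
        simp only [inv_inj, EmbeddingLike.apply_eq_iff_eq]
        refine and_congr_right fun _ => ⟨fun h => by rw [h], fun h => ?_⟩
        rw [← sub_eq_zero]
        rw [← sub_eq_zero, ← Int.cast_sub, ZMod.intCast_zmod_eq_zero_iff_dvd] at h
        refine Int.eq_zero_of_abs_lt_dvd h ?_
        have hu' : (u.length : ℤ) ≤ (L * wordBound P : ℕ) := by exact_mod_cast hu
        have hw' : (w.length : ℤ) ≤ (L * wordBound P : ℕ) := by exact_mod_cast hw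
        have := abs_sub (drift u) (drift w)
        have := abs_drift_le u
        have := abs_drift_le w
        simp only [M]
        push_cast at *
        linarith)
    rw [drift_pw]
    exact hH X inferInstance _ _ hall i _ _ ((hp.isPath (permStep_append _ _)).take hi.le)
  obtain ⟨φ, hφ⟩ := h₁
  have hmem : ∀ i < L, T ^ (m₁ : ℤ) * rep A T (pw P y i) * (T ^ (m₁ + drift (pw P y i)))⁻¹ ∈
      φ.range := by
    intro i hi
    refine rep_mem_of_band (n := 2 * m₁ + 1) (Δ := φ.range) (fun j hj => ⟨_, hφ j hj⟩) _ _
      fun p hp => ?_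
    obtain ⟨k, hk, r, rfl, hr⟩ := prefix_pw hp
    have h1 := abs_lt.1 (hbound k (by omega))
    have h2 := abs_le.1 (abs_drift_le r)
    rw [drift_append]
    push_cast
    constructor <;> omega
  let F : Fin L → φ.range × Fin (2 * H + 1) := fun i =>
    (⟨_, hmem i i.2⟩, ⟨(drift (pw P y i) + H).toNat, by have := abs_lt.1 (hbound i i.2); omega⟩)
  have hF : Function.Injective F := by
    intro i j h
    rw [Prod.ext_iff] at h
    have h2 : drift (pw P y i) = drift (pw P y j) := by
      have h := congrArg Fin.val h.2
      have := abs_lt.1 (hbound i i.2)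
      have := abs_lt.1 (hbound j j.2)
      simp only [F] at h
      omega
    have h1 := congrArg Subtype.val h.1
    simp only [F, h2] at h1
    exact Fin.ext (hR.2.1 i i.2 j j.2 ⟨h2, by simpa using h1⟩)
  have h1 := Nat.card_le_card_of_injective F hF
  rw [Nat.card_prod, Nat.card_fin, Nat.card_fin] at h1
  have h2 : Nat.card φ.range ≤ Nat.card (conjClosure A₁ T₁ (2 * m₁ + 1)) :=
    Nat.card_le_card_of_surjective _ φ.rangeRestrict_surjective
  have := Nat.mul_le_mul_right (2 * H + 1) h2
  omega

end Snake

namespace Snake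

open Equiv

/-! ### States of the construction -/

/-- The word of the inverse of a conjugate of the first generator. -/
def aw (j : ℕ) : Word :=
  (List.range j).map (fun _ => (true, true)) ++
    (false, false) :: (List.range j).map fun _ => (true, false)

lemma rep_aw {Q : Type*} [Group Q] (A T : Q) (j : ℕ) : rep A T (aw j) = (conjT A T j)⁻¹ := by
  have h : ∀ l, rep A T ((List.range j).map fun _ => l) = letterVal A T l ^ j := by
    intro l
    simp [rep, List.map_const']
  rw [aw, rep_append, rep_cons, h, h]
  simp [letterVal, conjT, mul_assoc]

/-- A set of points of a coded space, given by the list of values of its indicator function, is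
preserved by the conjugates of the first generator with index less than `2 * m + 1`, but not by the
one with index `2 * m + 1`. -/
def Separates (m : ℕ) (b : Block) (χ : List Bool) : Prop :=
  (∀ j < 2 * m + 1, ∀ x < size b, χ.getD (ev b (aw j) x) false = χ.getD x false) ∧
    ∃ x < size b, χ.getD (ev b (aw (2 * m + 1)) x) false ≠ χ.getD x false

/-- A state: the list of codes of spaces chosen so far, the radius up to which the word problem has
been decided, and a separating set in one of these spaces. -/
abbrev State : Type := List Block × ℕ × Block × List Bool

/-- The invariant of states. -/
def StateOK (st : State) : Prop :=
  (∀ b ∈ st.1, Valid b) ∧ st.2.2.1 ∈ st.1 ∧ Separates st.2.1 st.2.2.1 st.2.2.2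

/-- A move: the codes to be added, the remaining data of the new state, the answer to the infinite
snake problem, and data certifying the answer. -/
abbrev Move : Type :=
  List Block × (ℕ × Block × List Bool) × Bool × (Block × ℕ) × List (ℕ × ℕ) × ℕ

/-- The state after a move. -/
def next (st : State) (c : Move) : State := (st.1 ++ c.1, c.2.1)

/-- The admissible colours of a problem. -/
def alph (P : Prob) : List (ℕ × ℕ) :=
  (List.range P.2.2.1).flatMap fun c => (List.range P.2.1.length).map fun s => (c, s)

lemma mem_alph {P : Prob} {y : ℕ × ℕ} : y ∈ alph P ↔ IsLetter P y := by
  rcases y with ⟨c, s⟩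
  simp [alph, IsLetter]

/-- The words of length at most `m`. -/
def wordsUpto (m : ℕ) : List Word := (List.range (m + 1)).flatMap (listsOf letters)

lemma mem_wordsUpto {m : ℕ} {w : Word} : w ∈ wordsUpto m ↔ w.length ≤ m := by
  simp [wordsUpto, mem_listsOf, mem_letters]

/-- A move certifies the existence of an infinite snake. -/
def CertYes (st : State) (P : Prob) (c : Move) : Prop :=
  c.2.2.2.1.1 ∈ (next st c).1 ∧ c.2.2.2.1.2 < size c.2.2.2.1.1 ∧
    ROuro P (Eqv (false, [c.2.2.2.1])) c.2.2.2.2.1.length (fn c.2.2.2.2.1) ∧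
    ¬ SameDrift (pw P (fn c.2.2.2.2.1) c.2.2.2.2.1.length) []

/-- A move certifies the absence of long snakes. -/
def CertNo (st : State) (P : Prob) (c : Move) : Prop :=
  (2 * c.2.2.2.2.2 + 1) * wordBound P ≤ (next st c).2.1 ∧
    ∀ ys ∈ listsOf (alph P) c.2.2.2.2.2,
      ¬ RPath P (Eqv (true, allPts (next st c).1)) c.2.2.2.2.2 (fn ys)

/-- The legality of moves. -/
def MoveOK (st : State) (P : Prob) (c : Move) : Prop :=
  StateOK (next st c) ∧ st.2.1 < (next st c).2.1 ∧
    (∀ v ∈ wordsUpto st.2.1, ∀ w ∈ wordsUpto st.2.1, Eqv (true, allPts st.1) v w →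
      Eqv (true, allPts (next st c).1) v w) ∧
    (c.2.2.1 = true → CertYes st P c) ∧ (c.2.2.1 = false → CertNo st P c)

section

variable {α : Type*} [Primcodable α]

@[fun_prop] lemma primrec_aw {f : α → ℕ} (hf : Primrec f) : Primrec fun a => aw (f a) := by
  unfold aw; fun_prop

@[fun_prop] lemma primrec_next {f : α → State} {g : α → Move} (hf : Primrec f) (hg : Primrec g) :
    Primrec fun a => next (f a) (g a) := by
  unfold next; fun_prop

@[fun_prop] lemma primrec_alph {f : α → Prob} (hf : Primrec f) : Primrec fun a => alph (f a) := by
  unfold alph; fun_prop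

@[fun_prop] lemma primrec_wordsUpto {f : α → ℕ} (hf : Primrec f) :
    Primrec fun a => wordsUpto (f a) := by
  unfold wordsUpto; fun_prop

@[fun_prop] lemma primrec_wordBound {f : α → Prob} (hf : Primrec f) :
    Primrec fun a => wordBound (f a) := by
  unfold wordBound; fun_prop

lemma primrecPred_stateOK {f : α → State} (hf : Primrec f) : PrimrecPred fun a => StateOK (f a) :=
  .and (primrecPred_ball (by fun_prop) (primrecPred_valid (by fun_prop)))
    (.and (primrecPred_mem (by fun_prop) (by fun_prop))
      (.and (primrecPred_ball_lt (by fun_prop) (primrecPred_ball_lt (by fun_prop)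
          (primrecPred_eq (by fun_prop) (by fun_prop))))
        (primrecPred_bex_lt (by fun_prop) (primrecPred_eq (by fun_prop) (by fun_prop)).not)))

lemma primrecPred_moveOK {f : α → State} {P : α → Prob} {c : α → Move} (hf : Primrec f)
    (hP : Primrec P) (hc : Primrec c) : PrimrecPred fun a => MoveOK (f a) (P a) (c a) := by
  refine .and (primrecPred_stateOK (by fun_prop)) (.and (primrecPred_lt (by fun_prop) (by fun_prop))
    (.and ?_ (.and (primrecPred_imp (primrecPred_eq (by fun_prop) (by fun_prop)) ?_)
      (primrecPred_imp (primrecPred_eq (by fun_prop) (by fun_prop)) ?_))))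
  · exact primrecPred_ball (by fun_prop) (primrecPred_ball (by fun_prop) (primrecPred_imp
      (primrecPred_eqv (by fun_prop) (by fun_prop) (by fun_prop))
      (primrecPred_eqv (by fun_prop) (by fun_prop) (by fun_prop))))
  · exact .and (primrecPred_mem (by fun_prop) (by fun_prop))
      (.and (primrecPred_lt (by fun_prop) (by fun_prop))
        (.and (primrecPred_rOuro (by fun_prop) (by fun_prop) (by fun_prop) (by fun_prop))
          (primrecPred_sameDrift (by fun_prop) (by fun_prop)).not))
  · exact .and (primrecPred_le (by fun_prop) (by fun_prop)) (primrecPred_ball (by fun_prop)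
      (primrecPred_rPath (by fun_prop) (by fun_prop) (by fun_prop) (by fun_prop)).not)

end

/-! ### Existence of moves -/

lemma ev_aw {b : Block} (hb : Valid b) (j : ℕ) (x : Fin (size b)) :
    ev b (aw j) x = conjT (perm b false) (perm b true) j x := by
  rw [← coe_pstep hb, pstep, permStep, rep_aw, inv_inv]

lemma Separates.notMem {m : ℕ} {b : Block} {χ : List Bool} {Bs : List Block}
    (h : Separates m b χ) (hb : Valid b) (hB : b ∈ Bs) :
    conjT (gen (toSet Bs) false) (gen (toSet Bs) true) (2 * m + 1) ∉
      conjClosure (gen (toSet Bs) false) (gen (toSet Bs) true) (2 * m + 1) := by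
  let b' : toSet Bs := ⟨b, hB⟩
  have hc : ∀ j, conjT (gen (toSet Bs) false) (gen (toSet Bs) true) j b' =
      conjT (perm b false) (perm b true) j := fun j =>
    map_conjT (Pi.evalMonoidHom (fun b : toSet Bs => Perm (Fin (size b.1))) b') _ _ j
  intro hmem
  have key : ∀ g ∈ conjClosure (gen (toSet Bs) false) (gen (toSet Bs) true) (2 * m + 1),
      ∀ x : Fin (size b), χ.getD (g b' x : Fin (size b)) false = χ.getD x false := by
    intro g hg
    induction hg using Subgroup.closure_induction with
    | mem g hg =>
      obtain ⟨j, hj, rfl⟩ := hg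
      intro x
      rw [hc, ← ev_aw hb]
      exact h.1 j hj x x.2
    | one => intro x; rfl
    | mul g g' _ _ ih ih' => intro x; exact (ih _).trans (ih' x)
    | inv g _ ih =>
      intro x
      rw [← ih]
      exact congrArg (fun z : Fin (size b) => χ.getD z false)
        ((g b').apply_symm_apply x)
  obtain ⟨x, hx, hne⟩ := h.2
  refine hne ?_
  have := key _ hmem ⟨x, hx⟩
  rw [hc, ← ev_aw hb] at this
  exact this

lemma Allowed.permCongr {Q : Type*} [Group Q] {A T : Q} {n : ℕ} {X : Type*} {a t : Perm X}
    (h : Allowed n A T a t) {b : Block} {e : X ≃ Fin (size b)} (ha : perm b false = e.permCongr a)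
    (ht : perm b true = e.permCongr t) : Allowed n A T (perm b false) (perm b true) := by
  rw [ha, ht]
  exact h.map e.permCongrHom.toMonoidHom

lemma exists_separates {m m' : ℕ} {b₀ : Block} {χ₀ : List Bool} {Bs : List Block}
    (h : Separates m b₀ χ₀) (hb : Valid b₀) (hB : b₀ ∈ Bs) (hm : m < m') :
    ∃ b χ, Valid b ∧ Separates m' b χ ∧
      Allowed (2 * m + 1) (gen (toSet Bs) false) (gen (toSet Bs) true) (perm b false)
        (perm b true) := by
  obtain ⟨X, _, a, t, χ, hall, hinv, x, hx⟩ :=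
    exists_extension _ _ (h := 2 * m) (n' := 2 * m' + 1) (by omega) (h.notMem hb hB)
  obtain ⟨b, hb, e, ha, ht⟩ := exists_block a t
  have hχ : ∀ i : Fin (size b), (List.ofFn fun i => χ (e.symm i)).getD i false = χ (e.symm i) := by
    intro i
    simp
  have hconj : ∀ j (i : Fin (size b)), e.symm (conjT (perm b false) (perm b true) j i) =
      conjT a t j (e.symm i) := by
    intro j i
    have := map_conjT e.permCongrHom.toMonoidHom a t j
    simp only [MulEquiv.coe_toMonoidHom, Equiv.permCongrHom_coe, ← ha, ← ht] at this
    simp [← this, Equiv.permCongr_apply]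
  refine ⟨b, List.ofFn fun i => χ (e.symm i), hb, ⟨fun j hj i hi => ?_, e x, Fin.is_lt _, ?_⟩,
    hall.permCongr ha ht⟩
  · lift i to Fin (size b) using hi
    rw [ev_aw hb, hχ, hχ, hconj, hinv j hj]
  · rw [ev_aw hb, hχ, hχ, hconj]
    simpa using hx

lemma allowed_append {n : ℕ} {Bs bs : List Block}
    (h : ∀ b ∈ bs, Allowed n (gen (toSet Bs) false) (gen (toSet Bs) true) (perm b false)
      (perm b true)) :
    Allowed n (gen (toSet Bs) false) (gen (toSet Bs) true) (gen (toSet (Bs ++ bs)) false)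
      (gen (toSet (Bs ++ bs)) true) := by
  refine Allowed.pi fun b => ?_
  by_cases hb : b.1 ∈ Bs
  · exact Allowed.of_hom n (Pi.evalMonoidHom (fun b : toSet Bs => Perm (Fin (size b.1))) ⟨b.1, hb⟩)
      _ _
  · exact h _ ((List.mem_append.1 b.2).resolve_left hb)

lemma eqv_of_allowed {m : ℕ} {Bs Bs' : List Block} (hBs : ∀ b ∈ Bs, Valid b)
    (hBs' : ∀ b ∈ Bs', Valid b)
    (h : Allowed (2 * m + 1) (gen (toSet Bs) false) (gen (toSet Bs) true)
      (gen (toSet Bs') false) (gen (toSet Bs') true)) {v w : Word} (hv : v.length ≤ m)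
    (hw : w.length ≤ m) (e : Eqv (true, allPts Bs) v w) : Eqv (true, allPts Bs') v w := by
  rw [eqv_allPts hBs, rep_fullGen, rep_fullGen, Prod.ext_iff] at e
  have hd : drift v = drift w := Multiplicative.ofAdd.injective e.2
  rw [eqv_allPts hBs', rep_fullGen, rep_fullGen, h.rep_eq hv hw hd e.1, hd]

lemma isOuro_permCongr {P : Prob} {X : Type*} {a t : Perm X} {n : ℕ} {z : ℕ → X}
    {y : ℕ → ℕ × ℕ} (h : IsOuro P (permStep a t) n z y) {b : Block} (hb : Valid b)
    {e : X ≃ Fin (size b)} (ha : perm b false = e.permCongr a) (ht : perm b true = e.permCongr t) :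
    ROuro P (Eqv (false, [(b, (e (z 0) : ℕ))])) n y := by
  refine (h.rOuro (permStep_nil a t) (permStep_append a t)).congr (fun _ _ => rfl)
    fun u w _ _ => ?_
  have hu : ∀ u, (ev b u (e (z 0)) : ℕ) = e (permStep a t (z 0) u) := by
    intro u
    have := map_rep e.permCongrHom.toMonoidHom a t u
    simp only [MulEquiv.coe_toMonoidHom, Equiv.permCongrHom_coe, ← ha, ← ht] at this
    rw [← coe_pstep hb, pstep, permStep, ← this]
    simp [permStep, Perm.inv_def, Equiv.permCongr_def]
  simp only [Eqv, Bool.false_eq_true, false_imp_iff, true_and, List.mem_singleton, forall_eq, hu,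
    Fin.val_inj, EmbeddingLike.apply_eq_iff_eq]

lemma fn_ofFn {n : ℕ} (y : ℕ → ℕ × ℕ) {i : ℕ} (hi : i < n) :
    y i = fn (List.ofFn fun i : Fin n => y i) i := by
  simp [fn, hi]

/-- Every state admits a legal move for every problem. -/
theorem exists_moveOK {st : State} (hst : StateOK st) (P : Prob) : ∃ c, MoveOK st P c := by
  obtain ⟨Bs, m, b₀, χ₀⟩ := st
  obtain ⟨hBs, hmem, hsep⟩ := hst
  simp only at hBs hmem hsep
  have hval := fun (bs : List Block) (h : ∀ b ∈ bs, Valid b) b (hb : b ∈ Bs ++ bs) =>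
    (List.mem_append.1 hb).elim (hBs b) (h b)
  obtain ⟨X, _, a, t, hall, n, z, y, hO, hd⟩ | ⟨H, hH⟩ :=
    ouro_or_bounded (gen (toSet Bs) false) (gen (toSet Bs) true) (2 * m) P
  · obtain ⟨b, hb, e, ha, ht⟩ := exists_block a t
    obtain ⟨b', χ', hb', hs', hall'⟩ := exists_separates hsep (hBs _ hmem) hmem m.lt_succ_self
    have hv := hval [b, b'] (by simp [hb, hb'])
    refine ⟨([b, b'], (m + 1, b', χ'), true, (b, (e (z 0) : ℕ)), List.ofFn fun i : Fin n => y i, 0),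
      ⟨hv, by simp [next], hs'⟩, m.lt_succ_self, fun v hv' w hw' hvw => ?_, fun _ => ?_, by simp⟩
    · refine eqv_of_allowed hBs hv (allowed_append ?_) (mem_wordsUpto.1 hv') (mem_wordsUpto.1 hw')
        hvw
      simp [hall.permCongr ha ht, hall']
    · refine ⟨by simp [next], Fin.is_lt _, ?_, ?_⟩
      · simp only [List.length_ofFn]
        exact (isOuro_permCongr hO hb ha ht).congr (fun i hi => fn_ofFn y hi) fun _ _ _ _ => Iff.rfl
      · simp only [List.length_ofFn]
        rw [← pw_congr fun i hi => fn_ofFn y hi, sameDrift_iff, drift_pw]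
        exact hd
  · obtain ⟨m₁, hm₁⟩ : ∃ m₁, m₁ = m + 1 + H + wordBound P := ⟨_, rfl⟩
    obtain ⟨b, χ, hb, hs, hall⟩ := exists_separates hsep (hBs _ hmem) hmem
      (show m < m₁ by omega)
    have hBs₁ := hval [b] (by simp [hb])
    obtain ⟨L, hL⟩ : ∃ L, L = Nat.card (conjClosure (gen (toSet (Bs ++ [b])) false)
      (gen (toSet (Bs ++ [b])) true) (2 * m₁ + 1)) * (2 * H + 1) + 1 := ⟨_, rfl⟩
    obtain ⟨b', χ', hb', hs', hall'⟩ := exists_separates (Bs := Bs ++ [b]) hs hb (by simp)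
      (show m₁ < m₁ + 1 + (2 * L + 1) * wordBound P by omega)
    have hBs₂ := hval [b, b'] (by simp [hb, hb'])
    have h1 : Allowed (2 * m + 1) (gen (toSet Bs) false) (gen (toSet Bs) true)
        (gen (toSet (Bs ++ [b])) false) (gen (toSet (Bs ++ [b])) true) :=
      allowed_append (by simpa using hall)
    have h2 : Allowed (2 * m₁ + 1) (gen (toSet (Bs ++ [b])) false) (gen (toSet (Bs ++ [b])) true)
        (gen (toSet (Bs ++ [b, b'])) false) (gen (toSet (Bs ++ [b, b'])) true) := by
      have := allowed_append (Bs := Bs ++ [b]) (bs := [b']) (by simpa using hall')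
      rwa [List.append_assoc] at this
    have h12 := h1.trans (show 2 * m + 1 ≤ 2 * m₁ + 1 by omega) h2
    refine ⟨([b, b'], (_, b', χ'), false, (b, 0), [], L),
      ⟨hBs₂, by simp [next], hs'⟩, by simp only [next]; omega, fun v hv' w hw' hvw => ?_, by simp,
      fun _ => ⟨by simp [next], fun ys _ hR => ?_⟩⟩
    · exact eqv_of_allowed hBs hBs₂ h12 (mem_wordsUpto.1 hv') (mem_wordsUpto.1 hw') hvw
    · refine not_rPath_of_bounded hH h12 h2 (by omega) (fn ys) ?_
      rw [← hL]
      refine hR.congr (fun _ _ => rfl) fun u w _ _ => ?_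
      simp only [next]
      rw [eqv_allPts hBs₂, rep_fullGen, rep_fullGen, Prod.ext_iff, and_comm]
      simp only [EmbeddingLike.apply_eq_iff_eq]

end Snake

namespace Snake

open Equiv

/-! ### Snakes in groups -/

/-- Directed snakes in a group, for problems whose generators are given by words. -/
def PSnake {G : Type*} [Group G] (a t : G) (P : Prob) (n : ℕ) : Prop :=
  ∃ (ω : ZMod n → G) (y : ZMod n → ℕ × ℕ), Function.Injective ω ∧ (∀ i, IsLetter P (y i)) ∧
    (∀ i, ω (i + 1) = ω i * rep a t (wd P (y i).2)) ∧
    (P.1 = false → ∀ i, (y i, ((y i).2, y (i + 1))) ∈ P.2.2.2) ∧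
    (P.1 = true → ∀ i j, ∀ s < P.2.1.length, ω j = ω i * rep a t (wd P s) →
      (y i, (s, y j)) ∈ P.2.2.2)

section

variable {G : Type*} [Group G] {a t : G} {P : Prob}

lemma groupStep_nil (a t g : G) : groupStep a t g [] = g := by simp [groupStep]

/-- A closed path with nontrivial total displacement in a quotient space unwinds to an infinite
snake. -/
theorem pSnake_zero_of_isOuro {X : Type*} (f : G →* Perm X) (δ : G →* Multiplicative ℤ) {n : ℕ}
    {z : ℕ → X} {y : ℕ → ℕ × ℕ} (h : IsOuro P (permStep (f a) (f t)) n z y)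
    (hδ : δ (rep a t (pw P y n)) ≠ 1) : PSnake a t P 0 := by
  have hn := h.pos
  have hnz : (n : ℤ) ≠ 0 := by omega
  set u := rep a t (pw P y n) with hu
  let ω : ℤ → G := fun i => u ^ (i / n) * rep a t (pw P y (i % n).toNat)
  let Y : ℤ → ℕ × ℕ := fun i => y (i % n).toNat
  have hdec : ∀ i : ℤ, ∃ (q : ℤ) (r : ℕ), r < n ∧ i = q * n + r := fun i =>
    ⟨i / n, (i % n).toNat, by have := Int.emod_lt_of_pos i (b := n) (by omega); omega, by
      rw [Int.toNat_of_nonneg (Int.emod_nonneg i hnz), mul_comm, Int.mul_ediv_add_emod]⟩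
  have hdiv : ∀ (q : ℤ) (r : ℕ), r < n → (q * n + r) / n = q ∧ ((q * n + r) % n).toNat = r := by
    intro q r hr
    have h0 : (r : ℤ) / n = 0 := Int.ediv_eq_zero_of_lt (by omega) (by omega)
    have h1 : (r : ℤ) % n = r := Int.emod_eq_of_lt (by omega) (by omega)
    refine ⟨?_, ?_⟩
    · rw [add_comm, Int.add_mul_ediv_right _ _ hnz, h0, zero_add]
    · rw [add_comm, Int.add_mul_emod_self_right, h1]; simp
  have hω : ∀ (q : ℤ) (r : ℕ), r ≤ n → ω (q * n + r) = u ^ q * rep a t (pw P y r) := by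
    intro q r hr
    obtain hr | rfl := hr.lt_or_eq
    · simp only [ω, hdiv q r hr]
    · have := hdiv (q + 1) 0 hn
      rw [show q * (r : ℤ) + r = (q + 1) * r + (0 : ℕ) by push_cast; ring]
      simp only [ω, this, pw_zero, rep_nil, mul_one, zpow_add_one, hu]
  have hY : ∀ (q : ℤ) (r : ℕ), r < n → Y (q * n + r) = y r := fun q r hr => by
    simp only [Y, hdiv q r hr]
  have hYn : ∀ q : ℤ, Y (q * n + n) = y 0 := fun q => by
    rw [show q * (n : ℤ) + n = (q + 1) * n + (0 : ℕ) by push_cast; ring, hY _ _ hn]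
  have hpt : ∀ g w, (f (g * rep a t w))⁻¹ (z 0) = permStep (f a) (f t) ((f g)⁻¹ (z 0)) w := by
    intro g w
    rw [permStep, ← map_rep, map_mul, mul_inv_rev, Perm.mul_apply]
  have hzpw : ∀ r ≤ n, (f (rep a t (pw P y r)))⁻¹ (z 0) = z r := by
    intro r hr
    have := hpt 1 (pw P y r)
    rw [one_mul, map_one, inv_one, Perm.one_apply] at this
    rw [this, h.toIsPath.eq_stp_pw (permStep_nil _ _) (permStep_append _ _) hr]
  have hfix : ∀ q : ℤ, (f (u ^ q))⁻¹ (z 0) = z 0 := by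
    intro q
    have h1 : (f u)⁻¹ (z 0) = z 0 := by rw [hzpw n le_rfl, h.closed]
    rw [map_zpow, ← inv_zpow]
    exact Perm.zpow_apply_eq_self_of_apply_eq_self h1 q
  have hωz : ∀ (q : ℤ) (r : ℕ), r < n → (f (ω (q * n + r)))⁻¹ (z 0) = z r := by
    intro q r hr
    rw [hω q r hr.le, hpt, hfix, h.toIsPath.eq_stp_pw (permStep_nil _ _)
      (permStep_append _ _) hr.le]
  refine ⟨ω, Y, fun i j hij => ?_, fun i => ?_, fun i => ?_, fun hP i => ?_,
    fun hP i j s hs e => ?_⟩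
  · obtain ⟨q, r, hr, rfl⟩ := hdec i
    obtain ⟨q', r', hr', rfl⟩ := hdec j
    obtain rfl : r = r' := h.inj r hr r' hr' (by rw [← hωz q r hr, hij, hωz q' r' hr'])
    rw [hω q r hr.le, hω q' r hr.le, mul_left_inj] at hij
    have := congrArg (fun g => Multiplicative.toAdd (δ g)) hij
    simp only [map_zpow, toAdd_zpow, smul_eq_mul, mul_eq_mul_right_iff, toAdd_eq_zero, hδ,
      or_false] at this
    rw [this]
  · exact h.letter _ (by have := Int.emod_lt_of_pos i (b := n) (by omega); omega)
  · obtain ⟨q, r, hr, rfl⟩ := hdec i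
    rw [hY q r hr, hω q r hr.le, mul_assoc, ← rep_append, ← pw_succ, ← hω q (r + 1) hr]
    push_cast
    exact congrArg ω (add_assoc (q * n : ℤ) r 1)
  · obtain ⟨q, r, hr, rfl⟩ := hdec i
    rw [hY q r hr]
    obtain hr' | hr' : r + 1 < n ∨ n = r + 1 := by omega
    · have := hY q (r + 1) hr'
      push_cast at this
      have e : Y (q * n + r + 1) = y (r + 1) := by rw [add_assoc, this]
      exact e ▸ h.next hP r hr'
    · have h1 := hYn q
      have h2 := h.next_closed hP
      rw [hr'] at h1
      push_cast at h1
      have e : Y (q * n + r + 1) = y 0 := by rw [hr', ← h1, add_assoc]; push_cast; rfl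
      rw [show n - 1 = r by omega] at h2
      exact e ▸ h2
  · obtain ⟨q, r, hr, rfl⟩ := hdec i
    obtain ⟨q', r', hr', rfl⟩ := hdec j
    rw [hY q r hr, hY q' r' hr']
    refine h.conf hP r hr r' hr' s hs ?_
    rw [← hωz q' r' hr', e, hpt, hωz q r hr]

lemma PSnake.isOuro {n : ℕ} (hn : 0 < n) (h : PSnake a t P n) :
    ∃ z y, IsOuro P (groupStep a t) n z y := by
  obtain ⟨ω, y, hinj, hlet, hstep, hnext, hconf⟩ := h
  have hcast : ((n - 1 : ℕ) : ZMod n) + 1 = (0 : ℕ) := by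
    rw [← Nat.cast_add_one, Nat.sub_add_cancel hn]
    simp
  refine ⟨fun i => ω i, fun i => y i, ⟨fun i _ => hlet i, fun i _ => ?_, fun i hi j hj e => ?_,
    fun hP i _ => ?_, fun hP i _ j _ s hs e => hconf hP _ _ s hs e⟩, hn, by simp, fun hP => ?_⟩
  · push_cast
    exact hstep i
  · have := congrArg ZMod.val (hinj e)
    rwa [ZMod.val_cast_of_lt hi, ZMod.val_cast_of_lt hj] at this
  · push_cast
    exact hnext hP i
  · have := hnext hP (n - 1 : ℕ)
    rwa [hcast] at this

lemma PSnake.isPath {n L : ℕ} (h : PSnake a t P n) (hL : n = 0 ∨ L ≤ n) :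
    ∃ z y, IsPath P (groupStep a t) L z y := by
  obtain rfl | hn := n.eq_zero_or_pos
  · obtain ⟨ω, y, hinj, hlet, hstep, hnext, hconf⟩ := h
    refine ⟨fun i => ω (i : ℤ), fun i => y (i : ℤ), ⟨fun i _ => hlet _, fun i _ => ?_,
      fun i _ j _ e => Int.ofNat_inj.1 (hinj e), fun hP i _ => ?_,
      fun hP i _ j _ s hs e => hconf hP _ _ s hs e⟩⟩
    · push_cast
      exact hstep _
    · push_cast
      exact hnext hP _
  · obtain ⟨z, y, h⟩ := h.isOuro hn
    exact ⟨z, y, h.toIsPath.take (hL.resolve_left hn.ne')⟩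

lemma pSnake_of_isOuro {n : ℕ} {z : ℕ → G} {y : ℕ → ℕ × ℕ} (h : IsOuro P (groupStep a t) n z y) :
    PSnake a t P n := by
  have hn : NeZero n := ⟨h.pos.ne'⟩
  have hval : ∀ i : ZMod n, (i.val + 1 < n ∧ (i + 1).val = i.val + 1) ∨
      (i.val = n - 1 ∧ i.val + 1 = n ∧ (i + 1).val = 0) := by
    intro i
    have h1 := i.val_lt
    have h2 : (i + 1).val = (i.val + 1) % n := by
      rw [← ZMod.val_natCast, Nat.cast_add_one, ZMod.natCast_zmod_val]
    obtain h3 | h3 : i.val + 1 < n ∨ i.val + 1 = n := by omega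
    · exact .inl ⟨h3, by rw [h2, Nat.mod_eq_of_lt h3]⟩
    · exact .inr ⟨by omega, h3, by rw [h2, h3, Nat.mod_self]⟩
  refine ⟨fun i => z i.val, fun i => y i.val, fun i j e => ?_, fun i => h.letter _ i.val_lt,
    fun i => ?_, fun hP i => ?_, fun hP i j s hs e => h.conf hP _ i.val_lt _ j.val_lt s hs e⟩
  · exact ZMod.val_injective n (h.inj _ i.val_lt _ j.val_lt e)
  · have := h.step _ i.val_lt
    obtain ⟨_, h2⟩ | ⟨_, h2, h3⟩ := hval i
    · simp only [h2]
      exact this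
    · rw [h2, h.closed] at this
      simp only [h3]
      exact this
  · obtain ⟨h1, h2⟩ | ⟨h1, h2, h3⟩ := hval i
    · simp only [h2]
      exact h.next hP _ h1
    · simp only [h3]
      rw [h1]
      exact h.next_closed hP

lemma groupStep_inj {g : G} {u w : Word} :
    groupStep a t g u = groupStep a t g w ↔ rep a t u = rep a t w := mul_right_inj g

end

end Snake

namespace Snake

/-! ### The construction of the group -/

/-- The problem with a given code. -/
def probOf (i : ℕ) : Prob := (Encodable.decode i : Option Prob).getD (false, [], 0, [])

lemma primrec_probOf : Primrec probOf :=
  Primrec.option_getD.comp Primrec.decode (Primrec.const _)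

lemma probOf_encode (P : Prob) : probOf (Encodable.encode P) = P := by
  simp [probOf]

/-- The initial state, given by the standard generators of the symmetric group on three points. -/
def initialState : State :=
  ([(([1, 0, 2], [1, 0, 2]), ([1, 2, 0], [2, 0, 1]))], 0,
    (([1, 0, 2], [1, 0, 2]), ([1, 2, 0], [2, 0, 1])), [false, false, true])

lemma stateOK_initialState : StateOK initialState := by
  refine ⟨?_, by simp [initialState], ?_, 1, ?_⟩
  · simp [initialState, Valid, letters, size, app, invLetter]
    decide
  · simp [initialState, size, ev, aw, app, invLetter]
    decide
  · simp [initialState, size, ev, aw, app, invLetter, List.range_succ]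

lemma computable_next {α : Type*} [Primcodable α] {f : α → State} {g : α → Move}
    (hf : Computable f) (hg : Computable g) : Computable fun a => next (f a) (g a) := by
  have h : Primrec₂ next := by unfold Primrec₂; fun_prop
  exact h.to_comp.comp hf hg

lemma computable_iterate {σ : Type*} [Primcodable σ] (s : σ) {g : ℕ → σ → σ}
    (hg : Computable fun q : ℕ × σ => g q.1 q.2) :
    Computable fun i : ℕ => (Nat.rec s g i : σ) :=
  Computable.nat_rec (f := fun i : ℕ => i) (g := fun _ => s) (h := fun _ q => g q.1 q.2)
    Computable.id (Computable.const s) (hg.comp Computable.snd)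

lemma exists_computable_move :
    ∃ F : State × Prob → Move, Computable F ∧ ∀ st P, StateOK st → MoveOK st P (F (st, P)) := by
  classical
  let dec : ℕ → Move := fun n =>
    (Encodable.decode n : Option Move).getD
      ([], (0, (([], []), [], []), []), false, ((([], []), [], []), 0), [], 0)
  have hdec : Primrec dec := Primrec.option_getD.comp Primrec.decode (Primrec.const _)
  let R : State × Prob → ℕ → Prop := fun x n => StateOK x.1 → MoveOK x.1 x.2 (dec n)
  have hR : PrimrecPred fun p : (State × Prob) × ℕ => R p.1 p.2 :=
    primrecPred_imp (primrecPred_stateOK (by fun_prop))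
      (primrecPred_moveOK (by fun_prop) (by fun_prop) (hdec.comp Primrec.snd))
  have hex : ∀ x, ∃ n, R x n := by
    intro x
    by_cases hx : StateOK x.1
    · obtain ⟨c, hc⟩ := exists_moveOK hx x.2
      exact ⟨Encodable.encode c, fun _ => by
        simpa only [dec, Encodable.encodek, Option.getD_some] using hc⟩
    · exact ⟨0, fun h => absurd h hx⟩
  exact ⟨fun x => dec (Nat.find (hex x)), hdec.to_comp.comp (Computable.find hR.computablePred hex),
    fun st P h => Nat.find_spec (hex (st, P)) h⟩

/-- The properties of the sequence of states. -/
structure IsRun (st : ℕ → State) (mv : ℕ → Move) : Prop where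
  ok : ∀ i, StateOK (st i)
  moveOK : ∀ i, MoveOK (st i) (probOf i) (mv i)
  succ : ∀ i, st (i + 1) = next (st i) (mv i)

theorem exists_isRun : ∃ st mv, Computable st ∧ Computable mv ∧ IsRun st mv := by
  obtain ⟨F, hF, hm⟩ := exists_computable_move
  let g : ℕ → State → State := fun i s => next s (F (s, probOf i))
  have hp : Primrec fun q : ℕ × State => (q.2, probOf q.1) :=
    Primrec.snd.pair (primrec_probOf.comp Primrec.fst)
  have hg : Computable fun q : ℕ × State => g q.1 q.2 :=
    computable_next Computable.snd (hF.comp hp.to_comp)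
  let st : ℕ → State := fun i => Nat.rec initialState g i
  have hst : Computable st := computable_iterate initialState hg
  have hok : ∀ i, StateOK (st i) := by
    intro i
    induction i with
    | zero => exact stateOK_initialState
    | succ i ih => exact (hm _ _ ih).1
  exact ⟨st, fun i => F (st i, probOf i), hst, hF.comp (hst.pair primrec_probOf.to_comp), hok,
    fun i => hm _ _ (hok i), fun i => rfl⟩

end Snake

namespace Snake

open Equiv

/-! ### Snake problems in models of a run -/

section

variable {st : ℕ → State} {mv : ℕ → Move}

lemma IsRun.strictMono (h : IsRun st mv) : StrictMono fun i => (st i).2.1 :=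
  strictMono_nat_of_lt_succ fun i => by
    rw [h.succ]
    exact (h.moveOK i).2.1

lemma IsRun.mem_of_le (h : IsRun st mv) {i j : ℕ} (hij : i ≤ j) {b : Block} (hb : b ∈ (st i).1) :
    b ∈ (st j).1 := by
  induction j, hij using Nat.le_induction with
  | base => exact hb
  | succ j _ ih =>
    rw [h.succ]
    exact List.mem_append_left _ ih

lemma IsRun.eqv_of_le (h : IsRun st mv) {i j : ℕ} (hij : i ≤ j) {v w : Word}
    (hv : v.length ≤ (st i).2.1) (hw : w.length ≤ (st i).2.1)
    (e : Eqv (true, allPts (st i).1) v w) : Eqv (true, allPts (st j).1) v w := by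
  induction j, hij using Nat.le_induction with
  | base => exact e
  | succ j hj ih =>
    have hm := h.strictMono.monotone hj
    rw [h.succ]
    exact (h.moveOK j).2.2.1 v (mem_wordsUpto.2 (hv.trans hm)) w (mem_wordsUpto.2 (hw.trans hm)) ih

lemma eqv_allPts_iff {Bs : List Block} (h : ∀ b ∈ Bs, Valid b) {v w : Word} :
    Eqv (true, allPts Bs) v w ↔ drift v = drift w ∧
      ∀ b ∈ Bs, rep (perm b false) (perm b true) v = rep (perm b false) (perm b true) w := by
  rw [eqv_allPts h, rep_fullGen_eq_iff]
  rfl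

/-- A group generated by `a` and `t` that is residually determined by the degree and by the coded
spaces of a run. -/
structure IsModel {G : Type*} [Group G] (a t : G) (st : ℕ → State) : Prop where
  closure : Subgroup.closure {a, t} = ⊤
  hom : ∀ i, ∀ b ∈ (st i).1, ∃ f : G →* Perm (Fin (size b)), f a = perm b false ∧ f t = perm b true
  deg : ∃ δ : G →* Multiplicative ℤ, δ a = 1 ∧ δ t = Multiplicative.ofAdd 1
  sep : ∀ v w, drift v = drift w → (∀ i, ∀ b ∈ (st i).1,
    rep (perm b false) (perm b true) v = rep (perm b false) (perm b true) w) →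
      rep a t v = rep a t w

/-- Every sequence of states has a model. -/
theorem exists_isModel (st : ℕ → State) :
    ∃ (G : Type) (_ : Group G) (a t : G), IsModel a t st := by
  let B : Set Block := {b | ∃ i, b ∈ (st i).1}
  let H : Subgroup (Gam B × Multiplicative ℤ) := Subgroup.closure {fullGen B false, fullGen B true}
  let a : H := ⟨fullGen B false, Subgroup.subset_closure (by simp)⟩
  let t : H := ⟨fullGen B true, Subgroup.subset_closure (by simp)⟩
  refine ⟨H, inferInstance, a, t, ?_, fun i b hb => ?_, ?_, fun v w hd hp => ?_⟩
  · have h := Subgroup.closure_closure_coe_preimage (k := {fullGen B false, fullGen B true})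
    convert h using 2
    ext x
    simp [a, t, Subtype.ext_iff, H]
  · let f : Gam B →* Perm (Fin (size b)) :=
      Pi.evalMonoidHom (fun b : B => Perm (Fin (size b.1))) ⟨b, i, hb⟩
    exact ⟨(f.comp (MonoidHom.fst _ _)).comp H.subtype, rfl, rfl⟩
  · exact ⟨(MonoidHom.snd _ _).comp H.subtype, rfl, rfl⟩
  · refine Subtype.ext ?_
    have h : ∀ u, ((rep a t u : H) : Gam B × Multiplicative ℤ) =
        rep (fullGen B false) (fullGen B true) u := fun u => map_rep H.subtype a t u
    rw [h, h, rep_fullGen_eq_iff]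
    exact ⟨hd, fun b ⟨i, hb⟩ => hp i b hb⟩

variable {G : Type*} [Group G] {a t : G}

lemma exists_rep_eq (h : Subgroup.closure {a, t} = ⊤) (g : G) : ∃ w, rep a t w = g := by
  have hg : g ∈ Subgroup.closure {a, t} := h ▸ Subgroup.mem_top g
  induction hg using Subgroup.closure_induction with
  | mem x hx =>
    obtain rfl | rfl := hx
    · exact ⟨[(false, true)], by simp [letterVal]⟩
    · exact ⟨[(true, true)], by simp [letterVal]⟩
  | one => exact ⟨[], rfl⟩
  | mul x y _ _ hx hy =>
    obtain ⟨v, rfl⟩ := hx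
    obtain ⟨w, rfl⟩ := hy
    exact ⟨v ++ w, rep_append _ _ _ _⟩
  | inv x _ hx =>
    obtain ⟨v, rfl⟩ := hx
    exact ⟨invWord v, rep_invWord _ _ _⟩

lemma deg_rep {δ : G →* Multiplicative ℤ} (ha : δ a = 1) (ht : δ t = Multiplicative.ofAdd 1)
    (w : Word) : δ (rep a t w) = Multiplicative.ofAdd (drift w) := by
  rw [map_rep, ha, ht, rep_ofAdd]

/-- Words of bounded length are compared in a model by means of finitely many coded spaces. -/
theorem IsModel.rep_eq_iff (hG : IsModel a t st) (h : IsRun st mv) {i : ℕ} {v w : Word}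
    (hv : v.length ≤ (st i).2.1) (hw : w.length ≤ (st i).2.1) :
    rep a t v = rep a t w ↔ Eqv (true, allPts (st i).1) v w := by
  refine ⟨fun e => (eqv_allPts_iff (h.ok i).1).2 ⟨?_, fun b hb => ?_⟩, fun e => ?_⟩
  · obtain ⟨δ, ha, ht⟩ := hG.deg
    have := congrArg δ e
    rw [deg_rep ha ht, deg_rep ha ht] at this
    exact Multiplicative.ofAdd.injective this
  · obtain ⟨f, ha, ht⟩ := hG.hom i b hb
    have := congrArg f e
    rwa [map_rep, map_rep, ha, ht] at this
  · refine hG.sep v w ((eqv_allPts_iff (h.ok i).1).1 e).1 fun j b hb => ?_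
    exact ((eqv_allPts_iff (h.ok _).1).1 (h.eqv_of_le (le_max_left i j) hv hw e)).2 b
      (h.mem_of_le (le_max_right i j) hb)

theorem IsModel.pSnake_zero (hG : IsModel a t st) (h : IsRun st mv) {i : ℕ}
    (hi : (mv i).2.2.1 = true) : PSnake a t (probOf i) 0 := by
  obtain ⟨hb, hx, hO, hd⟩ := (h.moveOK i).2.2.2.1 hi
  have hv := (h.moveOK i).1.1 _ hb
  rw [← h.succ] at hb
  obtain ⟨f, ha, ht⟩ := hG.hom _ _ hb
  obtain ⟨δ, hδa, hδt⟩ := hG.deg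
  have hO' := hO.congr (R' := fun u w => permStep (f a) (f t) ⟨_, hx⟩ u =
    permStep (f a) (f t) ⟨_, hx⟩ w) (fun _ _ => rfl) fun u w _ _ => by
      rw [ha, ht, Fin.ext_iff]
      change _ ↔ (pstep _ _ u : ℕ) = pstep _ _ w
      rw [coe_pstep hv, coe_pstep hv]
      simp [Eqv]
  refine pSnake_zero_of_isOuro f δ (hO'.isOuro (permStep_append _ _)) ?_
  rw [deg_rep hδa hδt]
  simpa [sameDrift_iff] using hd

/-- No path in a model has the length excluded by a move. -/
theorem IsModel.not_isPath (hG : IsModel a t st) (h : IsRun st mv) {i : ℕ}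
    (hi : (mv i).2.2.1 = false) (z : ℕ → G) (y : ℕ → ℕ × ℕ) :
    ¬ IsPath (probOf i) (groupStep a t) (mv i).2.2.2.2.2 z y := by
  obtain ⟨hL, hno⟩ := (h.moveOK i).2.2.2.2 hi
  intro hp
  refine hno (List.ofFn fun j : Fin (mv i).2.2.2.2.2 => y j) (mem_listsOf.2 ⟨by simp, ?_⟩) ?_
  · simp only [List.mem_ofFn]
    rintro _ ⟨j, rfl⟩
    exact mem_alph.2 (hp.letter _ j.2)
  · refine (hp.rPath (groupStep_nil a t) (groupStep_append a t)).congr (fun j hj => fn_ofFn y hj)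
      fun u w hu hw => ?_
    rw [← h.succ] at hL ⊢
    rw [groupStep_inj, hG.rep_eq_iff h (hu.trans (by nlinarith)) (hw.trans (by nlinarith))]

theorem IsModel.pSnake_iff (hG : IsModel a t st) (h : IsRun st mv) {i n : ℕ}
    (hi : (mv i).2.2.1 = false) (hn : n ≤ (mv i).2.2.2.2.2) (hn' : 0 < n) :
    PSnake a t (probOf i) n ↔ ∃ ys ∈ listsOf (alph (probOf i)) n,
      ROuro (probOf i) (Eqv (true, allPts (next (st i) (mv i)).1)) n (fn ys) := by
  obtain ⟨hL, -⟩ := (h.moveOK i).2.2.2.2 hi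
  rw [← h.succ] at hL ⊢
  have key : ∀ g u w, u.length ≤ n * wordBound (probOf i) → w.length ≤ n * wordBound (probOf i) →
      (groupStep a t g u = groupStep a t g w ↔ Eqv (true, allPts (st (i + 1)).1) u w) := by
    intro g u w hu hw
    have := Nat.mul_le_mul_right (wordBound (probOf i)) hn
    rw [groupStep_inj, hG.rep_eq_iff h (hu.trans (by nlinarith)) (hw.trans (by nlinarith))]
  refine ⟨fun hs => ?_, fun ⟨ys, _, hO⟩ => ?_⟩
  · obtain ⟨z, y, hO⟩ := hs.isOuro hn'
    refine ⟨List.ofFn fun j : Fin n => y j, mem_listsOf.2 ⟨by simp, ?_⟩, ?_⟩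
    · simp only [List.mem_ofFn]
      rintro _ ⟨j, rfl⟩
      exact mem_alph.2 (hO.letter _ j.2)
    · exact (hO.rOuro (groupStep_nil a t) (groupStep_append a t)).congr (fun j hj => fn_ofFn y hj)
        (key (z 0))
  · exact pSnake_of_isOuro ((hO.congr (fun _ _ => rfl)
      fun u w hu hw => (key 1 u w hu hw).symm).isOuro (groupStep_append a t))

end

end Snake

namespace Snake

/-! ### Decidability of snake problems in models -/

lemma computablePred_comp {α β : Type*} [Primcodable α] [Primcodable β] {p : β → Prop}
    (hp : ComputablePred p) {f : α → β} (hf : Computable f) : ComputablePred fun a => p (f a) := by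
  obtain ⟨g, hg, rfl⟩ := ComputablePred.computable_iff.1 hp
  exact ComputablePred.computable_iff.2 ⟨fun a => g (f a), hg.comp hf, rfl⟩

section

variable {st : ℕ → State} {mv : ℕ → Move} {G : Type*} [Group G] {a t : G}

lemma IsModel.lt_of_pSnake (hG : IsModel a t st) (h : IsRun st mv) {i n : ℕ}
    (hi : (mv i).2.2.1 = false) (hs : PSnake a t (probOf i) n) :
    0 < n ∧ n < (mv i).2.2.2.2.2 := by
  by_contra hn
  obtain ⟨z, y, hp⟩ := hs.isPath (L := (mv i).2.2.2.2.2) (by omega)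
  exact hG.not_isPath h hi z y hp

lemma IsModel.pSnake_zero_iff (hG : IsModel a t st) (h : IsRun st mv) (i : ℕ) :
    PSnake a t (probOf i) 0 ↔ (mv i).2.2.1 = true := by
  refine ⟨fun hs => ?_, hG.pSnake_zero h⟩
  by_contra hi
  exact (hG.lt_of_pSnake h (by simpa using hi) hs).1.false

lemma IsModel.exists_pSnake_iff (hG : IsModel a t st) (h : IsRun st mv) (i : ℕ) :
    (∃ n, PSnake a t (probOf i) n) ↔ (mv i).2.2.1 = true ∨ ∃ n < (mv i).2.2.2.2.2,
      ∃ ys ∈ listsOf (alph (probOf i)) n,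
        ROuro (probOf i) (Eqv (true, allPts (next (st i) (mv i)).1)) n (fn ys) := by
  rcases hi : (mv i).2.2.1 with _ | _
  · simp only [Bool.false_eq_true, false_or]
    refine exists_congr fun n => ⟨fun hs => ?_, fun ⟨hn, hs⟩ => ?_⟩
    · obtain ⟨h0, hn⟩ := hG.lt_of_pSnake h hi hs
      exact ⟨hn, (hG.pSnake_iff h hi hn.le h0).1 hs⟩
    · obtain ⟨_, _, hO⟩ := id hs
      exact (hG.pSnake_iff h hi hn.le hO.2.1).2 hs
  · simpa using ⟨0, hG.pSnake_zero h hi⟩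

theorem IsModel.computablePred_pSnake_zero (hG : IsModel a t st) (h : IsRun st mv)
    (hmv : Computable mv) : ComputablePred fun P => PSnake a t P 0 := by
  have h1 : PrimrecPred fun c : Move => c.2.2.1 = true :=
    primrecPred_eq (by fun_prop) (by fun_prop)
  refine (computablePred_comp h1.computablePred (hmv.comp Computable.encode)).of_eq fun P => ?_
  rw [← hG.pSnake_zero_iff h, probOf_encode]

set_option synthInstance.maxSize 512 in
theorem IsModel.computablePred_exists_pSnake (hG : IsModel a t st) (h : IsRun st mv)
    (hst : Computable st) (hmv : Computable mv) : ComputablePred fun P => ∃ n, PSnake a t P n := by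
  have h1 : PrimrecPred fun q : (State × Move) × Prob => q.1.2.2.2.1 = true ∨
      ∃ n < q.1.2.2.2.2.2.2, ∃ ys ∈ listsOf (alph q.2) n,
        ROuro q.2 (Eqv (true, allPts (next q.1.1 q.1.2).1)) n (fn ys) := by
    refine .or (primrecPred_eq (by fun_prop) (by fun_prop)) ?_
    exact primrecPred_bex_lt (by fun_prop) (primrecPred_bex (by fun_prop)
      (primrecPred_rOuro (by fun_prop) (by fun_prop) (by fun_prop) (by fun_prop)))
  have h2 := computablePred_comp h1.computablePred
    (((hst.pair hmv).comp Computable.encode).pair Computable.id)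
  refine h2.of_eq fun P => ?_
  have h3 := hG.exists_pSnake_iff h (Encodable.encode P)
  rw [probOf_encode] at h3
  exact h3.symm

end

end Snake

namespace Snake

open Equiv

/-! ### Models are not virtually free -/

section

variable {st : ℕ → State} {mv : ℕ → Move} {G : Type*} [Group G] {a t : G}

/-- The elements of degree zero have finite order. -/
lemma IsModel.isOfFinOrder (hG : IsModel a t st) (h : IsRun st mv) {δ : G →* Multiplicative ℤ}
    (ha : δ a = 1) (ht : δ t = Multiplicative.ofAdd 1) {g : G} (hg : δ g = 1) :
    IsOfFinOrder g := by
  obtain ⟨w, rfl⟩ := exists_rep_eq hG.closure g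
  have hw : drift w = 0 := by
    rw [deg_rep ha ht] at hg
    exact Multiplicative.ofAdd.injective hg
  let P : Prob := (false, [w], 1, [((0, 0), 0, (0, 0))])
  have hP : probOf (Encodable.encode P) = P := probOf_encode P
  have hwd : ∀ s, drift (wd P s) = 0 := by
    rintro (_ | s) <;> simp [wd, P, hw]
  rcases hi : (mv (Encodable.encode P)).2.2.1 with _ | _
  · by_contra hfin
    refine hG.not_isPath h hi (fun j => rep a t w ^ j) (fun _ => (0, 0)) ?_
    rw [hP]
    exact ⟨fun _ _ => by simp [IsLetter, P], fun j _ => by simp [groupStep, wd, P, pow_succ],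
      fun j _ k _ e => injective_pow_iff_not_isOfFinOrder.2 hfin e, fun _ _ _ => by simp [P],
      fun e => by simp [P] at e⟩
  · have hd := ((h.moveOK _).2.2.2.1 hi).2.2.2
    rw [hP, sameDrift_iff, drift_pw] at hd
    exact absurd (by simp [pathDrift, hwd]) hd

/-- The conjugates of the first generator are infinite in number. -/
lemma IsModel.infinite_ker (hG : IsModel a t st) (h : IsRun st mv) {δ : G →* Multiplicative ℤ}
    (ha : δ a = 1) : Infinite δ.ker := by
  have hmem : ∀ j, conjT a t j ∈ δ.ker := fun j => by simp [MonoidHom.mem_ker, conjT, ha]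
  refine Infinite.of_injective (fun i => (⟨_, hmem (2 * (st i).2.1 + 1)⟩ : δ.ker)) ?_
  have hlt : ∀ i j, i < j → conjT a t (2 * (st i).2.1 + 1) ≠ conjT a t (2 * (st j).2.1 + 1) := by
    intro i j hij e
    obtain ⟨hv, hb, hinv, x, hx, hne⟩ := h.ok j
    obtain ⟨f, hfa, hft⟩ := hG.hom j _ hb
    have hlt : 2 * (st i).2.1 + 1 < 2 * (st j).2.1 + 1 := by
      have : (st i).2.1 < (st j).2.1 := h.strictMono hij
      omega
    have e' := congrArg f e
    rw [map_conjT, map_conjT, hfa, hft] at e'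
    refine hne ?_
    rw [← hinv _ hlt x hx, ev_aw (hv _ hb) _ ⟨x, hx⟩, ev_aw (hv _ hb) _ ⟨x, hx⟩, e']
  intro i j e
  have e' := Subtype.ext_iff.1 e
  exact (lt_trichotomy i j).elim (fun hij => absurd e' (hlt i j hij))
    (Or.elim · id fun hij => absurd e'.symm (hlt j i hij))

theorem IsModel.not_virtually_free (hG : IsModel a t st) (h : IsRun st mv) :
    ¬ ∃ H : Subgroup G, H.FiniteIndex ∧ IsFreeGroup H := by
  rintro ⟨H, hfin, hfree⟩
  obtain ⟨δ, ha, ht⟩ := hG.deg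
  have : IsMulTorsionFree H := (IsFreeGroup.toFreeGroup H).injective.isMulTorsionFree
    (IsFreeGroup.toFreeGroup H).toMonoidHom
  have hinf := hG.infinite_ker h ha
  refine not_finite_iff_infinite.2 hinf (Finite.of_injective (fun k : δ.ker => (k : G ⧸ H)) ?_)
  intro k k' e
  have hmem : (k : G)⁻¹ * k' ∈ H := QuotientGroup.eq.1 e
  have hord : IsOfFinOrder ((k : G)⁻¹ * k') :=
    hG.isOfFinOrder h ha ht (δ.ker.mul_mem (δ.ker.inv_mem k.2) k'.2)
  have hone : (⟨_, hmem⟩ : H) = 1 := (isOfFinOrder_iff_eq_one _).1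
    ((H.subtype_injective.isOfFinOrder_iff).1 hord)
  rw [Subgroup.mk_eq_one, inv_mul_eq_one] at hone
  exact Subtype.ext hone

end

end Snake

namespace Snake

/-! ### Reductions between snake problems -/

section

variable {G : Type} [Group G] {a t : G} {m : ℕ} {e : Fin m → G} {u : Fin m → Word}

lemma rep_wd_ofFn (hu : ∀ s, rep a t (u s) = e s) (b : Bool) (T : EncDirTileset) {s : ℕ}
    (hs : s < m) : rep a t (wd (b, List.ofFn u, T) s) = e ⟨s, hs⟩ := by
  rw [← hu, wd, List.getD_eq_getElem _ _ (by simpa using hs), List.getElem_ofFn]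

lemma dirWeakSnake_iff (hu : ∀ s, rep a t (u s) = e s) {T : EncDirTileset} {n : ℕ} :
    DirWeakSnake e T n ↔ PSnake a t (false, List.ofFn u, T) n := by
  refine exists₂_congr fun ω x => and_congr_right fun _ => ?_
  simp only [IsLetter, List.length_ofFn, Bool.false_eq_true, false_imp_iff, and_true, true_imp_iff]
  refine and_congr_right fun hx => ⟨fun h => ⟨fun i => ?_, fun i => (h i).2.2⟩,
    fun h i => ⟨(hx i).2, ?_, h.2 i⟩⟩
  · rw [rep_wd_ofFn hu _ _ (hx i).2]
    exact (h i).2.1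
  · rw [← rep_wd_ofFn hu false T]
    exact h.1 i

lemma dirStrongSnake_iff (hu : ∀ s, rep a t (u s) = e s) {T : EncDirTileset} {n : ℕ} :
    DirStrongSnake e T n ↔ PSnake a t (true, List.ofFn u, T) n := by
  refine exists₂_congr fun ω x => and_congr_right fun _ => ?_
  simp only [IsLetter, List.length_ofFn, Bool.true_eq_false, false_imp_iff, true_and, true_imp_iff]
  refine and_congr_right fun hx => and_congr
    ⟨fun h i => ?_, fun h i => ⟨(hx i).2, ?_⟩⟩ ⟨fun h i j s hs hij => ?_, fun h i j s hij => ?_⟩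
  · rw [rep_wd_ofFn hu _ _ (hx i).2]
    exact (h i).2
  · rw [← rep_wd_ofFn hu true T]
    exact h i
  · rw [rep_wd_ofFn hu _ _ hs] at hij
    exact h i j ⟨s, hs⟩ hij
  · refine h i j s s.2 ?_
    rwa [rep_wd_ofFn hu]

/-- The directed tileset whose colours are those of `T` with arbitrary directions. -/
def addDirections (m : ℕ) (T : EncTileset) : EncDirTileset :=
  (T.1, T.2.flatMap fun d => (List.range m).flatMap fun b => (List.range m).map fun b' =>
    ((d.1, b), d.2.1, (d.2.2, b')))

lemma mem_addDirections {T : EncTileset} {c c' : ℕ × ℕ} {s : ℕ} :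
    (c, s, c') ∈ (addDirections m T).2 ↔ (c.1, s, c'.1) ∈ T.2 ∧ c.2 < m ∧ c'.2 < m := by
  rcases c with ⟨c, b⟩
  rcases c' with ⟨c', b'⟩
  simp only [addDirections, List.mem_flatMap, List.mem_map, List.mem_range, Prod.mk.injEq,
    Prod.exists]
  grind

lemma primrec_addDirections (m : ℕ) : Primrec (addDirections m) := by
  unfold addDirections
  fun_prop

lemma weakSnake_iff {T : EncTileset} {n : ℕ} :
    WeakSnake e T n ↔ DirWeakSnake e (addDirections m T) n := by
  constructor
  · rintro ⟨ω, x, hω, hx, h⟩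
    choose s hs hT using h
    exact ⟨ω, fun i => (x i, s i), hω, fun i => ⟨hx i, (s i).2⟩, fun i => ⟨(s i).2, hs i,
      mem_addDirections.2 ⟨hT i, (s i).2, (s (i + 1)).2⟩⟩⟩
  · rintro ⟨ω, x, hω, hx, h⟩
    exact ⟨ω, fun i => (x i).1, hω, fun i => (hx i).1, fun i => ⟨⟨(x i).2, (h i).1⟩, (h i).2.1,
      (mem_addDirections.1 (h i).2.2).1⟩⟩

lemma strongSnake_iff {T : EncTileset} {n : ℕ} :
    StrongSnake e T n ↔ DirStrongSnake e (addDirections m T) n := by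
  constructor
  · rintro ⟨ω, x, hω, hx, h, hT⟩
    choose s hs using h
    exact ⟨ω, fun i => (x i, s i), hω, fun i => ⟨hx i, (s i).2⟩, fun i => ⟨(s i).2, hs i⟩,
      fun i j r hij => mem_addDirections.2 ⟨hT i j r hij, (s i).2, (s j).2⟩⟩
  · rintro ⟨ω, x, hω, hx, h, hT⟩
    exact ⟨ω, fun i => (x i).1, hω, fun i => (hx i).1, fun i => ⟨⟨(x i).2, (h i).1⟩, (h i).2⟩,
      fun i j r hij => (mem_addDirections.1 (hT i j r hij)).1⟩

end

end Snake

theorem exists_fg_not_virtuallyFree_all_snake_problems_decidable :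
    ∃ (G : Type) (instG : Group G) (S₀ : Finset G),
      -- G is finitely generated
      Subgroup.closure (S₀ : Set G) = ⊤ ∧
      -- G is not virtually free
      (¬ ∃ H : Subgroup G, H.FiniteIndex ∧ IsFreeGroup H) ∧
      -- all eight snake problems are decidable, for every finite generating set S of G
      (∀ S : Finset G, Subgroup.closure (S : Set G) = ⊤ →
        ∀ (m : ℕ) (e : Fin m → G), Function.Injective e → Set.range e = (S : Set G) →
          -- weak snake problem
          ComputablePred (fun T : EncTileset => ∃ n : ℕ, @WeakSnake G instG m e T n) ∧
          -- weak infinite snake problem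
          ComputablePred (fun T : EncTileset => @WeakSnake G instG m e T 0) ∧
          -- strong snake problem
          ComputablePred (fun T : EncTileset => ∃ n : ℕ, @StrongSnake G instG m e T n) ∧
          -- strong infinite snake problem
          ComputablePred (fun T : EncTileset => @StrongSnake G instG m e T 0) ∧
          -- directed weak snake problem
          ComputablePred (fun T : EncDirTileset => ∃ n : ℕ, @DirWeakSnake G instG m e T n) ∧
          -- directed weak infinite snake problem
          ComputablePred (fun T : EncDirTileset => @DirWeakSnake G instG m e T 0) ∧
          -- directed strong snake problem
          ComputablePred (fun T : EncDirTileset => ∃ n : ℕ, @DirStrongSnake G instG m e T n) ∧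
          -- directed strong infinite snake problem
          ComputablePred (fun T : EncDirTileset => @DirStrongSnake G instG m e T 0)) := by
  classical
  obtain ⟨st, mv, hst, hmv, hrun⟩ := Snake.exists_isRun
  obtain ⟨G, instG, a, t, hG⟩ := Snake.exists_isModel st
  refine ⟨G, instG, {a, t}, by simpa using hG.closure, hG.not_virtually_free hrun,
    fun S _ m e _ _ => ?_⟩
  choose u hu using fun s => Snake.exists_rep_eq hG.closure (e s)
  have hP (b : Bool) : Primrec fun T : EncDirTileset => ((b, List.ofFn u, T) : Snake.Prob) := by
    fun_prop
  have hA := (Snake.primrec_addDirections m).to_comp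
  have h0 := hG.computablePred_pSnake_zero hrun hmv
  have h1 := hG.computablePred_exists_pSnake hrun hst hmv
  have hw0 : ComputablePred fun T : EncDirTileset => DirWeakSnake e T 0 :=
    (Snake.computablePred_comp h0 (hP false).to_comp).of_eq fun T =>
      (Snake.dirWeakSnake_iff hu).symm
  have hw1 : ComputablePred fun T : EncDirTileset => ∃ n, DirWeakSnake e T n :=
    (Snake.computablePred_comp h1 (hP false).to_comp).of_eq fun T =>
      exists_congr fun n => (Snake.dirWeakSnake_iff hu).symm
  have hs0 : ComputablePred fun T : EncDirTileset => DirStrongSnake e T 0 :=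
    (Snake.computablePred_comp h0 (hP true).to_comp).of_eq fun T =>
      (Snake.dirStrongSnake_iff hu).symm
  have hs1 : ComputablePred fun T : EncDirTileset => ∃ n, DirStrongSnake e T n :=
    (Snake.computablePred_comp h1 (hP true).to_comp).of_eq fun T =>
      exists_congr fun n => (Snake.dirStrongSnake_iff hu).symm
  exact ⟨(Snake.computablePred_comp hw1 hA).of_eq fun T =>
      exists_congr fun n => Snake.weakSnake_iff.symm,
    (Snake.computablePred_comp hw0 hA).of_eq fun T => Snake.weakSnake_iff.symm,
    (Snake.computablePred_comp hs1 hA).of_eq fun T =>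
      exists_congr fun n => Snake.strongSnake_iff.symm,
    (Snake.computablePred_comp hs0 hA).of_eq fun T => Snake.strongSnake_iff.symm,
    hw1, hw0, hs1, hs0⟩
end

section
/- Let G be a group with a free subgroup of finite index (G virtually free), let ε : FreeGroup σ →* G be a surjective homomorphism with σ a finite type, let π : G →* ℤ be a surjective homomorphism, and let Θ = (S', C, D) be a directed tileset with memory set S' ⊆ FreeGroup σ. If for every R ∈ ℕ there exists an infinite strong directed Θ-snake (ω, x) in (G, ε) such that the image of π∘ω has diameter greater than R (i.e. there are i, j ∈ ℤ with |π(ω(i)) − π(ω(j))| > R), then there exists an infinite strong directed Θ-snake (ω, x) in (G, ε) whose image under π∘ω is unbounded in ℤ. -/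
/-!
STATEMENT 5: Let `G` be virtually free, `ε : FreeGroup σ →* G` surjective with `σ`
finite, `π : G →* ℤ` surjective (`ℤ` taken multiplicatively as `Multiplicative ℤ`),
and `Θ = (S', C, D)` a directed tileset with memory set `S' ⊆ FreeGroup σ`.  If for
every `R ∈ ℕ` there is an infinite strong directed `Θ`-snake `(ω, x)` in `(G, ε)` whose
image under `π ∘ ω` has diameter greater than `R` (there are `i, j ∈ ℤ` with
`|π (ω i) − π (ω j)| > R`), then there is an infinite strong directed `Θ`-snake in
`(G, ε)` whose image under `π ∘ ω` is unbounded in `ℤ`.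
-/

/-- A directed tileset over the free group `FreeGroup σ` with base colour type `C₀`:
a finite memory set `S'`, a finite colour set `C ⊆ C₀ × S'`, and a finite domino set
`D ⊆ C × S' × C`. -/
structure DirTileset (σ : Type) (C₀ : Type) where
  S' : Finset (FreeGroup σ)
  C : Finset (C₀ × FreeGroup σ)
  D : Finset ((C₀ × FreeGroup σ) × FreeGroup σ × (C₀ × FreeGroup σ))
  mem_S' : ∀ c ∈ C, c.2 ∈ S'
  dom_mem : ∀ d ∈ D, d.1 ∈ C ∧ d.2.1 ∈ S' ∧ d.2.2 ∈ C

/-- An infinite strong directed `Θ`-snake in `(M, εM)`, indexed by `ℤ`: maps `ω : ℤ → M`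
injective and `x : ℤ → C` such that `ω (i+1) = ω i * εM ((x i).2)` for all `i`, and
`(x i, s, x j) ∈ D` whenever `s ∈ S'` and `ω j = ω i * εM s`. -/
def IsInfSnake {σ C₀ : Type} {M : Type} [Group M] (εM : FreeGroup σ →* M)
    (Θ : DirTileset σ C₀) (ω : ℤ → M) (x : ℤ → C₀ × FreeGroup σ) : Prop :=
  Function.Injective ω ∧
  (∀ i, x i ∈ Θ.C) ∧
  (∀ i, ω (i + 1) = ω i * εM (x i).2) ∧
  (∀ i j : ℤ, ∀ s ∈ Θ.S', ω j = ω i * εM s → (x i, (s, x j)) ∈ Θ.D)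


namespace FreeGroup

theorem toWord_mul_of_cases {X : Type*} [DecidableEq X] (w : FreeGroup X) (x : X) :
    (w * of x).toWord = w.toWord ++ [(x, true)] ∨
      w.toWord = (w * of x).toWord ++ [(x, false)] := by
  rw [toWord_mul, toWord_of]
  have hw : IsReduced w.toWord := isReduced_toWord
  rcases List.eq_nil_or_concat w.toWord with h | ⟨L, d, h⟩
  · left
    rw [h]
    exact reduce_singleton _
  · rw [h] at hw ⊢
    simp only [List.concat_eq_append] at hw ⊢
    by_cases hd : d = (x, false)
    · right
      subst hd
      have h1 : Red.Step ((L ++ [(x, false)]) ++ [(x, true)]) L := by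
        have := Red.Step.not (L₁ := L) (L₂ := []) (x := x) (b := false)
        simpa using this
      rw [reduce.Step.eq h1, (hw.infix ⟨[], [(x, false)], by simp⟩ : IsReduced L).reduce_eq]
    · left
      refine IsReduced.reduce_eq (IsReduced.append_overlap hw ?_ (by simp))
      simp only [List.cons_append, List.nil_append, isReduced_cons_cons]
      refine ⟨fun h1 => ?_, IsReduced.singleton⟩
      obtain ⟨d1, d2⟩ := d
      cases d2 <;> simp_all

/-- A cone in a free group is almost invariant under right multiplication. -/
theorem finite_startsWith_boundary {X : Type*} [DecidableEq X] (y : X × Bool) (e : FreeGroup X) :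
    {w : FreeGroup X | ¬ (w ∈ startsWith y ↔ w * e ∈ startsWith y)}.Finite := by
  induction e using FreeGroup.induction_on with
  | C1 => simp
  | of x =>
    refine Set.Finite.subset (Set.toFinite {1, (of x)⁻¹}) fun w hw => ?_
    by_contra hne
    simp only [Set.mem_insert_iff, Set.mem_singleton_iff, not_or, ← mul_eq_one_iff_eq_inv] at hne
    rw [← toWord_eq_nil_iff, ← toWord_eq_nil_iff] at hne
    apply hw
    simp only [startsWith, Set.mem_ofPred_eq]
    rcases toWord_mul_of_cases w x with h | h
    · rw [h, List.getElem?_append_left (List.length_pos_iff.2 hne.1)]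
    · rw [h, List.getElem?_append_left (List.length_pos_iff.2 hne.2)]
  | inv_of x ih =>
    refine (ih.image (· * of x)).subset fun w hw => ⟨w * (of x)⁻¹, ?_, by simp⟩
    simp only [Set.mem_ofPred_eq, inv_mul_cancel_right] at hw ⊢
    exact fun h => hw h.symm
  | mul a b iha ihb =>
    refine (iha.union (ihb.image (· * a⁻¹))).subset fun w hw => ?_
    by_cases h : w ∈ startsWith y ↔ w * a ∈ startsWith y
    · refine Or.inr ⟨w * a, ?_, by simp⟩
      simp only [Set.mem_ofPred_eq, mul_assoc] at hw ⊢
      rwa [h] at hw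
    · exact Or.inl h

/-- A reduced word `u ++ y :: t` translates the cone at `y` to the set of elements whose word
starts with `u ++ [y]`. -/
theorem inv_mk_mul_mem_startsWith_iff {X : Type*} [DecidableEq X] {u : List (X × Bool)}
    {y : X × Bool} (hu : IsReduced (u ++ [y])) (w : FreeGroup X) :
    (mk u)⁻¹ * w ∈ startsWith y ↔ u ++ [y] <+: w.toWord := by
  constructor
  · intro h
    obtain ⟨t, ht⟩ : ∃ t, ((mk u)⁻¹ * w).toWord = y :: t := by
      simp only [startsWith, Set.mem_ofPred_eq] at h
      cases h' : ((mk u)⁻¹ * w).toWord with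
      | nil => rw [h'] at h; simp at h
      | cons a t => rw [h'] at h; exact ⟨t, by simp_all⟩
    have hr : IsReduced ([y] ++ t) := by
      have := isReduced_toWord (x := (mk u)⁻¹ * w)
      rwa [ht] at this
    have hw : w = mk (u ++ [y] ++ t) := by
      have : w = mk u * mk (((mk u)⁻¹ * w).toWord) := by rw [mk_toWord, mul_inv_cancel_left]
      rw [this, ht, mul_mk]
      simp
    rw [hw, toWord_mk, (hu.append_overlap hr (by simp)).reduce_eq]
    exact List.prefix_append _ _
  · rintro ⟨t, ht⟩
    have hw : (mk u)⁻¹ * w = mk (y :: t) := by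
      rw [inv_mul_eq_iff_eq_mul, mul_mk, ← mk_toWord (x := w), ← ht]
      simp
    have hr : IsReduced (y :: t) := by
      have := isReduced_toWord (x := w)
      rw [← ht] at this
      exact this.infix ⟨u, [], by simp⟩
    rw [hw]
    simp [startsWith, hr.reduce_eq]

theorem finite_of_fg {X : Type*} [h : Group.FG (FreeGroup X)] : Finite X := by
  classical
  obtain ⟨S, hS, hfin⟩ := Group.fg_iff.1 h
  let D : FreeGroup X →* Multiplicative (X →₀ ℤ) :=
    lift fun x => Multiplicative.ofAdd (Finsupp.single x 1)
  let Y : Set X := ⋃ s ∈ S, ((D s).toAdd.support : Set X)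
  have hY : Y.Finite := hfin.biUnion fun s _ => Finset.finite_toSet _
  have key : ∀ w : FreeGroup X, ∀ x ∉ Y, (D w).toAdd x = 0 := by
    intro w
    have hw : w ∈ Subgroup.closure S := hS ▸ Subgroup.mem_top w
    induction hw using Subgroup.closure_induction with
    | mem s hs =>
      intro x hx
      by_contra h
      exact hx (Set.mem_biUnion hs (by simpa using h))
    | one => simp
    | mul a b _ _ ha hb => intro x hx; simp [ha x hx, hb x hx]
    | inv a _ ha => intro x hx; simp [ha x hx]
  refine Set.finite_univ_iff.1 (hY.subset fun x _ => ?_)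
  by_contra hx
  simpa [D] using key (of x) x hx

end FreeGroup

theorem exists_equivariant_retraction {F G : Type*} [Group F] [Group G] (φ : F →* G)
    (hφ : Function.Injective φ) (hfin : φ.range.FiniteIndex) :
    ∃ (p : G → F) (τ : G → G), (Set.range τ).Finite ∧ (∀ u, φ (p u) * τ u = u) ∧
      ∀ h u, p (φ h * u) = h * p u := by
  let q : G → Quotient (QuotientGroup.rightRel φ.range) := fun u => Quotient.mk _ u
  have : Finite (Quotient (QuotientGroup.rightRel φ.range)) :=
    Finite.of_equiv _ (QuotientGroup.quotientRightRelEquivQuotientLeftRel _).symm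
  have hmem : ∀ u, ∃ f, φ f = u * ((q u).out)⁻¹ := fun u => by
    have : QuotientGroup.rightRel φ.range (q u).out u := Quotient.mk_out u
    rwa [QuotientGroup.rightRel_apply] at this
  choose p hp using hmem
  refine ⟨p, fun u => (q u).out, (Set.finite_range fun c : Quotient
    (QuotientGroup.rightRel φ.range) => c.out).subset ?_, ?_, ?_⟩
  · rintro _ ⟨u, rfl⟩
    exact ⟨q u, rfl⟩
  · intro u
    simp [hp]
  · intro h u
    have : q (φ h * u) = q u := Quotient.sound (by
      change QuotientGroup.rightRel φ.range _ _
      rw [QuotientGroup.rightRel_apply]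
      exact ⟨h⁻¹, by simp⟩)
    apply hφ
    rw [hp, this, map_mul, hp, mul_assoc]

theorem exists_eq_state_ne_value {K : Type*} [Finite K] (B : ℤ) :
    ∃ N : ℤ, ∀ (n : ℕ) (q : ℕ → ℤ) (st : ℕ → K), q 0 = 0 →
      (∀ k < n, |q (k + 1) - q k| ≤ B) → N < |q n| →
      ∃ k l, k < l ∧ l < n ∧ st k = st l ∧ q k ≠ q l := by
  have key : ∀ (n : ℕ) (q : ℕ → ℤ) (st : ℕ → K), q 0 = 0 →
      (∀ k < n, |q (k + 1) - q k| ≤ B) → (Nat.card K + 1) * (|B| + 1) < q n →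
      ∃ k l, k < l ∧ l < n ∧ st k = st l ∧ q k ≠ q l := by
    intro n q st h0 hB hn
    have hB0 := abs_nonneg B
    have hBB := le_abs_self B
    have hex : ∀ t : Fin (Nat.card K + 1), ∃ k < n, (t : ℤ) * (|B| + 1) ≤ q k ∧
        q k < ((t : ℤ) + 1) * (|B| + 1) := by
      intro t
      have ht : (t : ℤ) ≤ Nat.card K := by have := t.2; omega
      have hlt : (t : ℤ) * (|B| + 1) ≤ q n := by nlinarith
      classical
      have hE : ∃ k, (t : ℤ) * (|B| + 1) ≤ q k := ⟨n, hlt⟩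
      have hs := Nat.find_spec hE
      have hup : q (Nat.find hE) < ((t : ℤ) + 1) * (|B| + 1) := by
        rcases Nat.eq_zero_or_eq_succ_pred (Nat.find hE) with h | h
        · rw [h, h0]
          positivity
        · have h1 := Nat.find_min hE (m := (Nat.find hE).pred) (by omega)
          have h2 := Nat.find_min' hE hlt
          have h3 := (abs_le.1 (hB (Nat.find hE).pred (by omega))).2
          rw [← Nat.succ_eq_add_one, ← h] at h3
          nlinarith
      refine ⟨Nat.find hE, lt_of_le_of_ne (Nat.find_min' hE hlt) fun h => ?_, hs, hup⟩
      rw [h] at hup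
      nlinarith
    choose κ hκn hκl hκu using hex
    have := Fintype.ofFinite K
    obtain ⟨a, b, hab, hst⟩ := Fintype.exists_ne_map_eq_of_card_lt (fun t => st (κ t))
      (by simp [Nat.card_eq_fintype_card])
    have hq : ∀ a b, a < b → q (κ a) < q (κ b) := by
      intro a b hab
      have h1 : ((a : ℕ) : ℤ) + 1 ≤ ((b : ℕ) : ℤ) := by
        have : (a : ℕ) < b := hab
        omega
      nlinarith [hκu a, hκl b]
    have hq' : q (κ a) ≠ q (κ b) := by
      rcases lt_or_gt_of_ne hab with h | h
      · exact (hq _ _ h).ne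
      · exact (hq _ _ h).ne'
    rcases lt_trichotomy (κ a) (κ b) with h | h | h
    · exact ⟨_, _, h, hκn _, hst, hq'⟩
    · exact absurd (congrArg q h) hq'
    · exact ⟨_, _, h, hκn _, hst.symm, hq'.symm⟩
  refine ⟨(Nat.card K + 1) * (|B| + 1), fun n q st h0 hB hn => ?_⟩
  rcases lt_abs.1 hn with h | h
  · exact key n q st h0 hB h
  · obtain ⟨k, l, h1, h2, h3, h4⟩ := key n (fun k => - q k) st (by simp [h0])
      (fun k hk => by rw [← abs_neg]; convert hB k hk using 2; ring) h
    exact ⟨k, l, h1, h2, h3, fun h => h4 (by simp [h])⟩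
section Pumping

variable {G L : Type*} [Group G]

/-- The data of a partial labelling `P` of `G` which can be pumped along `g`: the set `A` is mapped
into itself by `g`, has a boundary that is bounded with respect to `π` (where `r` is a
left-invariant adjacency relation), and `P` looks the same at the boundaries of `A` and `g • A`. -/
structure IsPumpable (r : G → G → Prop) (π : G →* Multiplicative ℤ) (A : Set G) (g : G)
    (P : G → Option L) : Prop where
  symm : ∀ u v, r u v → r v u
  mul_left : ∀ h u v, r u v → r (h * u) (h * v)
  maps : ∀ u ∈ A, g * u ∈ A
  map_ne : (π g).toAdd ≠ 0
  finite_boundary : {u | ∃ v, r u v ∧ ¬ (u ∈ A ↔ v ∈ A)}.Finite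
  label_eq : ∀ u v, r u v → ¬ (u ∈ A ↔ v ∈ A) → P u = P (g * u)

/-- `v` lies in the translate of `A \ g • A` by `g ^ (-m)`. -/
def IsLevel (A : Set G) (g : G) (m : ℤ) (v : G) : Prop :=
  g ^ m * v ∈ A ∧ g ^ (m - 1) * v ∉ A

open Classical in
/-- The `g`-periodic labelling that agrees with `P` on `A \ g • A`. -/
noncomputable def pump (A : Set G) (g : G) (P : G → Option L) (v : G) : Option L :=
  if h : ∃ m, IsLevel A g m v then P (g ^ h.choose * v) else none

namespace IsPumpable

variable {r : G → G → Prop} {π : G →* Multiplicative ℤ} {A : Set G} {g : G} {P : G → Option L}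

theorem zpow_mul_mem_of_le (H : IsPumpable r π A g P) {m n : ℤ} (h : m ≤ n) {v : G}
    (hv : g ^ m * v ∈ A) : g ^ n * v ∈ A := by
  induction n, h using Int.leInduction with
  | base => exact hv
  | succ n _ ih =>
    rw [add_comm, zpow_add, zpow_one, mul_assoc]
    exact H.maps _ ih

theorem isLevel_unique (H : IsPumpable r π A g P) {m n : ℤ} {v : G} (hm : IsLevel A g m v)
    (hn : IsLevel A g n v) : m = n := by
  by_contra hne
  rcases lt_or_gt_of_ne hne with h | h
  · exact hn.2 (H.zpow_mul_mem_of_le (by omega) hm.1)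
  · exact hm.2 (H.zpow_mul_mem_of_le (by omega) hn.1)

theorem pump_eq (H : IsPumpable r π A g P) {m : ℤ} {v : G} (hm : IsLevel A g m v) :
    pump A g P v = P (g ^ m * v) := by
  have h : ∃ m, IsLevel A g m v := ⟨m, hm⟩
  rw [pump, dif_pos h, H.isLevel_unique h.choose_spec hm]

theorem exists_isLevel_of_pump_eq_some {v : G} {l : L}
    (hv : pump A g P v = some l) : ∃ m, IsLevel A g m v := by
  by_contra h
  simp [pump, h] at hv

theorem exists_isLevel_mem_Ioc (H : IsPumpable r π A g P) {a b : ℤ} {v : G}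
    (ha : g ^ a * v ∉ A) (hb : g ^ b * v ∈ A) : ∃ m ∈ Set.Ioc a b, IsLevel A g m v := by
  classical
  have hab : a < b := by
    by_contra h
    exact ha (H.zpow_mul_mem_of_le (not_lt.1 h) hb)
  obtain ⟨m, hm, hmin⟩ := Int.exists_least_of_bdd (P := fun m => g ^ m * v ∈ A)
    ⟨a, fun z hz => by
      by_contra h
      exact ha (H.zpow_mul_mem_of_le (by omega) hz)⟩ ⟨b, hb⟩
  refine ⟨m, ⟨?_, hmin b hb⟩, hm, fun h => ?_⟩
  · by_contra h
    exact ha (H.zpow_mul_mem_of_le (not_lt.1 h) hm)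
  · have := hmin _ h
    omega

/-- The translates of the boundary of `A` that come near `v` have bounded index. -/
theorem exists_bound (H : IsPumpable r π A g P) : ∃ K : ℤ, ∀ (u v : G) (m : ℤ), r u v →
    ¬ (g ^ m * u ∈ A ↔ g ^ m * v ∈ A) → |m| ≤ |(π u).toAdd| + K := by
  obtain ⟨K, hK⟩ := (H.finite_boundary.image fun u => |(π u).toAdd|).bddAbove
  refine ⟨K, fun u v m huv hm => ?_⟩
  have h1 : |(π (g ^ m * u)).toAdd| ≤ K :=
    hK ⟨_, ⟨g ^ m * v, H.mul_left _ _ _ huv, hm⟩, rfl⟩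
  simp only [map_mul, map_zpow, toAdd_mul, toAdd_zpow, smul_eq_mul] at h1
  have h2 : |m| ≤ |m * (π g).toAdd| := by
    rw [abs_mul]
    exact le_mul_of_one_le_right (abs_nonneg _) (Int.one_le_abs H.map_ne)
  have h3 := abs_sub_abs_le_abs_sub (m * (π g).toAdd) (-(π u).toAdd)
  rw [sub_neg_eq_add, abs_neg] at h3
  linarith

theorem exists_isLevel (H : IsPumpable r π A g P) {u v : G} (huv : r u v)
    (h1 : ∃ m : ℤ, g ^ m * u ∈ A ∨ g ^ m * v ∈ A) (h2 : ∃ m : ℤ, g ^ m * u ∉ A ∨ g ^ m * v ∉ A) :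
    ∃ m, IsLevel A g m u := by
  obtain ⟨K, hK⟩ := H.exists_bound
  have hK' : ∀ m : ℤ, |(π u).toAdd| + K < |m| → (g ^ m * u ∈ A ↔ g ^ m * v ∈ A) := by
    intro m hm
    by_contra h
    exact absurd (hK u v m huv h) (not_le.2 hm)
  set N := |(π u).toAdd| + K
  obtain ⟨b, hb⟩ : ∃ b : ℤ, g ^ b * u ∈ A := by
    obtain ⟨m, hm | hm⟩ := h1
    · exact ⟨m, hm⟩
    · refine ⟨max m (N + 1), (hK' _ ?_).2 (H.zpow_mul_mem_of_le (le_max_left _ _) hm)⟩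
      have := le_max_right m (N + 1)
      have := le_abs_self (max m (N + 1))
      omega
  obtain ⟨a, ha⟩ : ∃ a : ℤ, g ^ a * u ∉ A := by
    obtain ⟨m, hm | hm⟩ := h2
    · exact ⟨m, hm⟩
    · refine ⟨min m (-N - 1), fun h => hm (H.zpow_mul_mem_of_le (min_le_left _ _) ((hK' _ ?_).1 h))⟩
      have := min_le_right m (-N - 1)
      have := neg_abs_le (min m (-N - 1))
      omega
  obtain ⟨m, -, hm⟩ := H.exists_isLevel_mem_Ioc ha hb
  exact ⟨m, hm⟩

theorem label_eq_of_separated (H : IsPumpable r π A g P) {u v : G} (huv : r u v) {m n : ℤ}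
    (hmn : m ≤ n) (h : ∀ k, m ≤ k → k < n → ¬ (g ^ k * u ∈ A ↔ g ^ k * v ∈ A)) :
    P (g ^ m * u) = P (g ^ n * u) := by
  induction n, hmn using Int.leInduction with
  | base => rfl
  | succ n hn ih =>
    rw [ih fun k h1 h2 => h k h1 (by omega),
      H.label_eq _ _ (H.mul_left (g ^ n) _ _ huv) (h n hn (by omega)), add_comm n, zpow_add,
      zpow_one, mul_assoc]

/-- On a pair of adjacent elements, the pumped labelling is a translate of the original one. -/
theorem pump_eq_of_adj (H : IsPumpable r π A g P) {u v : G} (huv : r u v) {m : ℤ}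
    (hm : IsLevel A g m u) : pump A g P v = P (g ^ m * v) := by
  have hvu := H.symm _ _ huv
  obtain ⟨n, hn⟩ := H.exists_isLevel hvu ⟨m, Or.inr hm.1⟩ ⟨m - 1, Or.inr hm.2⟩
  rw [H.pump_eq hn]
  rcases le_total m n with h | h
  · refine (H.label_eq_of_separated hvu h fun k h1 h2 hk => ?_).symm
    exact hn.2 (H.zpow_mul_mem_of_le (by omega) (hk.2 (H.zpow_mul_mem_of_le h1 hm.1)))
  · refine H.label_eq_of_separated hvu h fun k h1 h2 hk => ?_
    exact hm.2 (H.zpow_mul_mem_of_le (by omega) (hk.1 (H.zpow_mul_mem_of_le h1 hn.1)))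

/-- Near the boundary of `A`, the pumped labelling is the original one. -/
theorem pump_eq_of_separated (H : IsPumpable r π A g P) {u v : G} (huv : r u v)
    (hs : ¬ (u ∈ A ↔ v ∈ A)) : pump A g P u = P u := by
  have hs0 : ¬ (g ^ (0 : ℤ) * u ∈ A ↔ g ^ (0 : ℤ) * v ∈ A) := by simpa using hs
  obtain ⟨m, hm⟩ := H.exists_isLevel huv ⟨0, by tauto⟩ ⟨0, by tauto⟩
  have h0 : P u = P (g ^ (0 : ℤ) * u) := by simp
  rw [H.pump_eq hm, h0]
  rcases le_total m 0 with h | h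
  · refine H.label_eq_of_separated huv h fun k h1 h2 hk => ?_
    have := H.zpow_mul_mem_of_le h1 hm.1
    exact hs0 ⟨fun _ => H.zpow_mul_mem_of_le h2.le (hk.1 this),
      fun _ => H.zpow_mul_mem_of_le h2.le this⟩
  · refine (H.label_eq_of_separated huv h fun k h1 h2 hk => ?_).symm
    have h3 : g ^ k * u ∉ A := fun h => hm.2 (H.zpow_mul_mem_of_le (by omega) h)
    have h4 : g ^ k * v ∉ A := fun h => h3 (hk.2 h)
    exact hs0 ⟨fun h => (h3 (H.zpow_mul_mem_of_le h1 h)).elim,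
      fun h => (h4 (H.zpow_mul_mem_of_le h1 h)).elim⟩

end IsPumpable

end Pumping

/-- If a permutation increases a function with integer values in total over the finitely many
points where it changes, one of these points has an infinite orbit. -/
theorem Equiv.Perm.exists_injective_zpow_apply_of_sum_ne_zero {α : Type*} (f : Equiv.Perm α)
    (d : α → ℤ) (s : Finset α) (hs : ∀ v, d (f v) - d v ≠ 0 → v ∈ s)
    (hsum : ∑ v ∈ s, (d (f v) - d v) ≠ 0) :
    ∃ c, d (f c) - d c ≠ 0 ∧ Function.Injective fun k : ℤ => (f ^ k) c := by
  by_contra! hcon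
  have horb : ∀ c, d (f c) - d c ≠ 0 → (Set.range fun k : ℤ => (f ^ k) c).Finite := by
    intro c hc
    have h := hcon c hc
    rw [Function.Injective] at h
    push Not at h
    obtain ⟨a, b, hab, hne⟩ := h
    have hfix : ∃ n : ℤ, 0 < n ∧ (f ^ n) c = c := by
      have key : ∀ a b : ℤ, (f ^ a) c = (f ^ b) c → (f ^ (b - a)) c = c := by
        intro a b h
        rw [sub_eq_neg_add, zpow_add, Equiv.Perm.mul_apply, ← h, ← Equiv.Perm.mul_apply, ← zpow_add]
        simp
      rcases lt_or_gt_of_ne hne with h | h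
      · exact ⟨b - a, by omega, key a b hab⟩
      · exact ⟨a - b, by omega, key b a hab.symm⟩
    obtain ⟨n, hn, hfn⟩ := hfix
    refine ((Set.finite_Ico 0 n).image fun k : ℤ => (f ^ k) c).subset ?_
    rintro _ ⟨k, rfl⟩
    refine ⟨k % n, ⟨Int.emod_nonneg _ hn.ne', Int.emod_lt_of_pos _ hn⟩, ?_⟩
    have h1 : (f ^ (n * (k / n))) c = c := by
      rw [zpow_mul]
      exact Equiv.Perm.zpow_apply_eq_self_of_apply_eq_self hfn _
    change (f ^ (k % n)) c = (f ^ k) c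
    conv_rhs => rw [← Int.emod_add_mul_ediv k n, zpow_add, Equiv.Perm.mul_apply, h1]
  classical
  let Z : Set α := ⋃ c ∈ s.filter (fun c => d (f c) - d c ≠ 0), Set.range fun k : ℤ => (f ^ k) c
  have hZ : Z.Finite := (Finset.finite_toSet _).biUnion fun c hc =>
    horb c (Finset.mem_filter.1 hc).2
  have hZf : ∀ v, v ∈ Z ↔ f v ∈ Z := by
    intro v
    simp only [Z, Set.mem_iUnion, Set.mem_range]
    constructor
    · rintro ⟨c, hc, k, hk⟩
      refine ⟨c, hc, k + 1, ?_⟩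
      rw [add_comm, zpow_add, Equiv.Perm.mul_apply, hk]
      simp
    · rintro ⟨c, hc, k, hk⟩
      refine ⟨c, hc, k - 1, ?_⟩
      rw [sub_eq_neg_add, zpow_add, Equiv.Perm.mul_apply, hk]
      simp
  have h0 : ∑ v ∈ hZ.toFinset, (d (f v) - d v) = 0 := by
    rw [Finset.sum_sub_distrib, sub_eq_zero]
    exact Finset.sum_equiv f (fun v => by simpa using hZf v) fun _ _ => rfl
  apply hsum
  rw [← h0]
  refine Finset.sum_bij_ne_zero (fun v _ _ => v) ?_ (by simp) ?_ (by simp)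
  · intro v hv hne
    rw [Set.Finite.mem_toFinset]
    exact Set.mem_biUnion (Finset.mem_filter.2 ⟨hv, hne⟩) ⟨0, by simp⟩
  · intro v _ hne
    exact ⟨v, hs v hne, hne, rfl⟩

theorem Equiv.Perm.zpow_apply_iff_of_forall {α : Type*} (f : Equiv.Perm α) (c : α) (p : α → Prop)
    (hp : ∀ k : ℤ, p (f ((f ^ k) c)) ↔ p ((f ^ k) c)) (k : ℤ) : p ((f ^ k) c) ↔ p c := by
  have hs : ∀ k : ℤ, (f ^ (k + 1)) c = f ((f ^ k) c) := fun k => by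
    rw [add_comm, zpow_add, zpow_one, Equiv.Perm.mul_apply]
  induction k using Int.induction_on with
  | zero => simp
  | succ n ih => exact hs n ▸ (hp n).trans ih
  | pred n ih =>
    rw [← hp, ← hs, sub_add_cancel]
    exact ih

section Snake

variable {σ C₀ G : Type} [Group G]

/-- Adjacency of group elements with respect to the memory set of a directed tileset. -/
def DirTileset.Adj (Θ : DirTileset σ C₀) (ε : FreeGroup σ →* G) (u v : G) : Prop :=
  ∃ s ∈ Θ.S', v = u * ε s ∨ u = v * ε s

/-- A label records the direction in which a snake enters a vertex, and the colour there. -/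
abbrev DirTileset.Label (Θ : DirTileset σ C₀) : Type := ↥Θ.S' × ↥Θ.C

/-- `P` is the labelling of `G` by the segment of the snake `(ω, x)` between times `a` and `b`. -/
def IsTrace (Θ : DirTileset σ C₀) (ω : ℤ → G) (x : ℤ → C₀ × FreeGroup σ) (a b : ℤ)
    (P : G → Option Θ.Label) : Prop :=
  ∀ u l, P u = some l ↔
    ∃ k, a ≤ k ∧ k ≤ b ∧ ω k = u ∧ l.1.1 = (x (k - 1)).2 ∧ l.2.1 = x k

variable {ε : FreeGroup σ →* G} {Θ : DirTileset σ C₀} {ω : ℤ → G} {x : ℤ → C₀ × FreeGroup σ}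
  {a b : ℤ} {P : G → Option Θ.Label}

theorem IsInfSnake.exists_isTrace (hω : IsInfSnake ε Θ ω x) (a b : ℤ) :
    ∃ P, IsTrace Θ ω x a b P := by
  classical
  refine ⟨fun u => if h : ∃ k, a ≤ k ∧ k ≤ b ∧ ω k = u then
    some (⟨(x (h.choose - 1)).2, Θ.mem_S' _ (hω.2.1 _)⟩, ⟨x h.choose, hω.2.1 _⟩) else none,
    fun u l => ?_⟩
  dsimp only
  constructor
  · intro h
    split at h
    · rename_i hk
      obtain rfl := Option.some.inj h
      exact ⟨hk.choose, hk.choose_spec.1, hk.choose_spec.2.1, hk.choose_spec.2.2, rfl, rfl⟩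
    · simp at h
  · rintro ⟨k, h1, h2, h3, h4, h5⟩
    have hk : ∃ k, a ≤ k ∧ k ≤ b ∧ ω k = u := ⟨k, h1, h2, h3⟩
    have : hk.choose = k := hω.1 (hk.choose_spec.2.2.trans h3.symm)
    rw [dif_pos hk, this, Option.some.injEq]
    exact Prod.ext (Subtype.ext h4.symm) (Subtype.ext h5.symm)

theorem IsInfSnake.eq_some_of_isTrace (hω : IsInfSnake ε Θ ω x) (hP : IsTrace Θ ω x a b P) {k : ℤ}
    (h1 : a ≤ k) (h2 : k ≤ b) : ∃ l, P (ω k) = some l ∧ l.1.1 = (x (k - 1)).2 ∧ l.2.1 = x k :=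
  ⟨(⟨(x (k - 1)).2, Θ.mem_S' _ (hω.2.1 _)⟩, ⟨x k, hω.2.1 _⟩),
    (hP _ _).2 ⟨k, h1, h2, rfl, rfl, rfl⟩, rfl, rfl⟩

/-- A snake segment that crosses from the complement of `A` into `g • A`, and looks the same at the
boundaries of `A` and `g • A`, can be pumped to an unbounded snake. -/
theorem exists_unbounded_snake_of_isPumpable {π : G →* Multiplicative ℤ}
    (hω : IsInfSnake ε Θ ω x) (hab : a ≤ b) (hP : IsTrace Θ ω x a b P) {A : Set G} {g : G}
    (H : IsPumpable (Θ.Adj ε) π A g P) (ha : ω a ∉ A) (hb : g⁻¹ * ω b ∈ A) :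
    ∃ (ω : ℤ → G) (x : ℤ → C₀ × FreeGroup σ), IsInfSnake ε Θ ω x ∧
      ∀ R : ℕ, ∃ i : ℤ, (R : ℤ) < |Multiplicative.toAdd (π (ω i))| := by
  classical
  have hadj : ∀ (v : G) (s : ↥Θ.S'), Θ.Adj ε v (v * ε s) := fun v s => ⟨s, s.2, Or.inl rfl⟩
  have hadj' : ∀ (v : G) (s : ↥Θ.S'), Θ.Adj ε v (v * (ε s)⁻¹) :=
    fun v s => ⟨s, s.2, Or.inr (by simp)⟩
  have hcol : ∀ c : ↥Θ.C, c.1.2 ∈ Θ.S' := fun c => Θ.mem_S' _ c.2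
  have hstep : ∀ (v : G) (m : ℤ), g⁻¹ * (g ^ m * v) = g ^ (m - 1) * v := fun v m => by
    rw [← mul_assoc, ← zpow_neg_one, ← zpow_add, neg_add_eq_sub]
  set Q := pump A g P
  have hnext : ∀ v l, Q v = some l → ∃ l', Q (v * ε l.2.1.2) = some l' ∧ l'.1.1 = l.2.1.2 := by
    intro v l hl
    obtain ⟨m, hm⟩ := IsPumpable.exists_isLevel_of_pump_eq_some hl
    have h1 : P (g ^ m * v) = some l := by rw [← H.pump_eq hm]; exact hl
    obtain ⟨k, hak, hkb, hk, -, hc⟩ := (hP _ _).1 h1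
    have hkb' : k ≠ b := by
      rintro rfl
      exact hm.2 (by rw [← hstep, ← hk]; exact hb)
    obtain ⟨l', hl', h2, -⟩ := hω.eq_some_of_isTrace hP (k := k + 1) (by omega) (by omega)
    refine ⟨l', ?_, ?_⟩
    · rw [← hl', hω.2.2.1, hk, ← hc, mul_assoc]
      exact H.pump_eq_of_adj (hadj v ⟨_, hcol l.2⟩) hm
    · rw [h2, hc, add_sub_cancel_right]
  have hprev : ∀ v l, Q v = some l →
      ∃ l', Q (v * (ε l.1.1)⁻¹) = some l' ∧ l'.2.1.2 = l.1.1 := by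
    intro v l hl
    obtain ⟨m, hm⟩ := IsPumpable.exists_isLevel_of_pump_eq_some hl
    have h1 : P (g ^ m * v) = some l := by rw [← H.pump_eq hm]; exact hl
    obtain ⟨k, hak, hkb, hk, hin, -⟩ := (hP _ _).1 h1
    have hka : k ≠ a := by
      rintro rfl
      exact ha (by rw [hk]; exact hm.1)
    obtain ⟨l', hl', -, h2⟩ := hω.eq_some_of_isTrace hP (k := k - 1) (by omega) (by omega)
    have h3 := hω.2.2.1 (k - 1)
    rw [sub_add_cancel] at h3
    refine ⟨l', ?_, ?_⟩
    · have h4 : ω (k - 1) = g ^ m * (v * (ε l.1.1)⁻¹) := by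
        rw [← mul_assoc, ← hk, hin, h3, mul_inv_cancel_right]
      rw [← hl', h4]
      exact H.pump_eq_of_adj (hadj' v l.1) hm
    · rw [h2, hin]
  let nxt : G → G := fun v => (Q v).elim v fun l => v * ε l.2.1.2
  let prv : G → G := fun v => (Q v).elim v fun l => v * (ε l.1.1)⁻¹
  have hnxt : ∀ v l, Q v = some l → nxt v = v * ε l.2.1.2 := fun v l hv => by
    simp only [nxt, hv, Option.elim_some]
  have hprv : ∀ v l, Q v = some l → prv v = v * (ε l.1.1)⁻¹ := fun v l hv => by
    simp only [prv, hv, Option.elim_some]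
  have hnxt0 : ∀ v, Q v = none → nxt v = v := fun v hv => by
    simp only [nxt, hv, Option.elim_none]
  have hprv0 : ∀ v, Q v = none → prv v = v := fun v hv => by
    simp only [prv, hv, Option.elim_none]
  let f : Equiv.Perm G :=
    { toFun := nxt
      invFun := prv
      left_inv := fun v => by
        cases hv : Q v with
        | none => rw [hnxt0 v hv, hprv0 v hv]
        | some l =>
          obtain ⟨l', h1, h2⟩ := hnext v l hv
          rw [hnxt v l hv, hprv _ l' h1, h2, mul_inv_cancel_right]
      right_inv := fun v => by
        cases hv : Q v with
        | none => rw [hprv0 v hv, hnxt0 v hv]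
        | some l =>
          obtain ⟨l', h1, h2⟩ := hprev v l hv
          rw [hprv v l hv, hnxt _ l' h1, h2, inv_mul_cancel_right] }
  have hf : ∀ v l, Q v = some l → f v = v * ε l.2.1.2 := hnxt
  have hf0 : ∀ v, Q v = none → f v = v := hnxt0
  have hfadj : ∀ v, Q v ≠ none → Θ.Adj ε v (f v) := fun v hv => by
    obtain ⟨l, hl⟩ := Option.ne_none_iff_exists'.1 hv
    rw [hf v l hl]
    exact hadj v ⟨_, hcol l.2⟩
  have hQf : ∀ v, Q (f v) ≠ none ↔ Q v ≠ none := by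
    intro v
    cases hv : Q v with
    | none => simp [hf0 v hv, hv]
    | some l =>
      obtain ⟨l', h1, -⟩ := hnext v l hv
      simp [hf v l hv, h1]
  -- crossings of the boundary of `A`
  let d : G → ℤ := fun v => if v ∈ A then 1 else 0
  have hd : ∀ u v, d u - d v ≠ 0 ↔ ¬ (v ∈ A ↔ u ∈ A) := by
    intro u v
    by_cases hu : u ∈ A <;> by_cases hv : v ∈ A <;> simp [d, hu, hv]
  have hdQ : ∀ v, d (f v) - d v ≠ 0 → Q v ≠ none := fun v hv h => hv (by rw [hf0 v h, sub_self])
  have hcross : ∀ v, d (f v) - d v ≠ 0 → ∃ k, a ≤ k ∧ k < b ∧ ω k = v ∧ ω (k + 1) = f v := by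
    intro v hv
    have hQv := hdQ v hv
    have hs := (hd _ _).1 hv
    have hQ1 : Q v = P v := H.pump_eq_of_separated (hfadj v hQv) hs
    have hQ2 : Q (f v) = P (f v) :=
      H.pump_eq_of_separated (H.symm _ _ (hfadj v hQv)) fun h => hs h.symm
    obtain ⟨l, hl⟩ := Option.ne_none_iff_exists'.1 hQv
    obtain ⟨l', hl'⟩ := Option.ne_none_iff_exists'.1 ((hQf v).2 hQv)
    obtain ⟨k, h1, h2, h3, -, h4⟩ := (hP _ _).1 (hQ1 ▸ hl)
    obtain ⟨k', h1', h2', h3', -⟩ := (hP _ _).1 (hQ2 ▸ hl')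
    have h5 : ω (k + 1) = f v := by rw [hω.2.2.1, hf v l hl, h3, h4]
    have : k + 1 = k' := hω.1 (h5.trans h3'.symm)
    exact ⟨k, h1, by omega, h3, h5⟩
  have hcross' : ∀ k, a ≤ k → k < b → d (ω (k + 1)) - d (ω k) ≠ 0 → f (ω k) = ω (k + 1) := by
    intro k h1 h2 h3
    have hs := (hd _ _).1 h3
    obtain ⟨l, hl, -, hc⟩ := hω.eq_some_of_isTrace hP h1 h2.le
    have hQ : Q (ω k) = P (ω k) := by
      refine H.pump_eq_of_separated (v := ω (k + 1)) ?_ hs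
      rw [hω.2.2.1]
      exact hadj _ ⟨_, Θ.mem_S' _ (hω.2.1 k)⟩
    rw [hf _ l (hQ.trans hl), hω.2.2.1, hc]
  have hsum : ∑ v ∈ (Finset.Ico a b).image ω, (d (f v) - d v) = 1 := by
    have h1 : ∀ n : ℤ, a ≤ n → ∑ k ∈ Finset.Ico a n, (d (ω (k + 1)) - d (ω k)) =
        d (ω n) - d (ω a) := by
      intro n hn
      induction n, hn using Int.leInduction with
      | base => simp
      | succ n hn ih =>
        rw [← Finset.insert_Ico_right_eq_Ico_add_one hn, Finset.sum_insert (by simp), ih]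
        ring
    have h2 : d (ω b) - d (ω a) = 1 := by
      have : ω b ∈ A := by simpa using H.maps _ hb
      simp [d, ha, this]
    rw [← h2, ← h1 b hab, Finset.sum_image hω.1.injOn]
    refine Finset.sum_congr rfl fun k hk => ?_
    rw [Finset.mem_Ico] at hk
    by_cases h3 : d (ω (k + 1)) - d (ω k) = 0
    · rw [h3]
      by_contra h4
      obtain ⟨k', -, -, h5, h6⟩ := hcross _ h4
      obtain rfl := hω.1 h5
      rw [← h6] at h4
      exact h4 h3
    · rw [hcross' k hk.1 hk.2 h3]
  obtain ⟨c, hc, hinj⟩ := f.exists_injective_zpow_apply_of_sum_ne_zero d _ (fun v hv => by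
    obtain ⟨k, h1, h2, h3, -⟩ := hcross v hv
    exact Finset.mem_image.2 ⟨k, Finset.mem_Ico.2 ⟨h1, h2⟩, h3⟩) (by rw [hsum]; exact one_ne_zero)
  have hQc : ∀ k : ℤ, Q ((f ^ k) c) ≠ none := fun k =>
    (f.zpow_apply_iff_of_forall c (fun v => Q v ≠ none) (fun k => hQf _) k).2 (hdQ c hc)
  choose l hl using fun k => Option.ne_none_iff_exists'.1 (hQc k)
  refine ⟨fun k => (f ^ k) c, fun k => (l k).2.1, ⟨hinj, fun k => (l k).2.2, fun k => ?_, ?_⟩, ?_⟩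
  · change (f ^ (k + 1)) c = _
    rw [add_comm, zpow_add, zpow_one, Equiv.Perm.mul_apply, hf _ _ (hl k)]
  · intro i j s hs hij
    obtain ⟨m, hm⟩ := IsPumpable.exists_isLevel_of_pump_eq_some (hl i)
    have h1 : P (g ^ m * (f ^ i) c) = some (l i) := by rw [← H.pump_eq hm]; exact hl i
    have h2 : P (g ^ m * (f ^ j) c) = some (l j) := by
      rw [← H.pump_eq_of_adj ⟨s, hs, Or.inl hij⟩ hm]
      exact hl j
    obtain ⟨k, -, -, h3, -, h4⟩ := (hP _ _).1 h1
    obtain ⟨k', -, -, h3', -, h4'⟩ := (hP _ _).1 h2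
    change ((l i).2.1, s, (l j).2.1) ∈ Θ.D
    rw [h4, h4']
    refine hω.2.2.2 k k' s hs ?_
    change (f ^ j) c = (f ^ i) c * ε s at hij
    rw [h3, h3', hij, mul_assoc]
  · by_contra! hbdd
    obtain ⟨R, hR⟩ := hbdd
    obtain ⟨K, hK⟩ := H.exists_bound
    have hconst : ∀ (n : ℤ), (R : ℤ) + K < |n| → ∀ k : ℤ,
        g ^ n * (f ^ k) c ∈ A ↔ g ^ n * c ∈ A := by
      intro n hn k
      refine f.zpow_apply_iff_of_forall c (fun v => g ^ n * v ∈ A) (fun k => ?_) k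
      by_contra h
      have h1 := hK _ _ n (hfadj _ (hQc k)) fun h' => h h'.symm
      have h2 := hR k
      linarith
    set N : ℤ := |(R : ℤ) + K| + 1
    have hN0 := abs_nonneg ((R : ℤ) + K)
    have hN : (R : ℤ) + K < N := by
      have := le_abs_self ((R : ℤ) + K)
      omega
    have hconst1 := hconst N (hN.trans_le (le_abs_self N))
    have hconst2 := hconst (-N) (by rw [abs_neg]; exact hN.trans_le (le_abs_self N))
    have hs := (hd _ _).1 hc
    have hup : ∀ k : ℤ, g ^ N * (f ^ k) c ∈ A := by
      have key : ∀ v, v ∈ A → g ^ N * v ∈ A := fun v hv =>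
        H.zpow_mul_mem_of_le (m := 0) (by omega) (by simpa using hv)
      have h0 : g ^ N * c ∈ A := by
        by_cases h : c ∈ A
        · exact key c h
        · rw [← hconst1 1, zpow_one]
          exact key _ (by tauto)
      exact fun k => (hconst1 k).2 h0
    have hdown : ∀ k : ℤ, g ^ (-N) * (f ^ k) c ∉ A := by
      have key : ∀ v, g ^ (-N) * v ∈ A → v ∈ A := fun v hv => by
        simpa using H.zpow_mul_mem_of_le (n := 0) (by omega) hv
      have h0 : g ^ (-N) * c ∉ A := by
        by_cases h : c ∈ A
        · rw [← hconst2 1, zpow_one]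
          exact fun h' => hs ⟨fun _ => key _ h', fun _ => h⟩
        · exact fun h' => h (key _ h')
      exact fun k h => h0 ((hconst2 k).1 h)
    have hfin : (Set.image2 (fun m k : ℤ => g ^ (-m) * ω k) (Set.Ioc (-N) N)
        (Set.Icc a b)).Finite := (Set.finite_Ioc _ _).image2 _ (Set.finite_Icc _ _)
    refine Set.infinite_range_of_injective hinj (hfin.subset ?_)
    rintro _ ⟨k, rfl⟩
    obtain ⟨m, hmN, hm⟩ := H.exists_isLevel_mem_Ioc (hdown k) (hup k)
    have h1 : P (g ^ m * (f ^ k) c) = some (l k) := by rw [← H.pump_eq hm]; exact hl k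
    obtain ⟨i, h2, h3, h4, -⟩ := (hP _ _).1 h1
    exact ⟨m, hmN, i, ⟨h2, h3⟩, by simp [h4]⟩

end Snake

section Cut

variable {X G L : Type*} [DecidableEq X] [Group G]

/-- The boundary of a half-space of a virtually free group is finite. -/
theorem FreeGroup.finite_boundary_preimage_startsWith {φ : FreeGroup X →* G} {p : G → FreeGroup X}
    {τ : G → G} (hτ : (Set.range τ).Finite) (hpτ : ∀ u, φ (p u) * τ u = u)
    (hp : ∀ h u, p (φ h * u) = h * p u) (y : X × Bool) (t : G) :
    {u | ¬ (p u ∈ startsWith y ↔ p (u * t) ∈ startsWith y)}.Finite := by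
  refine (hτ.biUnion fun c _ =>
    (finite_startsWith_boundary y (p (c * t))).image fun w => φ w * c).subset fun u hu => ?_
  refine Set.mem_biUnion ⟨u, rfl⟩ ⟨p u, ?_, hpτ u⟩
  have h : p (u * t) = p u * p (τ u * t) := by
    rw [← hp, ← mul_assoc, hpτ]
  rw [Set.mem_ofPred_eq, h] at hu
  exact hu

variable {φ : FreeGroup X →* G} {p : G → FreeGroup X} {w : List (X × Bool)}

theorem FreeGroup.take_succ_isPrefix_toWord_iff (hp : ∀ h u, p (φ h * u) = h * p u)
    (hw : IsReduced w) {k : ℕ} {y : X × Bool} (hk : w[k]? = some y) (u : G) :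
    w.take (k + 1) <+: (p u).toWord ↔ p ((φ (mk (w.take k)))⁻¹ * u) ∈ startsWith y := by
  have h : w.take (k + 1) = w.take k ++ [y] := by
    rw [List.take_add_one, hk, Option.toList_some]
  rw [← _root_.map_inv, hp, inv_mk_mul_mem_startsWith_iff, h]
  exact h ▸ hw.infix (List.take_prefix _ _).isInfix

/-- If the labelling `P` looks the same near two of the cuts that separate `1` from a reduced word
`w`, it can be pumped. -/
theorem isPumpable_of_take {r : G → G → Prop} {π : G →* Multiplicative ℤ} {P : G → Option L}
    (hp : ∀ h u, p (φ h * u) = h * p u) (hsymm : ∀ u v, r u v → r v u)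
    (hmul : ∀ h u v, r u v → r (h * u) (h * v)) {k l : ℕ} {y : X × Bool}
    (hfin : {u | ∃ v, r u v ∧
      ¬ (p u ∈ FreeGroup.startsWith y ↔ p v ∈ FreeGroup.startsWith y)}.Finite)
    (hw : FreeGroup.IsReduced w) (hkl : k ≤ l) (hk : w[k]? = some y) (hl : w[l]? = some y)
    (hne : (π (φ (FreeGroup.mk (w.take k)))).toAdd ≠ (π (φ (FreeGroup.mk (w.take l)))).toAdd)
    (hP : ∀ u v, r u v → ¬ (p u ∈ FreeGroup.startsWith y ↔ p v ∈ FreeGroup.startsWith y) →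
      P (φ (FreeGroup.mk (w.take k)) * u) = P (φ (FreeGroup.mk (w.take l)) * u)) :
    IsPumpable r π {u | w.take (k + 1) <+: (p u).toWord}
      (φ (FreeGroup.mk (w.take l)) * (φ (FreeGroup.mk (w.take k)))⁻¹) P := by
  have hA := FreeGroup.take_succ_isPrefix_toWord_iff hp hw hk
  have hB := FreeGroup.take_succ_isPrefix_toWord_iff hp hw hl
  set a := φ (FreeGroup.mk (w.take k))
  set b := φ (FreeGroup.mk (w.take l))
  refine ⟨hsymm, hmul, fun u hu => ?_, ?_, ?_, fun u v huv h => ?_⟩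
  · have h1 : w.take (l + 1) <+: (p (b * a⁻¹ * u)).toWord := by
      rw [hB, mul_assoc, inv_mul_cancel_left]
      exact (hA u).1 hu
    exact (List.take_prefix_take_left (by omega)).trans h1
  · intro h
    rw [map_mul, map_inv, toAdd_mul, toAdd_inv, add_neg_eq_zero] at h
    exact hne h.symm
  · refine (hfin.image fun u => a * u).subset ?_
    rintro u ⟨v, huv, h⟩
    refine ⟨a⁻¹ * u, ⟨a⁻¹ * v, hmul _ _ _ huv, ?_⟩, mul_inv_cancel_left _ _⟩
    rw [← hA, ← hA]
    exact h
  · have h1 := hP _ _ (hmul a⁻¹ _ _ huv) (by rw [← hA, ← hA]; exact h)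
    rw [mul_inv_cancel_left] at h1
    rw [h1, mul_assoc]

end Cut

section Adj

variable {σ C₀ G : Type} [Group G] {ε : FreeGroup σ →* G} {Θ : DirTileset σ C₀}

theorem DirTileset.Adj.symm {u v : G} (h : Θ.Adj ε u v) : Θ.Adj ε v u :=
  let ⟨s, hs, h⟩ := h
  ⟨s, hs, h.symm⟩

theorem DirTileset.Adj.mul_left (h : G) {u v : G} (huv : Θ.Adj ε u v) :
    Θ.Adj ε (h * u) (h * v) := by
  obtain ⟨s, hs, rfl | rfl⟩ := huv
  · exact ⟨s, hs, Or.inl (mul_assoc _ _ _).symm⟩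
  · exact ⟨s, hs, Or.inr (mul_assoc _ _ _).symm⟩

theorem DirTileset.finite_boundary (A : Set G)
    (hA : ∀ t, {u | ¬ (u ∈ A ↔ u * t ∈ A)}.Finite) :
    {u | ∃ v, Θ.Adj ε u v ∧ ¬ (u ∈ A ↔ v ∈ A)}.Finite := by
  refine (Θ.S'.finite_toSet.biUnion fun s _ => (hA (ε s)).union (hA (ε s)⁻¹)).subset ?_
  rintro u ⟨v, ⟨s, hs, rfl | rfl⟩, h⟩
  · exact Set.mem_biUnion hs (Or.inl h)
  · exact Set.mem_biUnion hs (Or.inr (by simpa using h))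

theorem IsInfSnake.mul_left {ω : ℤ → G} {x : ℤ → C₀ × FreeGroup σ} (hω : IsInfSnake ε Θ ω x)
    (h : G) : IsInfSnake ε Θ (fun k => h * ω k) x := by
  refine ⟨(mul_right_injective h).comp hω.1, hω.2.1, fun k => ?_, fun i j s hs hij => ?_⟩
  · change h * ω (k + 1) = h * ω k * _
    rw [hω.2.2.1, mul_assoc]
  · refine hω.2.2.2 i j s hs ?_
    change h * ω j = h * ω i * _ at hij
    rwa [mul_assoc, mul_right_inj] at hij

end Adj

/-- A virtually free, finitely generated group is up to finite index a free group of finite rank. -/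
theorem exists_freeGroup_hom_of_virtually_free {G : Type} [Group G] [Group.FG G]
    (hVF : ∃ H : Subgroup G, H.FiniteIndex ∧ IsFreeGroup H) :
    ∃ (X : Type) (_ : Finite X) (φ : FreeGroup X →* G),
      Function.Injective φ ∧ φ.range.FiniteIndex := by
  obtain ⟨H, hfi, hfree⟩ := hVF
  have hfg : Group.FG H := Subgroup.fg_of_index_ne_zero H
  let e := IsFreeGroup.mulEquiv H
  have : Group.FG (FreeGroup (IsFreeGroup.Generators H)) :=
    Group.fg_of_surjective (f := e.symm.toMonoidHom) e.symm.surjective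
  refine ⟨_, FreeGroup.finite_of_fg, H.subtype.comp e.toMonoidHom,
    H.subtype_injective.comp e.injective, ?_⟩
  have h : (H.subtype.comp e.toMonoidHom).range = H := by
    rw [MonoidHom.range_comp, MonoidHom.range_eq_top.2 e.surjective, ← MonoidHom.range_eq_map,
      H.range_subtype]
  rwa [h]

theorem exists_unbounded_snake_of_unbounded_diameters
    {σ C₀ G : Type} [Fintype σ] [Fintype C₀] [Group G]
    (hVF : ∃ H : Subgroup G, H.FiniteIndex ∧ IsFreeGroup H)
    (ε : FreeGroup σ →* G) (hε : Function.Surjective ε)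
    (π : G →* Multiplicative ℤ) (hπ : Function.Surjective π)
    (Θ : DirTileset σ C₀)
    (h : ∀ R : ℕ, ∃ (ω : ℤ → G) (x : ℤ → C₀ × FreeGroup σ),
      IsInfSnake ε Θ ω x ∧
      ∃ i j : ℤ, (R : ℤ) < |Multiplicative.toAdd (π (ω i)) - Multiplicative.toAdd (π (ω j))|) :
    ∃ (ω : ℤ → G) (x : ℤ → C₀ × FreeGroup σ),
      IsInfSnake ε Θ ω x ∧
      ∀ R : ℕ, ∃ i : ℤ, (R : ℤ) < |Multiplicative.toAdd (π (ω i))| := by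
  classical
  have : Group.FG G := Group.fg_of_surjective hε
  obtain ⟨X, hX, φ, hφ, hfi⟩ := exists_freeGroup_hom_of_virtually_free hVF
  obtain ⟨p, τ, hτ, hpτ, hp⟩ := exists_equivariant_retraction φ hφ hfi
  have hcut : ∀ y : X × Bool, {u | ∃ v, Θ.Adj ε u v ∧
      ¬ (p u ∈ FreeGroup.startsWith y ↔ p v ∈ FreeGroup.startsWith y)}.Finite := fun y =>
    Θ.finite_boundary (p ⁻¹' FreeGroup.startsWith y)
      (FreeGroup.finite_boundary_preimage_startsWith hτ hpτ hp y)
  let N : Set G := ⋃ y : X × Bool, {u | ∃ v, Θ.Adj ε u v ∧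
      ¬ (p u ∈ FreeGroup.startsWith y ↔ p v ∈ FreeGroup.startsWith y)}
  have hN : Finite N := (Set.finite_iUnion hcut).to_subtype
  obtain ⟨B, hB⟩ := (Set.finite_range fun x : X => |(π (φ (FreeGroup.of x))).toAdd|).bddAbove
  obtain ⟨T, hT⟩ := (hτ.image fun t => |(π t).toAdd|).bddAbove
  obtain ⟨N₀, hN₀⟩ := exists_eq_state_ne_value (K := Option (X × Bool) × (N → Option Θ.Label)) B
  -- the far apart times can be taken in increasing order
  obtain ⟨ω, x, hω, i, j, hij, hR⟩ : ∃ (ω : ℤ → G) (x : ℤ → C₀ × FreeGroup σ),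
      IsInfSnake ε Θ ω x ∧ ∃ i j : ℤ, i ≤ j ∧ p (ω i) = 1 ∧
        N₀ < |(π (φ (p (ω j)))).toAdd| := by
    obtain ⟨ω, x, hω, i, j, hR⟩ := h (N₀ + 2 * T).toNat
    have hR' := (Int.self_le_toNat (N₀ + 2 * T)).trans_lt hR
    wlog hij : i ≤ j generalizing i j
    · exact this j i (by rwa [abs_sub_comm]) (by rwa [abs_sub_comm]) (by omega)
    refine ⟨_, x, hω.mul_left (φ (p (ω i))⁻¹), i, j, hij, by rw [hp, inv_mul_cancel], ?_⟩
    have hπu : ∀ u, (π u).toAdd = (π (φ (p u))).toAdd + (π (τ u)).toAdd := fun u => by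
      rw [← toAdd_mul, ← map_mul, hpτ]
    have hTu : ∀ u, |(π (τ u)).toAdd| ≤ T := fun u => hT ⟨_, ⟨u, rfl⟩, rfl⟩
    rw [hp, map_mul, map_inv, map_mul, map_inv, toAdd_mul, toAdd_inv]
    rw [hπu (ω i), hπu (ω j)] at hR'
    have h1 := hTu (ω i)
    have h2 := hTu (ω j)
    grind
  obtain ⟨P, hP⟩ := hω.exists_isTrace i j
  set w := (p (ω j)).toWord with hwdef
  have hw : FreeGroup.IsReduced w := FreeGroup.isReduced_toWord
  have hstep : ∀ k (hk : k < w.length), |(π (φ (FreeGroup.mk (w.take (k + 1))))).toAdd -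
      (π (φ (FreeGroup.mk (w.take k)))).toAdd| ≤ B := by
    intro k hk
    have h1 : FreeGroup.mk (w.take (k + 1)) =
        FreeGroup.mk (w.take k) * FreeGroup.mk [w[k]] := by
      rw [FreeGroup.mul_mk, List.take_concat_get']
    have h2 := hB ⟨w[k].1, rfl⟩
    simp only [h1, map_mul, toAdd_mul, add_sub_cancel_left]
    rcases hwk : w[k] with ⟨c, b⟩
    rw [hwk] at h2
    cases b
    · have h3 : FreeGroup.mk [(c, false)] = (FreeGroup.of c)⁻¹ := rfl
      rwa [h3, map_inv, map_inv, toAdd_inv, abs_neg]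
    · exact h2
  obtain ⟨k, l, hkl, hln, hst, hne⟩ := hN₀ w.length
    (fun k => (π (φ (FreeGroup.mk (w.take k)))).toAdd)
    (fun k => (w[k]?, fun u => P (φ (FreeGroup.mk (w.take k)) * u)))
    (by simp [← FreeGroup.one_eq_mk]) hstep
    (by rw [List.take_length, hwdef, FreeGroup.mk_toWord]; exact hR.2)
  rw [Prod.mk.injEq] at hst
  obtain ⟨y, hy⟩ : ∃ y, w[l]? = some y := ⟨_, List.getElem?_eq_getElem hln⟩
  have H := isPumpable_of_take hp (fun _ _ => DirTileset.Adj.symm)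
    (fun g _ _ => DirTileset.Adj.mul_left g) (hcut y) hw hkl.le (hst.1.trans hy) hy hne
    fun u v huv hs => congrFun hst.2 ⟨u, Set.mem_iUnion.2 ⟨y, v, huv, hs⟩⟩
  refine exists_unbounded_snake_of_isPumpable hω hij hP H ?_ ?_
  · simp only [Set.mem_ofPred_eq, hR.1, FreeGroup.toWord_one, List.prefix_nil,
      List.take_eq_nil_iff]
    rintro (h | h)
    · omega
    · simp [h] at hln
  · rw [Set.mem_ofPred_eq, FreeGroup.take_succ_isPrefix_toWord_iff hp hw (hst.1.trans hy),
      mul_inv_rev, inv_inv, mul_assoc, inv_mul_cancel_left,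
      ← FreeGroup.take_succ_isPrefix_toWord_iff hp hw hy]
    exact List.take_prefix _ _
end
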